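/- arXiv:2305.05409 — 2 statements merged into one kernel-verified Lean document; each statement's English description precedes it below -/
import Mathlib

section
/- Let h : ℂ → ℝ be a smooth (C^∞) map and let E_h := { x + iy ∈ ℂ : h(x,y) = 0 }. If dh ≠ 0 at every point of E_h, then every totally real C²-smooth disc contained in M := E_h × ℂ ⊂ ℂ² is polynomially convex. -/
noncomputable section

/-- The polynomial (convex) hull of a set `K ⊆ ℂⁿ`:
`K̂ = { z : |p(z)| ≤ sup_K |p| for every holomorphic polynomial p }`. -/
def polyHull (n : ℕ) (K : Set (Fin n → ℂ)) : Set (Fin n → ℂ) :=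
  {z | ∀ p : MvPolynomial (Fin n) ℂ,
    ‖MvPolynomial.eval z p‖ ≤ sSup ((fun w => ‖MvPolynomial.eval w p‖) '' K)}

/-- A set `K ⊆ ℂⁿ` is polynomially convex if it equals its polynomial hull. -/
def PolyConvex (n : ℕ) (K : Set (Fin n → ℂ)) : Prop := polyHull n K = K

/-- A Runge domain in `ℂⁿ`: a domain on which every holomorphic function can be
approximated uniformly on compact subsets by holomorphic polynomials. -/
def RungeDomain (n : ℕ) (Ω : Set (Fin n → ℂ)) : Prop :=
  IsOpen Ω ∧ IsConnected Ω ∧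
  ∀ f : (Fin n → ℂ) → ℂ, DifferentiableOn ℂ f Ω →
    ∀ K : Set (Fin n → ℂ), K ⊆ Ω → IsCompact K → ∀ ε : ℝ, 0 < ε →
      ∃ p : MvPolynomial (Fin n) ℂ, ∀ z ∈ K, ‖f z - MvPolynomial.eval z p‖ ≤ ε

/-- `K ⊆ ℂⁿ` is a totally real `C²`-smooth disc: the image of the closed unit
disc in `ℝ²` under a `C²` embedding `φ` (defined on an open neighborhood `U` of
the closed disc) whose image is a totally real submanifold, i.e. at each point
the tangent plane `W = range (dφ)` satisfies `W ∩ i·W = {0}`. -/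
def TotallyRealDisc (n : ℕ) (K : Set (Fin n → ℂ)) : Prop :=
  ∃ (U : Set (ℝ × ℝ)) (φ : ℝ × ℝ → (Fin n → ℂ)),
    IsOpen U ∧ Metric.closedBall (0 : ℝ × ℝ) 1 ⊆ U ∧
    ContDiffOn ℝ 2 φ U ∧ Set.InjOn φ U ∧
    (∀ x ∈ U, Function.Injective (fderiv ℝ φ x)) ∧
    (∀ x ∈ U, ∀ v w : ℝ × ℝ,
      fderiv ℝ φ x v = Complex.I • fderiv ℝ φ x w → fderiv ℝ φ x v = 0) ∧
    K = φ '' Metric.closedBall (0 : ℝ × ℝ) 1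

namespace TotallyRealDiscHull

open Set Filter Topology

/-- `u` has a continuous logarithm on `s`. -/
def HasLogOn {X : Type*} [TopologicalSpace X] (u : X → ℂ) (s : Set X) : Prop :=
  ∃ l : X → ℂ, ContinuousOn l s ∧ ∀ x ∈ s, Complex.exp (l x) = u x

namespace HasLogOn

variable {X Y : Type*} [TopologicalSpace X] [TopologicalSpace Y] {u v : X → ℂ} {s t : Set X}

lemma congr (hu : HasLogOn u s) (h : ∀ x ∈ s, u x = v x) : HasLogOn v s := by
  obtain ⟨l, hl, hl'⟩ := hu
  exact ⟨l, hl, fun x hx => (hl' x hx).trans (h x hx)⟩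

lemma mono (hu : HasLogOn u s) (h : t ⊆ s) : HasLogOn u t := by
  obtain ⟨l, hl, hl'⟩ := hu
  exact ⟨l, hl.mono h, fun x hx => hl' x (h hx)⟩

lemma comp {w : Y → ℂ} {r : Set Y} (hw : HasLogOn w r) {f : X → Y} (hf : ContinuousOn f s)
    (hm : MapsTo f s r) : HasLogOn (w ∘ f) s := by
  obtain ⟨l, hl, hl'⟩ := hw
  exact ⟨l ∘ f, hl.comp hf hm, fun x hx => hl' _ (hm hx)⟩

lemma mul (hu : HasLogOn u s) (hv : HasLogOn v s) : HasLogOn (fun x => u x * v x) s := by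
  obtain ⟨l, hl, hl'⟩ := hu
  obtain ⟨m, hm, hm'⟩ := hv
  exact ⟨fun x => l x + m x, hl.add hm, fun x hx => by rw [Complex.exp_add, hl' x hx, hm' x hx]⟩

lemma const {c : ℂ} (hc : c ≠ 0) : HasLogOn (fun _ : X => c) s :=
  ⟨fun _ => Complex.log c, continuousOn_const, fun _ _ => Complex.exp_log hc⟩

lemma of_norm_sub_lt (hv : HasLogOn v s) (hu : ContinuousOn u s)
    (huv : ∀ x ∈ s, ‖u x - v x‖ < ‖v x‖) : HasLogOn u s := by
  obtain ⟨l, hl, hl'⟩ := hv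
  have h0 : ∀ x ∈ s, v x ≠ 0 := fun x hx => by rw [← hl' x hx]; exact Complex.exp_ne_zero _
  have key : ∀ x ∈ s, u x * Complex.exp (-l x) ∈ Complex.slitPlane := by
    intro x hx
    apply Complex.ball_one_subset_slitPlane
    rw [mem_ball_iff_norm, Complex.exp_neg, hl' x hx, ← div_eq_mul_inv,
      div_sub_one (h0 x hx), norm_div, div_lt_one (norm_pos_iff.2 (h0 x hx))]
    exact huv x hx
  refine ⟨fun x => l x + Complex.log (u x * Complex.exp (-l x)), ?_, fun x hx => ?_⟩
  · refine hl.add (ContinuousOn.clog ?_ key)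
    exact hu.mul (Complex.continuous_exp.comp_continuousOn hl.neg)
  · rw [Complex.exp_add, Complex.exp_log (Complex.slitPlane_ne_zero (key x hx)), mul_comm,
      mul_assoc,
      ← Complex.exp_add]
    simp

end HasLogOn

lemma exists_log_of_continuous {E : Type*} [NormedAddCommGroup E] [NormedSpace ℝ E] {u : E → ℂ}
    (hu : Continuous u) (h0 : ∀ x, u x ≠ 0) :
    ∃ l : E → ℂ, Continuous l ∧ ∀ x, Complex.exp (l x) = u x := by
  have hc : IsSimplyConnected (univ : Set E) :=
    have := (convex_univ (𝕜 := ℝ) (E := E)).contractibleSpace univ_nonempty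
    SimplyConnectedSpace.ofContractible (univ : Set E)
  obtain ⟨f, hf, hf'⟩ := Complex.exists_continuousOn_eqOn_exp_comp hc isOpen_univ
    hu.continuousOn (by simpa using h0)
  exact ⟨f, continuousOn_univ.1 hf, fun x => hf' (mem_univ x)⟩

lemma sub_const_of_exp_eq {X : Type*} [TopologicalSpace X] {s : Set X} (hs : IsPreconnected s)
    {f g : X → ℂ} (hf : ContinuousOn f s) (hg : ContinuousOn g s)
    (h : ∀ x ∈ s, Complex.exp (f x) = Complex.exp (g x)) {x y : X} (hx : x ∈ s) (hy : y ∈ s) :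
    f x - g x = f y - g y := by
  have hd : DiscreteTopology (AddSubgroup.zmultiples (2 * Real.pi * Complex.I)) :=
    NormedSpace.discreteTopology_zmultiples _
  obtain ⟨c, -, hc⟩ := hs.eqOn_const_of_mapsTo (f := fun x => f x - g x)
    (T := (AddSubgroup.zmultiples (2 * Real.pi * Complex.I) : Set ℂ)) ⟨hd⟩ (hf.sub hg)
    (fun x hx => by
      obtain ⟨n, hn⟩ := Complex.exp_eq_exp_iff_exists_int.1 (h x hx)
      simp only [SetLike.mem_coe, AddSubgroup.mem_zmultiples_iff]
      exact ⟨n, by rw [hn]; simp⟩) ⟨0, zero_mem _⟩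
  exact (hc hx).trans (hc hy).symm

lemma frontier_connectedComponentIn_subset {X : Set ℂ} (hX : IsClosed X) (a : ℂ) :
    frontier (connectedComponentIn Xᶜ a) ⊆ X := by
  intro x hx
  by_contra hxX
  have hO : IsOpen (connectedComponentIn Xᶜ x) := hX.isOpen_compl.connectedComponentIn
  obtain ⟨y, hy, hy'⟩ := mem_closure_iff.1 (frontier_subset_closure hx) _ hO
    (mem_connectedComponentIn hxX)
  have e1 := connectedComponentIn_eq hy
  have e2 := connectedComponentIn_eq hy'
  have hOa : IsOpen (connectedComponentIn Xᶜ a) := hX.isOpen_compl.connectedComponentIn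
  rw [hOa.frontier_eq] at hx
  exact hx.2 (by rw [e2, ← e1]; exact mem_connectedComponentIn hxX)

/-- A point `a` off a compact plane set such that `z - a` has a continuous logarithm lies in the
unbounded component of the complement. -/
lemma not_isBounded_of_hasLogOn {X : Set ℂ} (hX : IsCompact X) {a : ℂ} (ha : a ∉ X)
    (hlog : HasLogOn (fun z => z - a) X) : ¬ Bornology.IsBounded (connectedComponentIn Xᶜ a) := by
  intro hb
  set O := connectedComponentIn Xᶜ a with hOdef
  have hO : IsOpen O := hX.isClosed.isOpen_compl.connectedComponentIn
  have haO : a ∈ O := mem_connectedComponentIn ha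
  have hfr : frontier O ⊆ X := frontier_connectedComponentIn_subset hX.isClosed a
  obtain ⟨l, hl, hl'⟩ := hlog
  obtain ⟨L, hL⟩ := ContinuousMap.exists_restrict_eq (Y := ℂ) hX.isClosed
    ⟨X.domRestrict l, continuousOn_iff_continuous_domRestrict.1 hl⟩
  have hLX : ∀ x ∈ X, L x = l x := fun x hx => by
    have := congrArg (fun f => f ⟨x, hx⟩) hL
    simpa using this
  classical
  set G : ℂ → ℂ := fun z => if z ∈ O then (z - a) * Complex.exp (-L z) else 1 with hG
  have hGc : Continuous G := by
    refine Continuous.if (fun z hz => ?_) (by fun_prop) continuous_const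
    have hz' : z ∈ X := hfr hz
    rw [hLX z hz', ← show _ = z - a from hl' z hz', ← Complex.exp_add]; simp
  have hG0 : ∀ s : ℂ, G (a + Complex.exp s) ≠ 0 := by
    intro s
    simp only [hG]
    split_ifs <;> simp [Complex.exp_ne_zero]
  obtain ⟨m, hm, hm'⟩ := exists_log_of_continuous (u := fun s => G (a + Complex.exp s))
    (by fun_prop) hG0
  have hper : ∀ s : ℂ, Complex.exp (s + 2 * Real.pi * Complex.I) = Complex.exp s :=
    fun s => Complex.exp_periodic s
  have hD : ∀ s t : ℂ,
      m (s + 2 * Real.pi * Complex.I) - m s = m (t + 2 * Real.pi * Complex.I) - m t :=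
    fun s t => sub_const_of_exp_eq (s := univ) isPreconnected_univ
      (f := fun s => m (s + 2 * Real.pi * Complex.I)) (g := m) (by fun_prop) hm.continuousOn
      (fun x _ => by rw [hm', hm', hper]) (mem_univ s) (mem_univ t)
  obtain ⟨R, hR⟩ := hb.subset_closedBall a
  obtain ⟨ε, hε, hεO⟩ := Metric.isOpen_iff.1 hO a haO
  -- far away
  have h1 : ∃ s : ℂ, m (s + 2 * Real.pi * Complex.I) - m s = 0 := by
    have hconv : IsPreconnected {s : ℂ | Real.log (max R 1) < s.re} :=
      (convex_halfSpace_re_gt _).isPreconnected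
    have hs0 : ((Real.log (max R 1) + 1 : ℝ) : ℂ) ∈ {s : ℂ | Real.log (max R 1) < s.re} := by
      simp only [mem_ofPred_eq, Complex.ofReal_re]; linarith
    refine ⟨((Real.log (max R 1) + 1 : ℝ) : ℂ), ?_⟩
    have := sub_const_of_exp_eq hconv (f := m) (g := fun _ => 0) hm.continuousOn
      continuousOn_const (fun s hs => ?_)
      (x := ((Real.log (max R 1) + 1 : ℝ) : ℂ) + 2 * Real.pi * Complex.I)
      (y := ((Real.log (max R 1) + 1 : ℝ) : ℂ)) ?_ hs0
    · simpa [sub_eq_zero] using this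
    · rw [hm', Complex.exp_zero]
      have : a + Complex.exp s ∉ O := fun hh => by
        have := hR hh
        rw [mem_closedBall_iff_norm, add_sub_cancel_left, Complex.norm_exp] at this
        have h2 : max R 1 < Real.exp s.re := (Real.log_lt_iff_lt_exp (by positivity)).1 hs
        exact absurd (this.trans (le_max_left R 1)) (not_le.2 h2)
      simp [hG, this]
    · simp
  have h2 : ∃ s : ℂ, m (s + 2 * Real.pi * Complex.I) - m s = 2 * Real.pi * Complex.I := by
    have hconv : IsPreconnected {s : ℂ | s.re < Real.log ε} :=
      (convex_halfSpace_re_lt _).isPreconnected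
    have hs0 : ((Real.log ε - 1 : ℝ) : ℂ) ∈ {s : ℂ | s.re < Real.log ε} := by
      simp only [mem_ofPred_eq, Complex.ofReal_re]; linarith
    refine ⟨((Real.log ε - 1 : ℝ) : ℂ), ?_⟩
    have := sub_const_of_exp_eq hconv (f := m) (g := fun s => s - L (a + Complex.exp s))
      hm.continuousOn (by fun_prop) (fun s hs => ?_)
      (x := ((Real.log ε - 1 : ℝ) : ℂ) + 2 * Real.pi * Complex.I)
      (y := ((Real.log ε - 1 : ℝ) : ℂ)) ?_ hs0
    · simp only [hper] at this
      linear_combination this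
    · rw [hm']
      have : a + Complex.exp s ∈ O := hεO (by
        rw [mem_ball_iff_norm, add_sub_cancel_left, Complex.norm_exp]
        exact (Real.lt_log_iff_exp_lt hε).1 hs)
      simp [hG, this, sub_eq_add_neg, Complex.exp_add]
    · simp
  obtain ⟨s, hs⟩ := h1
  obtain ⟨t, ht⟩ := h2
  have := hD s t
  rw [hs, ht] at this
  exact Complex.two_pi_I_ne_zero this.symm

lemma hasLogOn_sub_of_not_isBounded {X : Set ℂ} (hX : IsCompact X) {a : ℂ}
    (hb : ¬ Bornology.IsBounded (connectedComponentIn Xᶜ a)) : HasLogOn (fun z => z - a) X := by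
  have ha : a ∈ Xᶜ := by
    by_contra h
    exact hb (by rw [connectedComponentIn_eq_empty h]; exact Bornology.isBounded_empty)
  obtain ⟨R, hR⟩ := hX.isBounded.subset_closedBall (0 : ℂ)
  obtain ⟨b, hbC, hbR⟩ : ∃ b ∈ connectedComponentIn Xᶜ a, max R 0 < ‖b‖ := by
    by_contra! h
    exact hb ((Metric.isBounded_closedBall (x := (0 : ℂ)) (r := max R 0)).subset
      fun b hb => by simpa using h b hb)
  have hlogb : HasLogOn (fun z => z - b) X := by
    have hb0 : -b ≠ 0 := by
      rw [neg_ne_zero, ← norm_pos_iff]; exact (le_max_right _ _).trans_lt hbR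
    refine (HasLogOn.const hb0).of_norm_sub_lt (by fun_prop) fun x hx => ?_
    have := hR hx
    rw [mem_closedBall_zero_iff] at this
    simp only [sub_neg_eq_add, sub_add_cancel, norm_neg]
    exact this.trans_lt ((le_max_left _ _).trans_lt hbR)
  have := (isPreconnected_connectedComponentIn (F := Xᶜ) (x := a)).induction₂
    (fun x y => HasLogOn (fun z => z - x) X ↔ HasLogOn (fun z => z - y) X) ?_
    (fun x y z _ _ _ h1 h2 => h1.trans h2) (fun x y _ _ h => h.symm)
    (mem_connectedComponentIn ha) hbC
  · exact this.2 hlogb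
  · intro x hx
    have hxX : x ∈ Xᶜ := connectedComponentIn_subset _ _ hx
    obtain ⟨ε, hε, hεO⟩ := Metric.isOpen_iff.1 hX.isClosed.isOpen_compl x hxX
    refine mem_nhdsWithin_of_mem_nhds ?_
    filter_upwards [Metric.ball_mem_nhds x (half_pos hε)] with y hy
    rw [mem_ball_iff_norm] at hy
    have hd : ∀ z ∈ X, ε ≤ ‖z - x‖ := fun z hz => by
      by_contra! h
      exact hεO (mem_ball_iff_norm.2 h) hz
    have e : ∀ z, ‖(z - x) - (z - y)‖ = ‖y - x‖ := fun z => by congr 1; ring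
    have e' : ∀ z, ‖(z - y) - (z - x)‖ = ‖y - x‖ := fun z => by rw [← norm_neg]; congr 1; ring
    constructor
    · intro h
      refine h.of_norm_sub_lt (by fun_prop) fun z hz => ?_
      rw [e']
      linarith [hd z hz]
    · intro h
      refine h.of_norm_sub_lt (by fun_prop) fun z hz => ?_
      rw [e]
      have := norm_sub_norm_le (z - x) (y - x)
      have e3 : z - x - (y - x) = z - y := by ring
      rw [e3] at this
      linarith [hd z hz]

/-- If polynomials are dense in `C(X)` and the complement of `X` has no bounded component, then
every zero-free continuous function on `X` has a logarithm. -/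
lemma hasLogOn_of_dense {X : Set ℂ} (hX : IsCompact X)
    (hc : ∀ a ∉ X, ¬ Bornology.IsBounded (connectedComponentIn Xᶜ a))
    (hd : ∀ u : ℂ → ℂ, ContinuousOn u X → ∀ ε > 0, ∃ p : Polynomial ℂ, ∀ z ∈ X,
      ‖p.eval z - u z‖ < ε)
    {u : ℂ → ℂ} (hu : ContinuousOn u X) (hu0 : ∀ x ∈ X, u x ≠ 0) : HasLogOn u X := by
  obtain ⟨δ, hδ, hδu⟩ : ∃ δ > 0, ∀ x ∈ X, δ ≤ ‖u x‖ := by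
    rcases X.eq_empty_or_nonempty with rfl | hne
    · exact ⟨1, one_pos, by simp⟩
    · obtain ⟨x, hx, hmin⟩ := hX.exists_isMinOn hne hu.norm
      exact ⟨‖u x‖, norm_pos_iff.2 (hu0 x hx), fun y hy => hmin hy⟩
  obtain ⟨p, hp⟩ := hd u hu (δ / 2) (half_pos hδ)
  have hpu : ∀ x ∈ X, ‖u x - p.eval x‖ < ‖p.eval x‖ := fun x hx => by
    have h1 := hp x hx
    have h2 := hδu x hx
    have h3 := norm_sub_norm_le (u x) (p.eval x)
    rw [norm_sub_rev] at h1
    linarith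
  refine HasLogOn.of_norm_sub_lt (v := fun x => p.eval x) ?_ hu hpu
  rcases X.eq_empty_or_nonempty with rfl | ⟨x₀, hx₀⟩
  · exact ⟨0, continuousOn_empty _, by simp⟩
  have hp0 : ∀ x ∈ X, p.eval x ≠ 0 := fun x hx h => by
    have := hpu x hx; rw [h, norm_zero] at this; exact absurd (norm_nonneg _) (not_le.2 this)
  have hpne : p ≠ 0 := fun h => hp0 x₀ hx₀ (by simp [h])
  have hroots : ∀ a ∈ p.roots, a ∉ X := fun a ha haX =>
    hp0 a haX (Polynomial.isRoot_of_mem_roots ha)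
  have hsplit := (IsAlgClosed.splits p).eq_prod_roots
  have key : ∀ s : Multiset ℂ, (∀ a ∈ s, a ∉ X) →
      HasLogOn (fun x => ((s.map (fun a => Polynomial.X - Polynomial.C a)).prod).eval x) X := by
    intro s
    induction s using Multiset.induction_on with
    | empty => intro _; simpa using HasLogOn.const (X := ℂ) (s := X) (one_ne_zero)
    | cons a s ih =>
      intro hs
      have h1 := hasLogOn_sub_of_not_isBounded hX (hc a (hs a (Multiset.mem_cons_self a s)))
      have h2 := ih fun b hb => hs b (Multiset.mem_cons_of_mem hb)
      exact (h1.mul h2).congr fun x _ => by simp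
  have := (HasLogOn.const (X := ℂ) (s := X) (Polynomial.leadingCoeff_ne_zero.2 hpne)).mul
    (key p.roots hroots)
  refine this.congr fun x _ => ?_
  conv_rhs => rw [hsplit]
  simp

end TotallyRealDiscHull

namespace TotallyRealDiscHull

open Set Filter Topology MeasureTheory
open scoped ENNReal Real

lemma circleAverage_inv_sub_of_lt {z : ℂ} {r : ℝ} (hr : 0 < r) (h : r < ‖z‖) :
    Real.circleAverage (fun w => (w - z)⁻¹) 0 r = -z⁻¹ := by
  have hd : DiffContOnCl ℂ (fun w => (w - z)⁻¹) (Metric.ball 0 |r|) := by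
    apply DifferentiableOn.diffContOnCl
    intro w hw
    have hw' : w - z ≠ 0 := by
      have := Metric.closure_ball_subset_closedBall hw
      rw [mem_closedBall_zero_iff, abs_of_pos hr] at this
      intro h0
      rw [sub_eq_zero] at h0; subst h0; linarith
    exact ((differentiableAt_id.sub_const z).inv hw').differentiableWithinAt
  rw [hd.circleAverage]; simp

lemma circleAverage_inv_sub_of_gt {z : ℂ} {r : ℝ} (h : ‖z‖ < r) :
    Real.circleAverage (fun w => (w - z)⁻¹) 0 r = 0 := by
  have hr : 0 < r := (norm_nonneg z).trans_lt h
  rw [Real.circleAverage_eq_circleIntegral hr.ne']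
  have hne : ∀ w ∈ Metric.sphere (0 : ℂ) r, w ≠ 0 ∧ w - z ≠ 0 := by
    intro w hw
    rw [mem_sphere_zero_iff_norm] at hw
    refine ⟨fun h0 => ?_, fun h0 => ?_⟩
    · rw [h0, norm_zero] at hw; linarith
    · rw [sub_eq_zero] at h0; subst h0; linarith
  rcases eq_or_ne z 0 with rfl | hz
  · have := circleIntegral.integral_sub_zpow_of_ne (n := -2) (by norm_num) (0 : ℂ) 0 r
    have h2 : (∮ w in C(0, r), (w - 0)⁻¹ • (w - 0)⁻¹) = ∮ w in C(0, r), (w - 0) ^ (-2 : ℤ) := by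
      refine circleIntegral.integral_congr hr.le fun w hw => ?_
      simp only [smul_eq_mul, zpow_neg]
      rw [← mul_inv]; congr 1; norm_cast; ring
    rw [h2, this, smul_zero]
  · have h2 : (∮ w in C(0, r), (w - 0)⁻¹ • (w - z)⁻¹) =
        ∮ w in C(0, r), z⁻¹ • ((w - z)⁻¹ - (w - 0)⁻¹) := by
      refine circleIntegral.integral_congr hr.le fun w hw => ?_
      obtain ⟨h1, h3⟩ := hne w hw
      simp only [smul_eq_mul, sub_zero]
      field_simp
      ring
    have i1 : CircleIntegrable (fun w => (w - z)⁻¹) 0 r := by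
      apply ContinuousOn.circleIntegrable hr.le
      exact (by fun_prop : ContinuousOn (fun w => w - z) _).inv₀ fun w hw => (hne w hw).2
    have i2 : CircleIntegrable (fun w : ℂ => (w - 0)⁻¹) 0 r := by
      apply ContinuousOn.circleIntegrable hr.le
      exact (by fun_prop : ContinuousOn (fun w : ℂ => w - 0) _).inv₀ fun w hw => by
        simpa using (hne w hw).1
    rw [h2, circleIntegral.integral_smul, circleIntegral.integral_sub i1 i2,
      circleIntegral.integral_sub_inv_of_mem_ball (by simpa using h),
      circleIntegral.integral_sub_inv_of_mem_ball (by simpa using hr)]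
    simp

lemma integral_Ioo_circleMap (f : ℂ → ℂ) (r : ℝ) :
    ∫ θ in Ioo (-π) π, f (circleMap 0 r θ) = (2 * π) * Real.circleAverage f 0 r := by
  rw [Real.circleAverage_eq_integral_add (-π),
    intervalIntegral.integral_comp_add_right (fun θ => f (circleMap 0 r θ)),
    ← integral_Ioc_eq_integral_Ioo, ← intervalIntegral.integral_of_le (by linarith [Real.pi_pos])]
  have : (2 * π : ℝ) + -π = π := by ring
  rw [this, zero_add]
  have hp : (π : ℂ) ≠ 0 := by exact_mod_cast Real.pi_ne_zero
  simp only [Complex.real_smul]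
  push_cast
  field_simp

lemma integrableOn_inv_sub (R : ℝ) (z : ℂ) :
    IntegrableOn (fun w : ℂ => (w - z)⁻¹) (Metric.ball 0 R) := by
  have : LocallyIntegrable (fun w : ℂ => w⁻¹) := by
    refine locallyIntegrable_of_norm_le_rpow (E := ℂ) (C := 1) (α := 1) ?_ ?_ ?_ ?_
    · simp [Complex.finrank_real_complex]
    · simp [Complex.finrank_real_complex]
    · filter_upwards with w
      rw [norm_inv, Real.rpow_neg_one, one_mul]
    · exact (measurable_inv).aestronglyMeasurable
  have h1 : IntegrableOn (fun w : ℂ => w⁻¹) (Metric.closedBall 0 (R + ‖z‖)) :=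
    this.integrableOn_isCompact (isCompact_closedBall _ _)
  have h2 := (measurePreserving_sub_right (volume : Measure ℂ) z).integrableOn_comp_preimage
    (MeasurableEquiv.subRight z).measurableEmbedding (f := fun w : ℂ => w⁻¹)
    (s := Metric.closedBall 0 (R + ‖z‖))
  refine (h2.2 h1).mono_set fun w hw => ?_
  rw [mem_ball_zero_iff] at hw
  simp only [mem_preimage, mem_closedBall_zero_iff]
  exact (norm_sub_le _ _).trans (by linarith)

lemma integral_ball_inv_sub {R : ℝ} {z : ℂ} (hz : ‖z‖ < R) :
    ∫ w in Metric.ball (0 : ℂ) R, (w - z)⁻¹ = -π * (starRingEnd ℂ) z := by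
  have hR : 0 < R := (norm_nonneg z).trans_lt hz
  set f : ℂ → ℂ := (Metric.ball (0 : ℂ) R).indicator (fun w => (w - z)⁻¹) with hf
  have hfm : Measurable f := by
    refine Measurable.indicator ?_ measurableSet_ball
    exact (measurable_id.sub_const z).inv
  have hfi : Integrable f := (integrable_indicator_iff measurableSet_ball).2
    (integrableOn_inv_sub R z)
  rw [← integral_indicator measurableSet_ball, ← hf, ← Complex.integral_comp_polarCoord_symm]
  have hI : IntegrableOn (fun p : ℝ × ℝ => p.1 • f (Complex.polarCoord.symm p))
      (Ioi (0 : ℝ) ×ˢ Ioo (-π) π) := by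
    have hc : Continuous (fun p : ℝ × ℝ => Complex.polarCoord.symm p) := by
      simp only [Complex.polarCoord_symm_apply]; fun_prop
    refine ⟨(measurable_fst.smul (hfm.comp hc.measurable)).aestronglyMeasurable, ?_⟩
    have h1 := Complex.lintegral_comp_polarCoord_symm (fun w => ‖f w‖ₑ)
    rw [polarCoord_target] at h1
    rw [HasFiniteIntegral]
    refine lt_of_eq_of_lt ?_ (h1.trans_lt hfi.2)
    refine setLIntegral_congr_fun (measurableSet_Ioi.prod measurableSet_Ioo) fun p hp => ?_
    simp only [enorm_smul, smul_eq_mul]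
    congr 1
    rw [Real.enorm_of_nonneg (le_of_lt hp.1)]
  rw [polarCoord_target, Measure.volume_eq_prod, setIntegral_prod _ hI]
  have inner : ∀ r ∈ Ioi (0 : ℝ), r ≠ ‖z‖ →
      ∫ θ in Ioo (-π) π, r • f (Complex.polarCoord.symm (r, θ))
      = (Ioo 0 ‖z‖).indicator (fun r : ℝ => (-(2 * π) * z⁻¹ * r : ℂ)) r := by
    intro r hr hrz
    rw [integral_smul]
    have e : ∀ θ, Complex.polarCoord.symm (r, θ) = circleMap 0 r θ := fun θ => by
      simp [Complex.polarCoord_symm_apply, circleMap, Complex.exp_mul_I]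
    simp_rw [e]
    have hn : ∀ θ, ‖circleMap 0 r θ‖ = r := fun θ => by
      simp [abs_of_pos (show 0 < r from hr)]
    by_cases hrR : r < R
    · have : ∀ θ, f (circleMap 0 r θ) = (circleMap 0 r θ - z)⁻¹ := fun θ => by
        rw [hf, indicator_of_mem]; simpa [hn] using hrR
      simp_rw [this]
      rw [integral_Ioo_circleMap (fun w => (w - z)⁻¹)]
      rcases lt_or_gt_of_ne hrz with h | h
      · rw [circleAverage_inv_sub_of_lt hr h, indicator_of_mem (by exact ⟨hr, h⟩)]
        simp only [Complex.real_smul]; ring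
      · rw [circleAverage_inv_sub_of_gt h, indicator_of_notMem (by simp [h.le])]
        simp
    · have : ∀ θ, f (circleMap 0 r θ) = 0 := fun θ => by
        rw [hf, indicator_of_notMem]
        simpa [abs_of_pos (show 0 < r from hr)] using hrR
      simp_rw [this]
      rw [indicator_of_notMem (by intro h; exact hrR (h.2.trans hz))]
      simp
  have : ∫ r in Ioi (0 : ℝ), ∫ θ in Ioo (-π) π, r • f (Complex.polarCoord.symm (r, θ))
      = ∫ r in Ioi (0 : ℝ), (Ioo 0 ‖z‖).indicator (fun r : ℝ => (-(2 * π) * z⁻¹ * r : ℂ)) r := by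
    refine setIntegral_congr_ae measurableSet_Ioi ?_
    filter_upwards
      [(measure_eq_zero_iff_ae_notMem (μ := volume)).1 (Real.volume_singleton (a := ‖z‖))]
      with r hr hr0
    exact inner r hr0 (by simpa using hr)
  rw [this, setIntegral_indicator measurableSet_Ioo,
    inter_eq_self_of_subset_right (fun r hr => hr.1), integral_const_mul,
    ← integral_Ioc_eq_integral_Ioo, ← intervalIntegral.integral_of_le (norm_nonneg z)]
  rw [intervalIntegral.integral_ofReal, integral_id]
  rcases eq_or_ne z 0 with rfl | h0
  · simp
  have := Complex.mul_conj' z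
  push_cast
  rw [← this]
  field_simp
  ring

end TotallyRealDiscHull

namespace TotallyRealDiscHull

open Set Filter Topology MeasureTheory
open scoped ENNReal Real

lemma exists_mul_sub_eq_one {X : Type*} [TopologicalSpace X] [CompactSpace X]
    {A : Subalgebra ℂ C(X, ℂ)} (hA : IsClosed (A : Set C(X, ℂ))) {f : C(X, ℂ)} (hf : f ∈ A) {a : ℂ}
    (h : ¬ Bornology.IsBounded (connectedComponentIn (range f)ᶜ a)) :
    ∃ g ∈ A, g * (algebraMap ℂ C(X, ℂ) a - f) = 1 := by
  have h1 : a ∉ spectrum ℂ (⟨f, hf⟩ : A) := fun hmem => h <| by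
    have := Subalgebra.spectrum_isBounded_connectedComponentIn (hS := hA) A (⟨f, hf⟩ : A) hmem
    rwa [ContinuousMap.spectrum_eq_range] at this
  rw [spectrum.notMem_iff] at h1
  obtain ⟨u, hu⟩ := h1
  refine ⟨((u⁻¹ : Aˣ) : A), SetLike.coe_mem _, ?_⟩
  have := u.inv_mul
  rw [hu] at this
  simpa using congrArg (Subtype.val) this

lemma resolvent_mem {X : Type*} [TopologicalSpace X] [CompactSpace X]
    {A : Subalgebra ℂ C(X, ℂ)} (hA : IsClosed (A : Set C(X, ℂ))) {f : C(X, ℂ)} (hf : f ∈ A)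
    (h : ∀ a ∉ range f, ¬ Bornology.IsBounded (connectedComponentIn (range f)ᶜ a)) (a : ℂ) :
    resolvent f a ∈ A := by
  by_cases ha : a ∈ range f
  · have : ¬ IsUnit (algebraMap ℂ C(X, ℂ) a - f) := by
      rw [← spectrum.mem_iff, ContinuousMap.spectrum_eq_range]; exact ha
    rw [resolvent, Ring.inverse_non_unit _ this]
    exact zero_mem _
  · obtain ⟨g, hg, hg1⟩ := exists_mul_sub_eq_one hA hf (h a ha)
    have hu : IsUnit (algebraMap ℂ C(X, ℂ) a - f) := IsUnit.of_mul_eq_one _ (mul_comm g _ ▸ hg1)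
    have : Ring.inverse (algebraMap ℂ C(X, ℂ) a - f) = g := by
      rw [← one_mul (Ring.inverse _), ← hg1, Ring.mul_inverse_cancel_right _ _ hu]
    rwa [resolvent, this]

lemma star_mem_of_null {X : Set ℂ} (hX : IsCompact X) (hX0 : volume X = 0)
    (hc : ∀ a ∉ X, ¬ Bornology.IsBounded (connectedComponentIn Xᶜ a)) [CompactSpace X]
    {A : Subalgebra ℂ C(X, ℂ)} (hA : IsClosed (A : Set C(X, ℂ)))
    (hf : ContinuousMap.restrict X (.id ℂ) ∈ A) : star (ContinuousMap.restrict X (.id ℂ)) ∈ A := by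
  set f : C(X, ℂ) := ContinuousMap.restrict X (.id ℂ) with hfdef
  have hfr : range f = X := by
    ext z; constructor
    · rintro ⟨x, rfl⟩; exact x.2
    · intro hz; exact ⟨⟨z, hz⟩, rfl⟩
  have hres : ∀ a, resolvent f a ∈ A := resolvent_mem hA hf (by rw [hfr]; exact hc)
  obtain ⟨R, hR0, hR⟩ := hX.isBounded.exists_pos_norm_lt
  -- small area near `X`
  have key : ∀ ε > 0, ∃ g ∈ A, ∀ x : X, ‖g x - (-π * (starRingEnd ℂ) (x : ℂ))‖ ≤ ε := by
    intro ε hε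
    have hfin : ∫⁻ w in Metric.ball (0 : ℂ) (R + R + 1), ‖w⁻¹‖ₑ ≠ ∞ := by
      have := (integrableOn_inv_sub (R + R + 1) 0).2.ne
      simpa using this
    obtain ⟨δ, hδ, hδ'⟩ := exists_pos_setLIntegral_lt_of_measure_lt hfin
      (ε := ENNReal.ofReal ε) (by simpa using hε)
    obtain ⟨η, hη, hηδ⟩ : ∃ η > 0, volume (Metric.cthickening η X) < δ := by
      have h1 := (tendsto_measure_cthickening_of_isCompact (μ := (volume : Measure ℂ)) hX)
      rw [hX0] at h1
      have h2 := (h1.mono_left (nhdsWithin_le_nhds (s := Ioi 0))).eventually (gt_mem_nhds hδ)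
      obtain ⟨η, h3, h4⟩ := (h2.and self_mem_nhdsWithin).exists
      exact ⟨η, h4, h3⟩
    have hcs : CompleteSpace A := hA.completeSpace_coe
    set Q : Set ℂ := Metric.closedBall 0 R \ Metric.thickening η X with hQ
    have hQc : IsCompact Q := (isCompact_closedBall _ _).diff Metric.isOpen_thickening
    have hXth : X ⊆ Metric.thickening η X := Metric.self_subset_thickening hη X
    have hcont : ContinuousOn (resolvent f) Q := by
      intro τ hτ
      have : τ ∈ resolventSet ℂ f := by
        have : τ ∉ spectrum ℂ f := by
          rw [ContinuousMap.spectrum_eq_range, hfr]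
          exact fun h => hτ.2 (hXth h)
        simpa [spectrum] using this
      exact (spectrum.hasDerivAt_resolvent_const_left this).continuousAt.continuousWithinAt
    let F : ℂ → A := fun τ => ⟨resolvent f τ, hres τ⟩
    have hFc : ContinuousOn F Q := by
      rw [continuousOn_iff_continuous_domRestrict] at hcont ⊢
      exact hcont.subtype_mk _
    have hFi : IntegrableOn F (Metric.ball 0 R \ Metric.thickening η X) :=
      (hFc.integrableOn_compact hQc).mono_set
        (sdiff_subset_sdiff_left Metric.ball_subset_closedBall)
    refine ⟨((∫ τ in Metric.ball 0 R \ Metric.thickening η X, F τ : A) : C(X, ℂ)),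
      SetLike.coe_mem _, fun x => ?_⟩
    have hev : ((∫ τ in Metric.ball 0 R \ Metric.thickening η X, F τ : A) : C(X, ℂ)) x
        = ∫ τ in Metric.ball 0 R \ Metric.thickening η X, (τ - x)⁻¹ := by
      let ev : A →L[ℂ] ℂ := (ContinuousMap.evalCLM ℂ x).comp A.toSubmodule.subtypeL
      have h1 : ev (∫ τ in Metric.ball 0 R \ Metric.thickening η X, F τ) = _ :=
        (ev.integral_comp_comm hFi).symm
      refine Eq.trans ?_ (h1.trans ?_)
      · rfl
      · refine setIntegral_congr_fun
          (measurableSet_ball.diff Metric.isOpen_thickening.measurableSet)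
          fun τ hτ => ?_
        have hu : IsUnit (algebraMap ℂ C(X, ℂ) τ - f) := by
          rw [← spectrum.notMem_iff, ContinuousMap.spectrum_eq_range, hfr]
          exact fun h => hτ.2 (hXth h)
        have h2 := congrArg (fun g : C(X, ℂ) => g x) (Ring.inverse_mul_cancel _ hu)
        have h3 : resolvent f τ x * (τ - x) = 1 := h2
        exact eq_inv_of_mul_eq_one_left h3
    rw [hev, ← integral_ball_inv_sub (hR x x.2)]
    have h_int := integrableOn_inv_sub R (x : ℂ)
    set T := Metric.thickening η X with hT
    have hTm : MeasurableSet T := Metric.isOpen_thickening.measurableSet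
    rw [← integral_inter_add_sdiff hTm h_int, sub_add_cancel_right, norm_neg]
    set s : Set ℂ := {w | w + x ∈ Metric.ball (0 : ℂ) R ∩ T} with hs
    have hmp : MeasurePreserving (fun w : ℂ => w - (x : ℂ)) volume volume :=
      measurePreserving_sub_right volume (x : ℂ)
    have hsm : MeasurableSet s :=
      (measurable_id.add_const (x : ℂ)) (measurableSet_ball.inter hTm)
    have hpre : (fun w : ℂ => w - (x : ℂ)) ⁻¹' s = Metric.ball (0 : ℂ) R ∩ T := by
      ext w; simp [hs]
    have hsball : s ⊆ Metric.ball 0 (R + R + 1) := fun w hw => by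
      have h1 := hw.1
      have h2 := hR x x.2
      rw [mem_ball_zero_iff] at h1 ⊢
      have h3 := norm_sub_le (w + x) (x : ℂ)
      rw [add_sub_cancel_right] at h3
      linarith
    have hsδ : (volume.restrict (Metric.ball (0 : ℂ) (R + R + 1))) s < δ := by
      refine (Measure.restrict_apply_le _ _).trans_lt ?_
      rw [← hmp.measure_preimage hsm.nullMeasurableSet, hpre]
      exact (measure_mono (inter_subset_right.trans
        (Metric.thickening_subset_cthickening η X))).trans_lt hηδ
    have h4 := hδ' s hsδ
    rw [Measure.restrict_restrict hsm, inter_eq_self_of_subset_left hsball,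
      ← hmp.setLIntegral_comp_preimage hsm (by fun_prop), hpre] at h4
    have h5 := (enorm_integral_le_lintegral_enorm (μ := volume.restrict (Metric.ball (0 : ℂ) R ∩ T))
      (fun w : ℂ => (w - (x : ℂ))⁻¹)).trans_lt h4
    rw [← ofReal_norm, ENNReal.ofReal_lt_ofReal_iff hε] at h5
    exact h5.le
  have hmem : (-π : ℂ) • star f ∈ A := by
    rw [← SetLike.mem_coe, ← hA.closure_eq, Metric.mem_closure_iff]
    intro ε hε
    obtain ⟨g, hg, hg'⟩ := key (ε / 2) (half_pos hε)
    refine ⟨g, hg, lt_of_le_of_lt ?_ (half_lt_self hε)⟩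
    rw [dist_comm, ContinuousMap.dist_le (half_pos hε).le]
    intro x
    rw [dist_eq_norm]
    exact hg' x
  have hpi : (-π : ℂ) ≠ 0 := by simp [Real.pi_ne_zero]
  have := A.smul_mem hmem (-π : ℂ)⁻¹
  rwa [smul_smul, inv_mul_cancel₀ hpi, one_smul] at this

/-- Polynomials are dense in `C(X)` when `X` is a compact plane null set whose complement has no
bounded component. -/
lemma exists_polynomial_approx {X : Set ℂ} (hX : IsCompact X) (hX0 : volume X = 0)
    (hc : ∀ a ∉ X, ¬ Bornology.IsBounded (connectedComponentIn Xᶜ a))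
    {u : ℂ → ℂ} (hu : ContinuousOn u X) {ε : ℝ} (hε : 0 < ε) :
    ∃ p : Polynomial ℂ, ∀ z ∈ X, ‖p.eval z - u z‖ < ε := by
  have : CompactSpace X := isCompact_iff_compactSpace.1 hX
  set A := (polynomialFunctions X).topologicalClosure with hAdef
  have hA : IsClosed (A : Set C(X, ℂ)) := Subalgebra.isClosed_topologicalClosure _
  have hid : ContinuousMap.restrict X (.id ℂ) ∈ A := by
    apply Subalgebra.le_topologicalClosure
    rw [← Polynomial.toContinuousMap_X_eq_id]
    exact ⟨Polynomial.X, trivial, rfl⟩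
  have hstar := star_mem_of_null hX hX0 hc hA hid
  have htop : A = ⊤ := by
    have h1 := ContinuousMap.elemental_id_eq_top X
    have hsub : (StarAlgebra.adjoin ℂ {ContinuousMap.restrict X (.id ℂ)}).toSubalgebra ≤ A := by
      rw [StarAlgebra.adjoin_toSubalgebra]
      apply Algebra.adjoin_le
      rintro g (hg | hg)
      · rw [mem_singleton_iff.1 hg]; exact hid
      · rw [Set.mem_star, mem_singleton_iff] at hg
        rw [← star_star g, hg]; exact hstar
    rw [eq_top_iff]
    intro g _
    have h2 : g ∈ StarAlgebra.elemental ℂ (ContinuousMap.restrict X (.id ℂ)) := by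
      rw [h1]; trivial
    have h3 : g ∈ closure ((StarAlgebra.adjoin ℂ {ContinuousMap.restrict X (.id ℂ)} :
      StarSubalgebra ℂ C(X, ℂ)) : Set C(X, ℂ)) := h2
    exact closure_minimal hsub hA h3
  have hmem : (⟨X.domRestrict u, continuousOn_iff_continuous_domRestrict.1 hu⟩ : C(X, ℂ)) ∈ A := by
    rw [htop]; trivial
  obtain ⟨g, hg, hgu⟩ := Metric.mem_closure_iff.1 hmem ε hε
  obtain ⟨p, -, rfl⟩ := hg
  refine ⟨p, fun z hz => ?_⟩
  rw [dist_comm, ContinuousMap.dist_lt_iff hε] at hgu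
  have := hgu ⟨z, hz⟩
  rwa [dist_eq_norm] at this

end TotallyRealDiscHull

namespace TotallyRealDiscHull

open Set Filter Topology WeakDual

/-- If every character killing `a` is bounded by `r < q` at `e`, then some power of `e` is close to
a multiple of `a`. -/
lemma exists_pow_sub_mul_lt {B : Type*} [NormedCommRing B] [NormedAlgebra ℂ B] [CompleteSpace B]
    {a e : B} {r q : ℝ} (hr : 0 ≤ r) (hrq : r < q)
    (h : ∀ χ : characterSpace ℂ B, χ a = 0 → ‖χ e‖ ≤ r) :
    ∃ N : ℕ, 0 < N ∧ ∃ g : B, ‖e ^ N - a * g‖ < q ^ N := by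
  set I : Ideal B := (Ideal.span {a}).closure with hI
  have : IsClosed (I : Set B) := isClosed_closure
  have haI : a ∈ I := subset_closure (Ideal.subset_span (mem_singleton a))
  have hq0 : 0 < q := hr.trans_lt hrq
  have hrad : spectralRadius ℂ (Ideal.Quotient.mk I e) ≤ ENNReal.ofReal r := by
    refine iSup₂_le fun k hk => ?_
    obtain ⟨χ, rfl⟩ := WeakDual.CharacterSpace.mem_spectrum_iff_exists.1 hk
    set ψ : B →ₐ[ℂ] ℂ := (CharacterSpace.toAlgHom χ).comp (Ideal.Quotient.mkₐ ℂ I) with hψ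
    have h1 := h (CharacterSpace.equivAlgHom.symm ψ) (by
      have : Ideal.Quotient.mk I a = 0 := Ideal.Quotient.eq_zero_iff_mem.2 haI
      simp [hψ, this])
    have h2 : ‖χ (Ideal.Quotient.mk I e)‖ ≤ r := by simpa [hψ] using h1
    exact ENNReal.coe_le_coe.2 (NNReal.le_toNNReal_of_coe_le h2)
  have hlim := (spectrum.pow_norm_pow_one_div_tendsto_nhds_spectralRadius
    (Ideal.Quotient.mk I e)).eventually_lt_const
    (hrad.trans_lt ((ENNReal.ofReal_lt_ofReal_iff hq0).2 hrq))
  obtain ⟨N, hN, hN0⟩ := (hlim.and (eventually_gt_atTop 0)).exists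
  refine ⟨N, hN0, ?_⟩
  have hlt : ‖Ideal.Quotient.mk I (e ^ N)‖ < q ^ N := by
    have h1 := (ENNReal.ofReal_lt_ofReal_iff hq0).1 hN
    rw [map_pow]
    calc _ = (‖Ideal.Quotient.mk I e ^ N‖ ^ (1 / N : ℝ)) ^ N := by
          rw [one_div, Real.rpow_inv_natCast_pow (norm_nonneg _) hN0.ne']
      _ < q ^ N := pow_lt_pow_left₀ h1 (by positivity) hN0.ne'
  obtain ⟨b, hb, hbn⟩ := Ideal.Quotient.norm_mk_lt (Ideal.Quotient.mk I (e ^ N)) (sub_pos.2 hlt)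
  have hm : e ^ N - b ∈ I := by
    rw [← Ideal.Quotient.eq, hb]
  obtain ⟨c, hc, hcd⟩ := Metric.mem_closure_iff.1 hm (q ^ N - ‖b‖) (by linarith)
  obtain ⟨g, rfl⟩ := Ideal.mem_span_singleton'.1 hc
  refine ⟨g, ?_⟩
  rw [dist_eq_norm] at hcd
  calc ‖e ^ N - a * g‖ = ‖(e ^ N - b - g * a) + b‖ := by congr 1; ring
    _ ≤ ‖e ^ N - b - g * a‖ + ‖b‖ := norm_add_le _ _
    _ < q ^ N := by linarith

lemma exists_pow_mul_sub_mul_le {B : Type*} [NormedCommRing B] {a e g : B} {q : ℝ} {N j : ℕ}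
    (hj : 0 < j) (h : ‖e ^ N - a * g‖ ≤ q ^ N) : ∃ g', ‖e ^ (N * j) - a * g'‖ ≤ q ^ (N * j) := by
  obtain ⟨d, hd⟩ := sub_dvd_pow_sub_pow (e ^ N) (e ^ N - a * g) j
  refine ⟨g * d, ?_⟩
  have : e ^ (N * j) - a * (g * d) = (e ^ N - a * g) ^ j := by
    rw [pow_mul]; linear_combination hd
  rw [this, pow_mul]
  exact (norm_pow_le' _ hj).trans (pow_le_pow_left₀ (norm_nonneg _) h _)

lemma exists_uniform_pow_sub_mul_le {B : Type*} [NormedCommRing B] [NormedAlgebra ℂ B]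
    [CompleteSpace B] {z e : B} {r q : ℝ} (hr : 0 ≤ r) (hrq : r < q) {s : Set ℂ} (hs : IsCompact s)
    (h : ∀ χ : characterSpace ℂ B, χ z ∈ s → ‖χ e‖ ≤ r) :
    ∃ N : ℕ, 0 < N ∧ ∀ ζ ∈ s, ∃ g : B, ‖e ^ N - (z - algebraMap ℂ B ζ) * g‖ ≤ q ^ N := by
  refine hs.induction_on (p := fun s => ∃ N : ℕ, 0 < N ∧
    ∀ ζ ∈ s, ∃ g : B, ‖e ^ N - (z - algebraMap ℂ B ζ) * g‖ ≤ q ^ N) ⟨1, one_pos, by simp⟩ ?_ ?_ ?_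
  · rintro s t hst ⟨N, hN, hN'⟩
    exact ⟨N, hN, fun ζ hζ => hN' ζ (hst hζ)⟩
  · rintro s t ⟨N, hN, hN'⟩ ⟨M, hM, hM'⟩
    refine ⟨N * M, Nat.mul_pos hN hM, ?_⟩
    rintro ζ (hζ | hζ)
    · obtain ⟨g, hg⟩ := hN' ζ hζ
      exact exists_pow_mul_sub_mul_le hM hg
    · obtain ⟨g, hg⟩ := hM' ζ hζ
      rw [mul_comm]
      exact exists_pow_mul_sub_mul_le hN hg
  · intro ζ₀ hζ₀
    obtain ⟨N, hN, g, hg⟩ := exists_pow_sub_mul_lt (a := z - algebraMap ℂ B ζ₀) (e := e) hr hrq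
      (fun χ hχ => h χ (by
        rw [map_sub, AlgHomClass.commutes, sub_eq_zero] at hχ
        rw [hχ]; exact hζ₀))
    have hc : Continuous fun ζ : ℂ => ‖e ^ N - (z - algebraMap ℂ B ζ) * g‖ := by
      have := algebraMapCLM ℂ B |>.continuous
      fun_prop
    refine ⟨_, mem_nhdsWithin_of_mem_nhds ((hc.tendsto ζ₀).eventually_lt_const hg), N, hN,
      fun ζ hζ => ⟨g, le_of_lt hζ⟩⟩

lemma norm_le_interp_of_mem_closedBall {F : ℂ → ℂ} {z' ζ : ℂ} {r R a b : ℝ} (hr : 0 < r)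
    (hrR : r < R) (hF : ∀ w ∈ Metric.closedBall z' R, DifferentiableAt ℂ F w)
    (ha : ∀ w ∈ Metric.sphere z' r, ‖F w‖ ≤ a) (hb : ∀ w ∈ Metric.sphere z' R, ‖F w‖ ≤ b)
    (h1 : r ≤ ‖ζ - z'‖) (h2 : ‖ζ - z'‖ ≤ R) :
    ‖F ζ‖ ≤ a ^ (1 - (Real.log ‖ζ - z'‖ - Real.log r) / (Real.log R - Real.log r)) *
      b ^ ((Real.log ‖ζ - z'‖ - Real.log r) / (Real.log R - Real.log r)) := by
  have hR : 0 < R := hr.trans hrR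
  have hζ : 0 < ‖ζ - z'‖ := hr.trans_le h1
  set E : ℂ → ℂ := fun s => z' + Complex.exp s with hE
  have hEm : ∀ s ∈ Complex.HadamardThreeLines.verticalClosedStrip (Real.log r) (Real.log R),
      E s ∈ Metric.closedBall z' R := by
    intro s hs
    simp only [hE, mem_closedBall_iff_norm, add_sub_cancel_left, Complex.norm_exp]
    rw [← Real.le_log_iff_exp_le hR]; exact hs.2
  have hsph : ∀ t : ℝ, 0 < t → ∀ s ∈ Complex.re ⁻¹' {Real.log t}, E s ∈ Metric.sphere z' t := by
    intro t ht s hs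
    rw [mem_preimage, mem_singleton_iff] at hs
    simp [hE, Complex.norm_exp, hs, Real.exp_log ht]
  have hlog := Real.log_lt_log hr hrR
  have hre : (Complex.log (ζ - z')).re = Real.log ‖ζ - z'‖ := Complex.log_re _
  have hEl : E (Complex.log (ζ - z')) = ζ := by
    simp [hE, Complex.exp_log (norm_pos_iff.1 hζ)]
  have key := Complex.HadamardThreeLines.norm_le_interp_of_mem_verticalClosedStrip'
    (f := F ∘ E) (z := Complex.log (ζ - z')) (a := a) (b := b) hlog
    (by
      rw [Complex.HadamardThreeLines.verticalClosedStrip, mem_preimage, hre]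
      exact ⟨Real.log_le_log hr h1, Real.log_le_log hζ h2⟩)
    (by
      apply DifferentiableOn.diffContOnCl
      rw [Complex.HadamardThreeLines.verticalStrip, Complex.closure_preimage_re,
        closure_Ioo hlog.ne]
      intro s hs
      exact ((hF _ (hEm s hs)).comp s (by fun_prop)).differentiableWithinAt)
    (by
      have hc : ContinuousOn F (Metric.closedBall z' R) :=
        fun w hw => (hF w hw).continuousAt.continuousWithinAt
      obtain ⟨C, hC⟩ := (isCompact_closedBall z' R).exists_bound_of_continuousOn hc
      refine ⟨C, ?_⟩
      rintro _ ⟨s, hs, rfl⟩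
      exact hC _ (hEm s hs))
    (fun s hs => ha _ (hsph r hr s hs)) (fun s hs => hb _ (hsph R hR s hs))
  rwa [hre, Function.comp_apply, hEl] at key

lemma le_of_forall_pow_le_mul_pow {a b M : ℝ} (hb : 0 ≤ b) {N : ℕ} (hN : 0 < N)
    (h : ∀ j : ℕ, 0 < j → a ^ (N * j) ≤ M * b ^ (N * j)) : a ≤ b := by
  by_contra! hab
  have ha : 0 < a := hb.trans_lt hab
  have h1 : b / a < 1 := (div_lt_one ha).2 hab
  have h2 : Tendsto (fun j : ℕ => M * (b / a) ^ (N * j)) atTop (𝓝 (M * 0)) :=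
    ((tendsto_pow_atTop_nhds_zero_of_lt_one (by positivity) h1).comp
      (tendsto_id.const_mul_atTop' hN)).const_mul M
  rw [mul_zero] at h2
  obtain ⟨j, hj, hj0⟩ := ((h2.eventually_lt_const one_pos).and (eventually_gt_atTop 0)).exists
  have h3 := h j hj0
  rw [div_pow, ← mul_div_assoc, div_lt_one (by positivity)] at hj
  linarith

section Functional

variable {X : Type*} [TopologicalSpace X] [CompactSpace X] {A : Subalgebra ℂ C(X, ℂ)}

lemma norm_character_le_of_annulus (hA : IsClosed (A : Set C(X, ℂ))) {z e : A} {z' : ℂ}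
    {ρ R r q : ℝ} (hρ : 0 < ρ) (hρR : ρ < R) (hr : 0 ≤ r) (hrq : r < q)
    (hR : ∀ y : X, (z : C(X, ℂ)) y ∉ Metric.closedBall z' R)
    (h : ∀ χ : characterSpace ℂ A, χ z ∈ Metric.ball z' ρ → ‖χ e‖ ≤ r)
    {x : characterSpace ℂ A} (hx : ‖x z - z'‖ = ρ) : ‖x e‖ ≤ q := by
  have : CompleteSpace A := hA.completeSpace_coe
  have hq : 0 < q := hr.trans_lt hrq
  obtain ⟨μ, hμ, -⟩ := exists_extension_norm_eq A.toSubmodule (CharacterSpace.toCLM x)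
  replace hμ : ∀ a : A, μ a = x a := hμ
  set z1 := x z with hz1
  set zc : C(X, ℂ) := Subtype.val z with hzc
  have hres : ∀ ζ ∈ Metric.closedBall z' R, ζ ∈ resolventSet ℂ zc := by
    intro ζ hζ
    rw [← notMem_compl_iff]
    change ζ ∉ spectrum ℂ zc
    rw [ContinuousMap.spectrum_eq_range]
    rintro ⟨y, rfl⟩
    exact hR y hζ
  set Φ : C(X, ℂ) → ℂ → ℂ := fun a ζ => μ (a * (algebraMap ℂ C(X, ℂ) z1 - zc) * resolvent zc ζ)
    with hΦ
  have hΦd : ∀ a, ∀ ζ ∈ Metric.closedBall z' R, DifferentiableAt ℂ (Φ a) ζ := fun a ζ hζ =>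
    μ.differentiableAt.comp ζ ((spectrum.hasDerivAt_resolvent_const_left
      (hres ζ hζ)).differentiableAt.const_mul _)
  have hresc : ContinuousOn (resolvent zc) (Metric.closedBall z' R) := fun ζ hζ =>
    (spectrum.hasDerivAt_resolvent_const_left (hres ζ hζ)).continuousAt.continuousWithinAt
  obtain ⟨C0, hC0⟩ := (isCompact_closedBall z' R).exists_bound_of_continuousOn hresc
  set M : ℝ := ‖μ‖ * (‖algebraMap ℂ C(X, ℂ) z1 - zc‖ * |C0|) + 1 with hM
  have hM0 : 0 < M := by positivity
  have hΦM : ∀ a, ∀ ζ ∈ Metric.closedBall z' R, ‖Φ a ζ‖ ≤ M * ‖a‖ := by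
    intro a ζ hζ
    calc ‖Φ a ζ‖ ≤ ‖μ‖ * (‖a‖ * ‖algebraMap ℂ C(X, ℂ) z1 - zc‖ * |C0|) := by
          refine (μ.le_opNorm _).trans ?_
          gcongr
          refine (norm_mul_le _ _).trans ?_
          gcongr
          · exact norm_mul_le _ _
          · exact (hC0 ζ hζ).trans (le_abs_self _)
      _ ≤ M * ‖a‖ := by
          rw [hM]; nlinarith [norm_nonneg a]
  have hz1m : z1 ∈ Metric.closedBall z' R := by
    rw [mem_closedBall_iff_norm, hx]; exact hρR.le
  have hinv : ∀ ζ ∈ Metric.closedBall z' R,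
      (algebraMap ℂ C(X, ℂ) ζ - zc) * resolvent zc ζ = 1 := fun ζ hζ =>
    Ring.mul_inverse_cancel _ (hres ζ hζ)
  have hΦx : ∀ a : A, Φ a z1 = x a := by
    intro a
    simp only [hΦ]
    rw [mul_assoc, hinv z1 hz1m, mul_one, hμ]
  have hΦ0 : ∀ g : A, ∀ ζ ∈ Metric.closedBall z' R,
      Φ ((z - algebraMap ℂ A ζ) * g : A) ζ = 0 := by
    intro g ζ hζ
    have h1 : (((z - algebraMap ℂ A ζ) * g : A) : C(X, ℂ)) * (algebraMap ℂ C(X, ℂ) z1 - zc) *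
        resolvent zc ζ = ((g * (z - algebraMap ℂ A z1) : A) : C(X, ℂ)) := by
      have := hinv ζ hζ
      push_cast
      linear_combination (-(g : C(X, ℂ)) * (algebraMap ℂ C(X, ℂ) z1 - zc)) * this
    simp only [hΦ]
    rw [h1, hμ, map_mul, map_sub, AlgHomClass.commutes]
    simp [hz1]
  have hΦsub : ∀ a b ζ, Φ (a - b) ζ = Φ a ζ - Φ b ζ := by
    intro a b ζ
    simp only [hΦ]
    rw [← map_sub, ← sub_mul, ← sub_mul]
  set C : ℝ := ‖e‖ + 1 with hC
  have hCpos : 0 < C := by positivity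
  -- the estimate for radii below `ρ`
  have key : ∀ ρ' : ℝ, 0 < ρ' → ρ' < ρ →
      ‖x e‖ ≤ q ^ (1 - (Real.log ρ - Real.log ρ') / (Real.log R - Real.log ρ')) *
        C ^ ((Real.log ρ - Real.log ρ') / (Real.log R - Real.log ρ')) := by
    intro ρ' hρ' hρ'ρ
    set t := (Real.log ρ - Real.log ρ') / (Real.log R - Real.log ρ') with ht
    obtain ⟨N, hN, hN'⟩ := exists_uniform_pow_sub_mul_le (z := z) (e := e) hr hrq
      (isCompact_closedBall z' ρ') (fun χ hχ => h χ (Metric.closedBall_subset_ball hρ'ρ hχ))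
    refine le_of_forall_pow_le_mul_pow (M := M) (by positivity) hN fun j hj => ?_
    have h3 := norm_le_interp_of_mem_closedBall (F := Φ (e ^ (N * j) : A)) (z' := z') (ζ := z1)
      (a := M * q ^ (N * j)) (b := M * C ^ (N * j)) hρ' (hρ'ρ.trans hρR) (hΦd _) ?_ ?_ ?_ ?_
    · rw [hx, ← ht, hΦx, map_pow, norm_pow, Real.mul_rpow hM0.le (by positivity),
        Real.mul_rpow hM0.le (by positivity)] at h3
      refine h3.trans (le_of_eq ?_)
      have hM1 : M ^ (1 - t) * M ^ t = M := by
        rw [← Real.rpow_add hM0]; simp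
      rw [mul_pow, ← Real.rpow_natCast (q ^ _), ← Real.rpow_natCast (C ^ _), ← Real.rpow_mul hq.le,
        ← Real.rpow_mul hCpos.le, mul_comm (1 - t), mul_comm t, Real.rpow_mul hq.le,
        Real.rpow_mul hCpos.le, Real.rpow_natCast, Real.rpow_natCast]
      linear_combination ((q ^ (N * j)) ^ (1 - t) * (C ^ (N * j)) ^ t) * hM1
    · intro w hw
      obtain ⟨g, hg⟩ := exists_pow_mul_sub_mul_le hj
        (hN' w (Metric.sphere_subset_closedBall hw)).choose_spec
      have hwR : w ∈ Metric.closedBall z' R :=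
        Metric.closedBall_subset_closedBall (hρ'ρ.trans hρR).le (Metric.sphere_subset_closedBall hw)
      have h4 : Φ (e ^ (N * j) : A) w = Φ ((e ^ (N * j) - (z - algebraMap ℂ A w) * g : A)) w := by
        rw [Subalgebra.coe_sub, hΦsub, hΦ0 g w hwR, sub_zero]
      rw [h4]
      refine (hΦM _ w hwR).trans ?_
      gcongr
      exact hg
    · intro w hw
      refine (hΦM _ w (Metric.sphere_subset_closedBall hw)).trans ?_
      gcongr
      refine (norm_pow_le' e (Nat.mul_pos hN hj)).trans ?_
      gcongr
      rw [hC]; linarith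
    · rw [hx]; exact hρ'ρ.le
    · rw [hx]; exact hρR.le
  have hlim : Tendsto (fun ρ' : ℝ =>
      q ^ (1 - (Real.log ρ - Real.log ρ') / (Real.log R - Real.log ρ')) *
        C ^ ((Real.log ρ - Real.log ρ') / (Real.log R - Real.log ρ'))) (𝓝[<] ρ) (𝓝 q) := by
    have hlogc : ContinuousAt Real.log ρ := Real.continuousAt_log hρ.ne'
    have hne : Real.log R - Real.log ρ ≠ 0 := (sub_pos.2 (Real.log_lt_log hρ hρR)).ne'
    have ht : ContinuousAt
        (fun ρ' : ℝ => (Real.log ρ - Real.log ρ') / (Real.log R - Real.log ρ')) ρ :=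
      (continuousAt_const.sub hlogc).div (continuousAt_const.sub hlogc) hne
    have h5 : ContinuousAt (fun ρ' : ℝ =>
      q ^ (1 - (Real.log ρ - Real.log ρ') / (Real.log R - Real.log ρ')) *
        C ^ ((Real.log ρ - Real.log ρ') / (Real.log R - Real.log ρ'))) ρ :=
      (continuousAt_const.rpow (continuousAt_const.sub ht) (Or.inl hq.ne')).mul
        (continuousAt_const.rpow ht (Or.inl hCpos.ne'))
    have h6 := h5.tendsto.mono_left (nhdsWithin_le_nhds (s := Iio ρ))
    simpa using h6
  refine ge_of_tendsto hlim ?_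
  filter_upwards [Ioo_mem_nhdsLT hρ] with ρ' hρ'
  exact key ρ' hρ'.1 hρ'.2

lemma eventually_exists_character (hA : IsClosed (A : Set C(X, ℂ))) {z e : A} {W : Set ℂ}
    (hW : IsOpen W) (hzW : ∀ y : X, (z : C(X, ℂ)) y ∉ W)
    (h : ∀ χ : characterSpace ℂ A, χ z ∈ W → ‖χ e‖ ≤ 1 / 3 ∨ 2 / 3 ≤ ‖χ e‖)
    {χ₁ : characterSpace ℂ A} (h1W : χ₁ z ∈ W) (h1 : 2 / 3 ≤ ‖χ₁ e‖) :
    ∀ᶠ ζ in 𝓝 (χ₁ z), ∃ χ : characterSpace ℂ A, χ z = ζ ∧ 2 / 3 ≤ ‖χ e‖ := by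
  have : CompleteSpace A := hA.completeSpace_coe
  obtain ⟨ε, hε, hεW⟩ := Metric.isOpen_iff.1 hW _ h1W
  have hev : ∀ a : A, Continuous fun χ : characterSpace ℂ A => χ a := fun a =>
    (WeakDual.eval_continuous a).comp continuous_subtype_val
  filter_upwards [Metric.ball_mem_nhds (χ₁ z) (show 0 < ε / 4 by positivity)] with z' hz'
  set S : Set (characterSpace ℂ A) := {χ | 2 / 3 ≤ ‖χ e‖} with hS
  have hSc : IsCompact S :=
    (isClosed_le continuous_const (hev e).norm).isCompact
  obtain ⟨x, hxS, hxmin⟩ := hSc.exists_isMinOn ⟨χ₁, h1⟩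
    (f := fun χ => ‖χ z - z'‖) ((hev z).sub continuous_const).norm.continuousOn
  rw [isMinOn_iff] at hxmin
  by_contra! hcon
  have hpos : 0 < ‖x z - z'‖ := by
    rw [norm_pos_iff, sub_ne_zero]
    intro h0
    exact (hcon x h0).not_ge hxS
  have hlt : ‖x z - z'‖ < ε / 4 := by
    refine (hxmin χ₁ h1).trans_lt ?_
    rwa [← dist_eq_norm, dist_comm]
  have hsub : Metric.closedBall z' (ε / 2) ⊆ W := by
    refine Subset.trans ?_ hεW
    intro w hw
    have h2 := dist_triangle w z' (χ₁ z)
    rw [Metric.mem_closedBall] at hw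
    rw [Metric.mem_ball] at hz' ⊢
    linarith
  have key := norm_character_le_of_annulus (r := 1 / 3) (q := 1 / 2) (R := ε / 2) (e := e) hA hpos
    (by linarith) (by norm_num) (by norm_num) (fun y hy => hzW y (hsub hy)) (fun χ hχ => by
      have hχW : χ z ∈ W :=
        hsub (Metric.closedBall_subset_closedBall (by linarith) (Metric.ball_subset_closedBall hχ))
      refine (h χ hχW).resolve_right fun hχe => ?_
      rw [mem_ball_iff_norm] at hχ
      exact (hxmin χ hχe).not_gt hχ) rfl
  have h3 : (2 : ℝ) / 3 ≤ ‖x e‖ := hxS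
  linarith

end Functional

end TotallyRealDiscHull

namespace TotallyRealDiscHull

open Set Filter Topology WeakDual

section Peak

variable {X : Type*} [TopologicalSpace X] {A : Subalgebra ℂ C(X, ℂ)}

/-- Evaluation at a point, as a homomorphism on a subalgebra of `C(X, ℂ)`. -/
def ev (y : X) : A →ₐ[ℂ] ℂ := (ContinuousMap.evalAlgHom ℂ ℂ y).comp A.val

lemma continuous_ev (f : A) : Continuous fun y => ev y f := (f : C(X, ℂ)).continuous

variable [CompactSpace X]

lemma continuous_character_apply {B : Type*} [NormedCommRing B] [NormedAlgebra ℂ B] (a : B) :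
    Continuous fun χ : characterSpace ℂ B => χ a :=
  (WeakDual.eval_continuous a).comp continuous_subtype_val

lemma norm_character_apply_le {B : Type*} [NormedCommRing B] [NormedAlgebra ℂ B] [CompleteSpace B]
    (χ : characterSpace ℂ B) (b : B) : ‖χ b‖ ≤ ‖b‖ * ‖(1 : B)‖ :=
  spectrum.norm_le_norm_mul_of_mem (CharacterSpace.mem_spectrum_iff_exists.2 ⟨χ, rfl⟩)

lemma isBounded_connectedComponentIn_of_character (hA : IsClosed (A : Set C(X, ℂ))) (z : A)
    (χ : characterSpace ℂ A) :
    Bornology.IsBounded (connectedComponentIn (range (z : C(X, ℂ)))ᶜ (χ z)) := by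
  have : CompleteSpace A := hA.completeSpace_coe
  have h1 : χ z ∈ spectrum ℂ z := CharacterSpace.mem_spectrum_iff_exists.2 ⟨χ, rfl⟩
  have := Subalgebra.spectrum_isBounded_connectedComponentIn (hS := hA) A z h1
  rwa [ContinuousMap.spectrum_eq_range] at this

lemma exists_character_of_mem_connectedComponentIn (hA : IsClosed (A : Set C(X, ℂ))) (z : A)
    (χ : characterSpace ℂ A) {ζ : ℂ}
    (hζ : ζ ∈ connectedComponentIn (range (z : C(X, ℂ)))ᶜ (χ z)) :
    ∃ χ' : characterSpace ℂ A, χ' z = ζ := by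
  have : CompleteSpace A := hA.completeSpace_coe
  rw [← CharacterSpace.mem_spectrum_iff_exists,
    Subalgebra.spectrum_sUnion_connectedComponentIn (hS := hA) A z, ContinuousMap.spectrum_eq_range]
  refine Or.inr (mem_iUnion₂.2 ⟨χ z, ⟨CharacterSpace.mem_spectrum_iff_exists.2 ⟨χ, rfl⟩, ?_⟩, hζ⟩)
  by_contra h
  rw [connectedComponentIn_eq_empty (by simpa using h)] at hζ
  exact hζ

lemma norm_ev_le (f : A) (y : X) : ‖ev y f‖ ≤ ‖f‖ :=
  ContinuousMap.norm_coe_le_norm (f : C(X, ℂ)) y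

lemma norm_character_le [Nonempty X] (hA : IsClosed (A : Set C(X, ℂ))) (χ : characterSpace ℂ A)
    {f : A} {δ : ℝ} (hδ : 0 ≤ δ) (hf : ∀ y, ‖ev y f‖ ≤ δ) : ‖χ f‖ ≤ δ := by
  have : CompleteSpace A := hA.completeSpace_coe
  have h1 : ‖f‖ ≤ δ := (ContinuousMap.norm_le (f : C(X, ℂ)) hδ).2 hf
  have h2 : ‖(1 : A)‖ = 1 := norm_one (α := C(X, ℂ))
  have h3 := norm_character_apply_le χ f
  rw [h2, mul_one] at h3
  exact h3.trans h1

/-- `c` is a point of `L` touched by a disc centred in the unbounded component of `Lᶜ`. -/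
def IsPeak (L : Set ℂ) (c : ℂ) : Prop :=
  ∃ a r, 0 < r ∧ ¬ Bornology.IsBounded (connectedComponentIn Lᶜ a) ∧ ‖c - a‖ = r ∧
    ∀ z ∈ L, ‖z - a‖ ≤ r → z = c

lemma norm_character_le_of_isPeak [Nonempty X] (hA : IsClosed (A : Set C(X, ℂ))) {z f : A}
    {χ : characterSpace ℂ A} (hp : IsPeak (range fun y => ev y z) (χ z)) {δ : ℝ} (hδ : 0 < δ)
    (hf : ∀ y, ev y z = χ z → ‖ev y f‖ < δ) : ‖χ f‖ ≤ δ := by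
  obtain ⟨a, r, hr, hb, hca, hL⟩ := hp
  obtain ⟨g, hgA⟩ : ∃ g : A, g * (algebraMap ℂ A a - z) = 1 := by
    obtain ⟨g₀, hg₀, hg1⟩ := exists_mul_sub_eq_one hA z.2 hb
    exact ⟨⟨g₀, hg₀⟩, Subtype.ext hg1⟩
  have hgn : ∀ y, ‖ev y g‖ * ‖ev y z - a‖ = 1 := fun y => by
    have := congrArg (fun F => ‖ev y F‖) hgA
    rw [norm_sub_rev]
    simpa only [map_mul, map_sub, AlgHom.commutes, map_one, norm_mul, norm_one,
      Algebra.algebraMap_self, RingHom.id_apply] using this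
  have hχg : ‖χ g‖ * r = 1 := by
    have := congrArg (fun F => ‖χ F‖) hgA
    rw [← hca, norm_sub_rev]
    simpa only [map_mul, map_sub, AlgHomClass.commutes, map_one, norm_mul, norm_one,
      Algebra.algebraMap_self, RingHom.id_apply] using this
  have hle : ∀ y, r * ‖ev y g‖ ≤ 1 := by
    intro y
    have h1 : r ≤ ‖ev y z - a‖ := by
      by_contra! h
      rw [hL _ (mem_range_self y) h.le, hca] at h
      exact h.false
    nlinarith [hgn y, norm_nonneg (ev y g)]
  set F : Set X := {y | δ ≤ ‖ev y f‖} with hF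
  have hFc : IsCompact F := (isClosed_le continuous_const (continuous_ev f).norm).isCompact
  have hlt : ∀ y ∈ F, r * ‖ev y g‖ < 1 := by
    intro y hy
    have h1 : r < ‖ev y z - a‖ := by
      by_contra! h
      exact (hf y (hL _ (mem_range_self y) h)).not_ge hy
    have h2 : 0 < ‖ev y g‖ := by
      by_contra! h
      have := hgn y
      rw [le_antisymm h (norm_nonneg _)] at this
      simp at this
    nlinarith [hgn y]
  obtain ⟨θ, hθ0, hθ1, hθ⟩ : ∃ θ : ℝ, 0 ≤ θ ∧ θ < 1 ∧ ∀ y ∈ F, r * ‖ev y g‖ ≤ θ := by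
    rcases F.eq_empty_or_nonempty with h | h
    · exact ⟨0, le_rfl, one_pos, by simp [h]⟩
    · obtain ⟨y, hy, hmax⟩ := hFc.exists_isMaxOn h (f := fun y => r * ‖ev y g‖)
        (continuous_const.mul (continuous_ev g).norm).continuousOn
      exact ⟨r * ‖ev y g‖, by positivity, hlt y hy, fun x hx => hmax hx⟩
  have hlim : Tendsto (fun N : ℕ => θ ^ N * ‖f‖) atTop (𝓝 (0 * ‖f‖)) :=
    (tendsto_pow_atTop_nhds_zero_of_lt_one hθ0 hθ1).mul_const _
  rw [zero_mul] at hlim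
  obtain ⟨N, hN⟩ := (hlim.eventually_lt_const hδ).exists
  have hnorm := norm_character_le hA χ (f := (algebraMap ℂ A r * g) ^ N * f) hδ.le (by
    intro y
    rw [map_mul, map_pow, map_mul, AlgHom.commutes, Algebra.algebraMap_self, RingHom.id_apply,
      norm_mul, norm_pow, norm_mul, Complex.norm_real, Real.norm_of_nonneg hr.le]
    by_cases hy : y ∈ F
    · refine le_trans ?_ hN.le
      gcongr
      · exact hθ y hy
      · exact norm_ev_le f y
    · have h2 : ‖ev y f‖ < δ := not_le.1 hy
      have h3 : (r * ‖ev y g‖) ^ N ≤ 1 := pow_le_one₀ (by positivity) (hle y)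
      nlinarith [norm_nonneg (ev y f)])
  rwa [map_mul, map_pow, map_mul, AlgHomClass.commutes, Algebra.algebraMap_self, RingHom.id_apply,
    norm_mul, norm_pow, norm_mul, Complex.norm_real, Real.norm_of_nonneg hr.le, mul_comm r, hχg,
    one_pow, one_mul] at hnorm

/-- The polynomials are dense in the continuous functions on `K`. -/
def PolyDense (K : Set ℂ) : Prop :=
  ∀ u : ℂ → ℂ, ContinuousOn u K → ∀ ε > 0, ∃ p : Polynomial ℂ, ∀ τ ∈ K, ‖p.eval τ - u τ‖ < ε

lemma map_aeval_eq_eval {B F : Type*} [CommRing B] [Algebra ℂ B] [FunLike F B ℂ]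
    [AlgHomClass F ℂ B ℂ] (χ : F) (p : Polynomial ℂ) (w : B) :
    χ (Polynomial.aeval w p) = p.eval (χ w) := by
  rw [← Polynomial.coe_aeval_eq_eval]
  exact (Polynomial.aeval_algHom_apply χ w p).symm

lemma exists_eq_of_isPeak [Nonempty X] (hA : IsClosed (A : Set C(X, ℂ))) {z w : A}
    {χ : characterSpace ℂ A} (hp : IsPeak (range fun y => ev y z) (χ z))
    (hd : PolyDense ((fun y => ev y w) '' {y | ev y z = χ z})) :
    ∃ y, ev y z = χ z ∧ ev y w = χ w := by
  by_contra! hcon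
  set m : A := w - algebraMap ℂ A (χ w) with hm
  have hmy : ∀ y, ev y m = ev y w - χ w := fun y => by
    rw [hm, map_sub, AlgHom.commutes]; rfl
  have hmχ : χ m = 0 := by
    rw [hm, map_sub, AlgHomClass.commutes]; exact sub_self _
  set ε : ℝ := 1 / (2 * (‖m‖ + 1)) with hε
  obtain ⟨q, hq⟩ := hd (fun τ => (τ - χ w)⁻¹) (by
    refine ContinuousOn.inv₀ (by fun_prop) ?_
    rintro _ ⟨y, hy, rfl⟩
    rw [sub_ne_zero]
    exact hcon y hy) ε (by positivity)
  have key := norm_character_le_of_isPeak (f := 1 - Polynomial.aeval w q * m) (δ := 1 / 2) hA hp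
    (by norm_num) (by
      intro y hy
      have h0 : ev y m ≠ 0 := by rw [hmy]; exact sub_ne_zero.2 (hcon y hy)
      have h1 : ev y (1 - Polynomial.aeval w q * m) =
          -((q.eval (ev y w) - (ev y m)⁻¹) * ev y m) := by
        rw [map_sub, map_mul, map_one, map_aeval_eq_eval]
        field_simp
        ring
      have h2 := hq _ (mem_image_of_mem _ hy)
      rw [h1, norm_neg, norm_mul]
      rw [← hmy] at h2
      calc _ ≤ ε * ‖ev y m‖ := by gcongr
        _ ≤ ε * ‖m‖ := by gcongr; exact norm_ev_le m y
        _ < ε * (‖m‖ + 1) := by gcongr; linarith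
        _ = 1 / 2 := by rw [hε]; field_simp)
  rw [map_sub, map_mul, hmχ, mul_zero, map_one, sub_zero, norm_one] at key
  norm_num at key

end Peak

end TotallyRealDiscHull

namespace TotallyRealDiscHull

open Set Filter Topology WeakDual

lemma eventually_forall_fiber_mem {Δ Y : Type*} [TopologicalSpace Δ] [CompactSpace Δ]
    [TopologicalSpace Y] [T2Space Y] {f : Δ → Y} (hf : Continuous f) {O : Set Δ} (hO : IsOpen O)
    {c : Y} (hc : ∀ χ, f χ = c → χ ∈ O) : ∀ᶠ ζ in 𝓝 c, ∀ χ, f χ = ζ → χ ∈ O := by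
  have h1 : IsClosed (f '' Oᶜ) := hf.isClosedMap _ hO.isClosed_compl
  have h2 : c ∉ f '' Oᶜ := by
    rintro ⟨χ, hχ, rfl⟩
    exact hχ (hc χ rfl)
  filter_upwards [h1.isOpen_compl.mem_nhds h2] with ζ hζ χ hχ
  by_contra hcon
  exact hζ ⟨χ, hcon, hχ⟩

lemma eq_or_lt_norm_sub_of_exp_eq {x y : ℂ} (h : Complex.exp x = Complex.exp y) :
    x = y ∨ 6 < |x.im - y.im| := by
  obtain ⟨n, hn⟩ := Complex.exp_eq_exp_iff_exists_int.1 h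
  rcases eq_or_ne n 0 with rfl | hn0
  · left; simpa using hn
  · right
    have h1 : x.im - y.im = n * (2 * Real.pi) := by rw [hn]; simp
    have h2 : (1 : ℝ) ≤ |(n : ℝ)| := by exact_mod_cast Int.one_le_abs hn0
    have h3 := Real.pi_gt_three
    rw [h1, abs_mul, abs_of_pos (show 0 < 2 * Real.pi by positivity)]
    nlinarith

section Interior

variable {X : Type*} [TopologicalSpace X] [CompactSpace X] {A : Subalgebra ℂ C(X, ℂ)}

lemma exists_log_near {z w : A} {z₀ : ℂ}
    (hinj : ∀ x y, ev x z = ev y z → ev x w = ev y w → x = y)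
    (hlog : HasLogOn (fun y => ev y z - z₀) (univ : Set X))
    (hfib : ∀ χ : characterSpace ℂ A, χ z ∈ range (fun y => ev y z) →
      ∃ y, ev y z = χ z ∧ ev y w = χ w) :
    ∃ (Ω : Set (characterSpace ℂ A)) (lh : characterSpace ℂ A → ℂ) (l : C(ℂ × ℂ, ℂ)),
      IsOpen Ω ∧ ContinuousOn lh Ω ∧ (∀ χ ∈ Ω, Complex.exp (lh χ) = χ z - z₀) ∧
      ∀ χ : characterSpace ℂ A, χ z ∈ range (fun y => ev y z) → χ ∈ Ω ∧ lh χ = l (χ z, χ w) := by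
  obtain ⟨l₀, hl₀, hl₀'⟩ := hlog
  have hemb : IsClosedEmbedding fun y : X => (ev y z, ev y w) :=
    ((continuous_ev z).prodMk (continuous_ev w)).isClosedEmbedding fun x y hxy => by
      rw [Prod.mk.injEq] at hxy
      exact hinj x y hxy.1 hxy.2
  obtain ⟨l, hl⟩ := ContinuousMap.exists_extension hemb ⟨l₀, continuousOn_univ.1 hl₀⟩
  have hll : ∀ y, l (ev y z, ev y w) = l₀ y := fun y => congrArg (fun F => F y) hl
  set D : characterSpace ℂ A → ℂ := fun χ => l (χ z, χ w) with hD
  have hz := continuous_character_apply z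
  have hDc : Continuous D :=
    l.continuous.comp (hz.prodMk (continuous_character_apply w))
  set q : characterSpace ℂ A → ℂ := fun χ => Complex.exp (D χ) / (χ z - z₀) with hq
  set O : Set (characterSpace ℂ A) := {χ | χ z ≠ z₀} with hO
  have hOo : IsOpen O := isOpen_ne_fun hz continuous_const
  have hqc : ContinuousOn q O := hDc.cexp.continuousOn.div
    (hz.sub continuous_const).continuousOn fun χ hχ => sub_ne_zero.2 hχ
  have hsl : ∀ v ∈ Metric.ball (1 : ℂ) 1, v ∈ Complex.slitPlane := fun v hv =>
    Complex.ball_one_subset_slitPlane hv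
  refine ⟨O ∩ q ⁻¹' Metric.ball 1 1, fun χ => D χ - Complex.log (q χ), l,
    hqc.isOpen_inter_preimage hOo Metric.isOpen_ball, ?_, ?_, ?_⟩
  · exact hDc.continuousOn.sub ((hqc.mono inter_subset_left).clog fun χ hχ => hsl _ hχ.2)
  · rintro χ ⟨h1, h2⟩
    have h3 : q χ ≠ 0 := Complex.slitPlane_ne_zero (hsl _ h2)
    have h4 : χ z - z₀ ≠ 0 := sub_ne_zero.2 h1
    rw [Complex.exp_sub, Complex.exp_log h3]
    simp only [hq]
    field_simp
  · intro χ hχ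
    obtain ⟨y, hy1, hy2⟩ := hfib χ hχ
    have h1 : Complex.exp (D χ) = χ z - z₀ := by
      simp only [hD]
      rw [← hy1, ← hy2, hll, hl₀' y (mem_univ y)]
    have h2 : χ z - z₀ ≠ 0 := h1 ▸ Complex.exp_ne_zero _
    have h3 : q χ = 1 := by
      simp only [hq]
      rw [h1, div_self h2]
    refine ⟨⟨sub_ne_zero.1 h2, ?_⟩, ?_⟩
    · rw [mem_preimage, h3]; exact Metric.mem_ball_self one_pos
    · change D χ - Complex.log (q χ) = _
      rw [h3, Complex.log_one, sub_zero]

lemma eventually_log_persists (hA : IsClosed (A : Set C(X, ℂ))) {z w : A} {z₀ : ℂ}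
    {Ω : Set (characterSpace ℂ A)} {lh : characterSpace ℂ A → ℂ} {l : C(ℂ × ℂ, ℂ)} (hΩ : IsOpen Ω)
    (hlh : ContinuousOn lh Ω) (hexp : ∀ χ ∈ Ω, Complex.exp (lh χ) = χ z - z₀)
    (hL : ∀ χ : characterSpace ℂ A, χ z ∈ range (fun y => ev y z) → χ ∈ Ω ∧ lh χ = l (χ z, χ w))
    (hfib : ∀ χ : characterSpace ℂ A, χ z ∈ range (fun y => ev y z) →
      ∃ y, ev y z = χ z ∧ ev y w = χ w)
    {χ₀ : characterSpace ℂ A} (hχ₀ : χ₀ z ∈ range fun y => ev y z)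
    (hd : PolyDense ((fun y => ev y w) '' {y | ev y z = χ₀ z})) :
    ∀ᶠ χ₁ in 𝓝 χ₀, χ₁ z ∉ (range fun y => ev y z) → χ₁ ∈ Ω ∧
      ∀ᶠ ζ in 𝓝 (χ₁ z), ∃ χ ∈ Ω, χ z = ζ ∧ ‖lh χ - lh χ₁‖ < 2 := by
  have : CompleteSpace A := hA.completeSpace_coe
  set v := lh χ₀ with hv
  set c := χ₀ z with hc
  have hzc := continuous_character_apply z
  obtain ⟨p, hp⟩ := hd (fun τ => ((max 0 (1 - ‖l (c, τ) - v‖) : ℝ) : ℂ)) (by fun_prop) (1 / 4)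
    (by norm_num)
  set e : A := Polynomial.aeval w p with he
  have hec := continuous_character_apply e
  set O : Set (characterSpace ℂ A) := (Ω ∩ lh ⁻¹' Metric.ball v 1 ∩ {χ | ‖χ e - 1‖ < 1 / 3}) ∪
    (Ω ∩ lh ⁻¹' {x | 1 < ‖x - v‖} ∩ {χ | ‖χ e‖ < 1 / 3}) with hO
  have hOo : IsOpen O := by
    refine IsOpen.union (IsOpen.inter ?_ ?_) (IsOpen.inter ?_ ?_)
    · exact hlh.isOpen_inter_preimage hΩ Metric.isOpen_ball
    · exact isOpen_lt (hec.sub continuous_const).norm continuous_const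
    · exact hlh.isOpen_inter_preimage hΩ (isOpen_lt continuous_const (by fun_prop))
    · exact isOpen_lt hec.norm continuous_const
  have hfO : ∀ χ : characterSpace ℂ A, χ z = c → χ ∈ O := by
    intro χ hχ
    have hχL : χ z ∈ range fun y => ev y z := hχ ▸ hχ₀
    obtain ⟨hχΩ, hχl⟩ := hL χ hχL
    obtain ⟨y, hy1, hy2⟩ := hfib χ hχL
    have h1 := hp (χ w) ⟨y, hy1.trans hχ, hy2⟩
    rw [← map_aeval_eq_eval χ p w, ← he] at h1
    simp only [← hχ] at h1
    rw [← hχl] at h1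
    have h2 : Complex.exp (lh χ) = Complex.exp v := by
      rw [hexp χ hχΩ, hv, hexp χ₀ (hL χ₀ hχ₀).1, hχ]
    rcases eq_or_lt_norm_sub_of_exp_eq h2 with h3 | h3
    · left
      refine ⟨⟨hχΩ, ?_⟩, ?_⟩
      · rw [mem_preimage, h3]; exact Metric.mem_ball_self one_pos
      · rw [h3] at h1
        have h4 : ‖χ e - 1‖ < 1 / 4 := by simpa using h1
        exact h4.trans (by norm_num)
    · right
      have h5 : 1 < ‖lh χ - v‖ := by
        have := Complex.abs_im_le_norm (lh χ - v)
        rw [Complex.sub_im] at this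
        linarith
      refine ⟨⟨hχΩ, h5⟩, ?_⟩
      rw [max_eq_left (by linarith)] at h1
      have h4 : ‖χ e‖ < 1 / 4 := by simpa using h1
      exact h4.trans (by norm_num)
  obtain ⟨r, hr, hrO⟩ := Metric.eventually_nhds_iff_ball.1
    (eventually_forall_fiber_mem hzc hOo hfO)
  set W : Set ℂ := Metric.ball c r \ range fun y => ev y z with hW
  have hWo : IsOpen W :=
    Metric.isOpen_ball.sdiff (isCompact_range (continuous_ev z)).isClosed
  have hΩ₀ := (hL χ₀ hχ₀).1
  have hev1 : ∀ᶠ χ₁ in 𝓝 χ₀, χ₁ ∈ Ω ∧ lh χ₁ ∈ Metric.ball v 1 :=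
    (hlh.isOpen_inter_preimage hΩ Metric.isOpen_ball).mem_nhds
      ⟨hΩ₀, Metric.mem_ball_self one_pos⟩
  filter_upwards [hev1, hzc.continuousAt.eventually_mem (Metric.ball_mem_nhds c hr)]
    with χ₁ ⟨hχ₁, hlv⟩ hχ₁c hχ₁L
  refine ⟨hχ₁, ?_⟩
  have hsmall : ∀ χ ∈ O, lh χ ∈ Metric.ball v 1 → 2 / 3 ≤ ‖χ e‖ := by
    rintro χ (⟨-, h1⟩ | ⟨⟨-, h1⟩, -⟩) h2
    · have h3 : ‖χ e - 1‖ < 1 / 3 := h1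
      have h4 := norm_sub_norm_le 1 (χ e)
      rw [norm_sub_rev, norm_one] at h4
      linarith
    · have h3 : 1 < ‖lh χ - v‖ := h1
      rw [mem_ball_iff_norm] at h2
      linarith
  have hlarge : ∀ χ ∈ O, 2 / 3 ≤ ‖χ e‖ → χ ∈ Ω ∧ lh χ ∈ Metric.ball v 1 := by
    rintro χ (⟨h1, -⟩ | ⟨-, h1⟩) h2
    · exact h1
    · have h3 : ‖χ e‖ < 1 / 3 := h1
      linarith
  have hχ₁O := hrO _ hχ₁c χ₁ rfl
  have key := eventually_exists_character hA (z := z) (e := e) hWo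
    (fun y hy => hy.2 (mem_range_self y)) (fun χ hχ => by
      rcases hrO _ hχ.1 χ rfl with h | h
      · exact Or.inr (hsmall χ (Or.inl h) h.1.2)
      · exact Or.inl (le_of_lt h.2)) (χ₁ := χ₁) ⟨hχ₁c, hχ₁L⟩ (hsmall χ₁ hχ₁O hlv)
  filter_upwards [key, Metric.isOpen_ball.mem_nhds hχ₁c] with ζ ⟨χ, hχ, hχe⟩ hζ
  obtain ⟨h1, h2⟩ := hlarge χ (hrO ζ hζ χ hχ) hχe
  refine ⟨χ, h1, hχ, ?_⟩
  rw [mem_ball_iff_norm] at h2 hlv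
  calc ‖lh χ - lh χ₁‖ = ‖(lh χ - v) - (lh χ₁ - v)‖ := by congr 1; ring
    _ ≤ ‖lh χ - v‖ + ‖lh χ₁ - v‖ := norm_sub_le _ _
    _ < 2 := by linarith

lemma connectedComponentIn_level_subset {L : Set ℂ} (hL : IsCompact L) {z₀ : ℂ}
    {η : ℝ} (hη : 0 < η) (hηz : η < Metric.infDist z₀ L) :
    connectedComponentIn {ζ | ζ ∈ connectedComponentIn Lᶜ z₀ ∧ Metric.infDist ζ L = η}ᶜ z₀ ⊆
      connectedComponentIn Lᶜ z₀ := by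
  set W := connectedComponentIn Lᶜ z₀ with hW
  set Y := {ζ | ζ ∈ W ∧ Metric.infDist ζ L = η} with hY
  have hz₀L : z₀ ∈ Lᶜ := fun h => by
    rw [Metric.infDist_zero_of_mem h] at hηz
    exact hηz.not_gt hη
  have hz₀W : z₀ ∈ W := mem_connectedComponentIn hz₀L
  have hz₀Y : z₀ ∈ Yᶜ := fun h => hηz.ne' h.2
  set V := {ζ | ζ ∈ W ∧ η < Metric.infDist ζ L} with hV
  suffices h : connectedComponentIn Yᶜ z₀ ⊆ V from h.trans fun ζ hζ => hζ.1
  have hVo : IsOpen V := hL.isClosed.isOpen_compl.connectedComponentIn.inter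
    (isOpen_lt continuous_const (Metric.continuous_infDist_pt L))
  refine isPreconnected_connectedComponentIn.subset_of_closure_inter_subset hVo
    ⟨z₀, mem_connectedComponentIn hz₀Y, hz₀W, hηz⟩ ?_
  rintro x ⟨hxV, hx⟩
  by_contra hxV'
  refine connectedComponentIn_subset _ _ hx ?_
  have hxη : η ≤ Metric.infDist x L := by
    have : V ⊆ {ζ | η ≤ Metric.infDist ζ L} := fun ζ hζ => hζ.2.le
    exact closure_minimal this (isClosed_le continuous_const (Metric.continuous_infDist_pt L))
      hxV
  have hxL : x ∉ L := fun h => by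
    rw [Metric.infDist_zero_of_mem h] at hxη
    exact hxη.not_gt hη
  have hxW : x ∈ W := by
    by_contra h
    have h1 : x ∈ frontier W := by
      refine ⟨closure_mono (fun ζ hζ => hζ.1) hxV, fun h2 => h (interior_subset h2)⟩
    exact hxL (frontier_connectedComponentIn_subset hL.isClosed z₀ h1)
  refine ⟨hxW, le_antisymm ?_ hxη⟩
  by_contra! h
  exact hxV' ⟨hxW, h⟩

theorem character_mem_range_of_fibers [Nonempty X] (hA : IsClosed (A : Set C(X, ℂ))) {z w : A}
    (hinj : ∀ x y, ev x z = ev y z → ev x w = ev y w → x = y)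
    (hlog : ∀ z₀ ∉ range (fun y => ev y z), HasLogOn (fun y => ev y z - z₀) (univ : Set X))
    (hpeak : ∀ c ∈ range (fun y => ev y z), IsPeak (range fun y => ev y z) c)
    (hd : ∀ c ∈ range (fun y => ev y z), PolyDense ((fun y => ev y w) '' {y | ev y z = c}))
    (χ₀ : characterSpace ℂ A) : ∃ y, ev y z = χ₀ z ∧ ev y w = χ₀ w := by
  have : CompleteSpace A := hA.completeSpace_coe
  set L : Set ℂ := range fun y => ev y z with hLdef
  have hfib : ∀ χ : characterSpace ℂ A, χ z ∈ L → ∃ y, ev y z = χ z ∧ ev y w = χ w :=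
    fun χ hχ => exists_eq_of_isPeak hA (hpeak _ hχ) (hd _ hχ)
  by_cases hz₀ : χ₀ z ∈ L
  · exact hfib χ₀ hz₀
  exfalso
  have hLc : IsCompact L := isCompact_range (continuous_ev z)
  have hLne : L.Nonempty := range_nonempty _
  set z₀ := χ₀ z with hz₀def
  set W := connectedComponentIn Lᶜ z₀ with hW
  have hWb : Bornology.IsBounded W := isBounded_connectedComponentIn_of_character hA z χ₀
  have hzc := continuous_character_apply z
  obtain ⟨Ω, lh, l, hΩ, hlh, hexp, hL⟩ := exists_log_near hinj (hlog z₀ hz₀) hfib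
  set P : characterSpace ℂ A → Prop := fun χ₁ => χ₁ z ∉ L → χ₁ ∈ Ω ∧
      ∀ᶠ ζ in 𝓝 (χ₁ z), ∃ χ ∈ Ω, χ z = ζ ∧ ‖lh χ - lh χ₁‖ < 2 with hP
  have hPL : ∀ χ : characterSpace ℂ A, χ z ∈ L → χ ∈ interior {χ | P χ} := fun χ hχ =>
    mem_interior_iff_mem_nhds.2 (eventually_log_persists hA hΩ hlh hexp hL hfib hχ (hd _ hχ))
  obtain ⟨η₀, hη₀, hη₀P⟩ : ∃ η₀ > 0, ∀ χ : characterSpace ℂ A,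
      Metric.infDist (χ z) L < η₀ → P χ := by
    have hcl : IsClosed ((fun χ : characterSpace ℂ A => Metric.infDist (χ z) L) ''
        (interior {χ | P χ})ᶜ) :=
      (((Metric.continuous_infDist_pt L).comp hzc).isClosedMap) _ isOpen_interior.isClosed_compl
    have h0 : (0 : ℝ) ∉ (fun χ : characterSpace ℂ A => Metric.infDist (χ z) L) ''
        (interior {χ | P χ})ᶜ := by
      rintro ⟨χ, hχ, h⟩
      exact hχ (hPL χ ((hLc.isClosed.mem_iff_infDist_zero hLne).2 h))
    obtain ⟨η₀, hη₀, hsub⟩ := Metric.isOpen_iff.1 hcl.isOpen_compl 0 h0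
    refine ⟨η₀, hη₀, fun χ hχ => ?_⟩
    by_contra hcon
    refine hsub (a := Metric.infDist (χ z) L) ?_ ⟨χ, fun h => hcon (interior_subset h), rfl⟩
    rw [mem_ball_zero_iff, Real.norm_of_nonneg Metric.infDist_nonneg]
    exact hχ
  have hd₀ : 0 < Metric.infDist z₀ L := (hLc.isClosed.notMem_iff_infDist_pos hLne).1 hz₀
  set η := min (η₀ / 2) (Metric.infDist z₀ L / 2) with hη
  have hηpos : 0 < η := by positivity
  have hηη₀ : η < η₀ := (min_le_left _ _).trans_lt (by linarith)
  have hηz₀ : η < Metric.infDist z₀ L := (min_le_right _ _).trans_lt (by linarith)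
  set Y : Set ℂ := {ζ | ζ ∈ W ∧ Metric.infDist ζ L = η} with hY
  have hYL : ∀ ζ ∈ Y, ζ ∉ L := fun ζ hζ h => by
    have := hζ.2
    rw [Metric.infDist_zero_of_mem h] at this
    exact hηpos.ne this
  have hYc : IsCompact Y := by
    refine Metric.isCompact_of_isClosed_isBounded ?_ (hWb.subset fun ζ hζ => hζ.1)
    have : Y = closure W ∩ {ζ | Metric.infDist ζ L = η} := by
      refine Subset.antisymm (fun ζ hζ => ⟨subset_closure hζ.1, hζ.2⟩) fun ζ hζ => ⟨?_, hζ.2⟩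
      by_contra h
      have h1 : ζ ∈ frontier W := ⟨hζ.1, fun h2 => h (interior_subset h2)⟩
      have h2 := hζ.2
      rw [mem_ofPred_eq, Metric.infDist_zero_of_mem
        (frontier_connectedComponentIn_subset hLc.isClosed z₀ h1)] at h2
      exact hηpos.ne h2
    rw [this]
    exact isClosed_closure.inter
      (isClosed_eq (Metric.continuous_infDist_pt L) continuous_const)
  have hYP : ∀ χ : characterSpace ℂ A, χ z ∈ Y → χ ∈ Ω ∧
      ∀ᶠ ζ in 𝓝 (χ z), ∃ χ' ∈ Ω, χ' z = ζ ∧ ‖lh χ' - lh χ‖ < 2 := fun χ hχ =>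
    hη₀P χ (by rw [hχ.2]; exact hηη₀) (hYL _ hχ)
  have hmax : ∀ ζ : ℂ, ∃ χ : characterSpace ℂ A, ζ ∈ Y → χ z = ζ ∧
      ∀ χ' : characterSpace ℂ A, χ' z = ζ → (lh χ').im ≤ (lh χ).im := by
    intro ζ
    by_cases hζ : ζ ∈ Y
    · have hc : IsCompact {χ : characterSpace ℂ A | χ z = ζ} :=
        (isClosed_eq hzc continuous_const).isCompact
      obtain ⟨χ, hχ, hm⟩ := hc.exists_isMaxOn
        (exists_character_of_mem_connectedComponentIn hA z χ₀ hζ.1)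
        (f := fun χ => (lh χ).im) (Complex.continuous_im.comp_continuousOn
          (hlh.mono fun χ hχ => (hYP χ (by rw [show χ z = ζ from hχ]; exact hζ)).1))
      exact ⟨χ, fun _ => ⟨hχ, fun χ' hχ' => hm hχ'⟩⟩
    · exact ⟨χ₀, fun h => absurd h hζ⟩
  choose M hM using hmax
  have hMY : ∀ ζ ∈ Y, M ζ z ∈ Y := fun ζ hζ => by rw [(hM ζ hζ).1]; exact hζ
  have hMe : ∀ ζ ∈ Y, Complex.exp (lh (M ζ)) = ζ - z₀ := fun ζ hζ => by
    rw [hexp _ (hYP _ (hMY ζ hζ)).1, (hM ζ hζ).1]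
  have hlogY : HasLogOn (fun ζ => ζ - z₀) Y := by
    refine ⟨fun ζ => lh (M ζ), fun ζ₁ hζ₁ => ?_, hMe⟩
    have hne : ζ₁ - z₀ ≠ 0 := hMe ζ₁ hζ₁ ▸ Complex.exp_ne_zero _
    set b : ℂ → ℂ := fun ζ => lh (M ζ₁) + Complex.log ((ζ - z₀) / (ζ₁ - z₀)) with hb
    have hb1 : b ζ₁ = lh (M ζ₁) := by simp [hb, div_self hne]
    have hbc : ContinuousAt b ζ₁ := by
      refine continuousAt_const.add (ContinuousAt.clog (by fun_prop) ?_)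
      rw [div_self hne]
      exact Complex.one_mem_slitPlane
    have hup : ∀ᶠ ζ in 𝓝 ζ₁, ∀ χ : characterSpace ℂ A, χ z = ζ →
        χ ∈ Ω ∩ lh ⁻¹' {x | x.im < (lh (M ζ₁)).im + 1} := by
      refine eventually_forall_fiber_mem hzc (hlh.isOpen_inter_preimage hΩ
        (isOpen_lt Complex.continuous_im continuous_const)) fun χ hχ => ?_
      refine ⟨(hYP χ (by rw [hχ]; exact hζ₁)).1, ?_⟩
      have := (hM ζ₁ hζ₁).2 χ hχ
      change (lh χ).im < _
      linarith
    have hlow := (hYP _ (hMY ζ₁ hζ₁)).2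
    rw [(hM ζ₁ hζ₁).1] at hlow
    have hbn : ∀ᶠ ζ in 𝓝 ζ₁, b ζ ∈ Metric.ball (lh (M ζ₁)) 1 :=
      hbc.eventually_mem (by rw [hb1]; exact Metric.ball_mem_nhds _ one_pos)
    have hnz : ∀ᶠ ζ in 𝓝 ζ₁, ζ - z₀ ≠ 0 :=
      (show ContinuousAt (fun ζ => ζ - z₀) ζ₁ by fun_prop).eventually_ne hne
    refine ContinuousWithinAt.congr_of_eventuallyEq hbc.continuousWithinAt ?_ hb1.symm
    filter_upwards [nhdsWithin_le_nhds hup, nhdsWithin_le_nhds hlow, nhdsWithin_le_nhds hbn,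
      nhdsWithin_le_nhds hnz, self_mem_nhdsWithin] with ζ h1 h2 h3 h4 h5
    have h6 : Complex.exp (lh (M ζ)) = Complex.exp (b ζ) := by
      rw [hMe ζ h5, hb]
      simp only
      rw [Complex.exp_add, hMe ζ₁ hζ₁, Complex.exp_log (div_ne_zero h4 hne)]
      field_simp
    refine (eq_or_lt_norm_sub_of_exp_eq h6).resolve_right ?_
    have h7 : (lh (M ζ)).im < (lh (M ζ₁)).im + 1 := (h1 _ (hM ζ h5).1).2
    obtain ⟨χ, hχ, hχz, hχl⟩ := h2
    have h8 := (hM ζ h5).2 χ hχz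
    have h9 := (Complex.abs_im_le_norm (lh χ - lh (M ζ₁))).trans_lt hχl
    rw [mem_ball_iff_norm] at h3
    have h10 := (Complex.abs_im_le_norm _).trans_lt h3
    rw [Complex.sub_im, abs_lt] at h9 h10
    rw [not_lt, abs_le]
    constructor <;> linarith
  refine not_isBounded_of_hasLogOn hYc (fun h => hηz₀.ne' h.2) hlogY ?_
  exact hWb.subset (connectedComponentIn_level_subset hLc hηpos hηz₀)

end Interior

end TotallyRealDiscHull

namespace TotallyRealDiscHull

open Set Filter Topology WeakDual

section Hull

variable {X : Type*} [TopologicalSpace X] [CompactSpace X]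

lemma exists_mvPolynomial_near {z w : C(X, ℂ)} (a : (MvPolynomial.aeval (R := ℂ)
    ![z, w]).range.topologicalClosure) {ε : ℝ} (hε : 0 < ε) :
    ∃ p : MvPolynomial (Fin 2) ℂ, ∀ y,
      ‖MvPolynomial.eval ![z y, w y] p - ev y a‖ < ε := by
  have h : (a : C(X, ℂ)) ∈ closure ((MvPolynomial.aeval (R := ℂ) ![z, w]).range : Set C(X, ℂ)) :=
    a.2
  obtain ⟨b, ⟨p, hp⟩, hb⟩ := Metric.mem_closure_iff.1 h ε hε
  refine ⟨p, fun y => ?_⟩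
  have h1 : MvPolynomial.eval ![z y, w y] p = b y := by
    have h2 : (ContinuousMap.evalAlgHom ℂ ℂ y).comp (MvPolynomial.aeval (R := ℂ) ![z, w]) =
        MvPolynomial.aeval ![z y, w y] := by
      refine MvPolynomial.algHom_ext fun i => ?_
      fin_cases i <;> simp
    have h3 := DFunLike.congr_fun h2 p
    rw [AlgHom.comp_apply, MvPolynomial.aeval_eq_eval] at h3
    rw [← hp]
    exact h3.symm
  rw [h1, ← dist_eq_norm]
  calc dist (b y) (ev y a) = dist ((a : C(X, ℂ)) y) (b y) := dist_comm _ _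
    _ ≤ dist (a : C(X, ℂ)) b := ContinuousMap.dist_apply_le_dist y
    _ < ε := hb

/-- A compact set over a plane compactum contains every point of its polynomial hull once
the projection has peak discs and logarithms, and polynomials are dense on the fibres. -/
theorem exists_eq_of_mem_hull [Nonempty X] {f g : C(X, ℂ)}
    (hinj : ∀ x y, f x = f y → g x = g y → x = y)
    (hlog : ∀ z₀ ∉ range f, HasLogOn (fun y => f y - z₀) (univ : Set X))
    (hpeak : ∀ c ∈ range f, IsPeak (range f) c)
    (hd : ∀ c ∈ range f, PolyDense (g '' {y | f y = c})) {x : Fin 2 → ℂ}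
    (hx : ∀ (p : MvPolynomial (Fin 2) ℂ) (C : ℝ),
      (∀ y, ‖MvPolynomial.eval ![f y, g y] p‖ ≤ C) → ‖MvPolynomial.eval x p‖ ≤ C) :
    ∃ y, f y = x 0 ∧ g y = x 1 := by
  set A := (MvPolynomial.aeval (R := ℂ) ![f, g]).range.topologicalClosure with hAdef
  have hA : IsClosed (A : Set C(X, ℂ)) := Subalgebra.isClosed_topologicalClosure _
  have : CompleteSpace A := hA.completeSpace_coe
  have hmem : ∀ i, ![f, g] i ∈ A := fun i =>
    Subalgebra.le_topologicalClosure _ ⟨MvPolynomial.X i, MvPolynomial.aeval_X _ _⟩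
  set z : A := ⟨f, hmem 0⟩ with hz
  set w : A := ⟨g, hmem 1⟩ with hw
  set a : A := z - algebraMap ℂ A (x 0) with ha
  set b : A := w - algebraMap ℂ A (x 1) with hb
  have hea : ∀ y, ev y a = f y - x 0 := fun y => by
    rw [ha, map_sub, AlgHom.commutes]; rfl
  have heb : ∀ y, ev y b = g y - x 1 := fun y => by
    rw [hb, map_sub, AlgHom.commutes]; rfl
  have hI : Ideal.span {a, b} ≠ ⊤ := by
    intro hI
    rw [Ideal.eq_top_iff_one, Ideal.mem_span_pair] at hI
    obtain ⟨g₁, g₂, h12⟩ := hI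
    set ε : ℝ := 1 / (2 * (‖a‖ + ‖b‖ + 1)) with hε
    have hε0 : 0 < ε := by positivity
    obtain ⟨p₁, hp₁⟩ := exists_mvPolynomial_near g₁ hε0
    obtain ⟨p₂, hp₂⟩ := exists_mvPolynomial_near g₂ hε0
    have h := hx (p₁ * (MvPolynomial.X 0 - MvPolynomial.C (x 0)) +
      p₂ * (MvPolynomial.X 1 - MvPolynomial.C (x 1)) - 1) (1 / 2) fun y => by
        have h1 : ev y g₁ * (f y - x 0) + ev y g₂ * (g y - x 1) = 1 := by
          rw [← hea, ← heb, ← map_mul, ← map_mul, ← map_add, h12, map_one]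
        simp only [map_sub, map_add, map_mul, MvPolynomial.eval_X, MvPolynomial.eval_C, map_one,
          Matrix.cons_val_zero, Matrix.cons_val_one]
        set P₁ := MvPolynomial.eval ![f y, g y] p₁ with hP₁
        set P₂ := MvPolynomial.eval ![f y, g y] p₂ with hP₂
        calc ‖P₁ * (f y - x 0) + P₂ * (g y - x 1) - 1‖
            = ‖(P₁ - ev y g₁) * (f y - x 0) + (P₂ - ev y g₂) * (g y - x 1)‖ := by
              rw [← h1]; congr 1; ring
          _ ≤ ‖P₁ - ev y g₁‖ * ‖f y - x 0‖ + ‖P₂ - ev y g₂‖ * ‖g y - x 1‖ := by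
              refine (norm_add_le _ _).trans_eq ?_
              rw [norm_mul, norm_mul]
          _ ≤ ε * ‖a‖ + ε * ‖b‖ := by
              rw [← hea, ← heb]
              exact add_le_add
                (mul_le_mul (hp₁ y).le (norm_ev_le a y) (norm_nonneg _) hε0.le)
                (mul_le_mul (hp₂ y).le (norm_ev_le b y) (norm_nonneg _) hε0.le)
          _ ≤ ε * (‖a‖ + ‖b‖ + 1) := by nlinarith
          _ = 1 / 2 := by rw [hε]; field_simp
    simp at h
    norm_num at h
  obtain ⟨m, hm, hIm⟩ := Ideal.exists_le_maximal _ hI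
  have hχ := fun c (hc : c ∈ m) => Ideal.toCharacterSpace_apply_eq_zero_of_mem (I := m) hc
  set χ := Ideal.toCharacterSpace m
  have hχz : χ z = x 0 := by
    have := hχ a (hIm (Ideal.subset_span (by simp)))
    rw [ha, map_sub, AlgHomClass.commutes, sub_eq_zero] at this
    exact this
  have hχw : χ w = x 1 := by
    have := hχ b (hIm (Ideal.subset_span (by simp)))
    rw [hb, map_sub, AlgHomClass.commutes, sub_eq_zero] at this
    exact this
  obtain ⟨y, h1, h2⟩ := character_mem_range_of_fibers hA (z := z) (w := w) hinj hlog hpeak hd χ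
  exact ⟨y, h1.trans hχz, h2.trans hχw⟩

end Hull

lemma hasLogOn_closedBall {u : ℝ × ℝ → ℂ} (hu : ContinuousOn u (Metric.closedBall 0 1))
    (hu0 : ∀ x ∈ Metric.closedBall 0 1, u x ≠ 0) : HasLogOn u (Metric.closedBall 0 1) := by
  set c : ℝ → ℝ := fun t => max (-1) (min 1 t) with hc
  have hcc : Continuous c := by fun_prop
  set r : ℝ × ℝ → ℝ × ℝ := fun x => (c x.1, c x.2) with hr
  have hrc : Continuous r := by fun_prop
  have hS : ∀ x : ℝ × ℝ,
      x ∈ Metric.closedBall (0 : ℝ × ℝ) 1 ↔ |x.1| ≤ 1 ∧ |x.2| ≤ 1 := fun x => by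
    rw [mem_closedBall_zero_iff, Prod.norm_def, sup_le_iff, Real.norm_eq_abs, Real.norm_eq_abs]
  have hcS : ∀ t, |c t| ≤ 1 := fun t =>
    abs_le.2 ⟨le_max_left _ _, max_le (by norm_num) (min_le_left _ _)⟩
  have hcid : ∀ t, |t| ≤ 1 → c t = t := fun t ht => by
    rw [abs_le] at ht
    simp [hc, ht.1, ht.2]
  have hrS : ∀ x, r x ∈ Metric.closedBall (0 : ℝ × ℝ) 1 := fun x => (hS _).2 ⟨hcS _, hcS _⟩
  obtain ⟨l, hl, hle⟩ := exists_log_of_continuous (u := u ∘ r)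
    (hu.comp_continuous hrc hrS) fun x => hu0 _ (hrS x)
  refine ⟨l, hl.continuousOn, fun x hx => ?_⟩
  have : r x = x := Prod.ext (hcid _ ((hS x).1 hx).1) (hcid _ ((hS x).1 hx).2)
  rw [hle, Function.comp_apply, this]

end TotallyRealDiscHull

namespace TotallyRealDiscHull

open Set Filter Topology MeasureTheory

section Levels

lemma volume_image_eq_zero_of_hasFDerivWithinAt_zero {X : Set ℂ} {g : ℂ → ℂ}
    (hg : ∀ x ∈ X, DifferentiableAt ℝ g x)
    (hX : ∀ x ∈ X, ∃ α : ℂ →L[ℝ] ℝ, α ≠ 0 ∧ HasFDerivWithinAt (fun _ => (0 : ℝ)) α X x) :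
    volume (g '' X) = 0 := by
  have H : ∀ x : ℂ, ∃ D : ℂ →L[ℝ] ℂ, x ∈ X → D.det = 0 ∧ HasFDerivWithinAt g D X x := by
    intro x
    by_cases hx : x ∈ X
    · obtain ⟨α, hα, hd⟩ := hX x hx
      obtain ⟨v, hv⟩ : ∃ v, α v ≠ 0 := by
        by_contra! h
        exact hα (ContinuousLinearMap.ext h)
      set P : ℂ →L[ℝ] ℂ := ContinuousLinearMap.id ℝ ℂ - α.smulRight ((α v)⁻¹ • v) with hP
      have hPv : P v = 0 := by simp [hP, hv]
      have hid : HasFDerivWithinAt id P X x := by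
        have := (hasFDerivWithinAt_id x X).sub (hd.smul_const ((α v)⁻¹ • v))
        refine this.congr (fun y _ => ?_) ?_ <;> simp
      have hv0 : v ≠ 0 := fun h => hv (by rw [h, map_zero])
      refine ⟨(fderiv ℝ g x).comp P, fun _ => ⟨?_, ?_⟩⟩
      · by_contra hdet
        have h1 : LinearMap.det ((fderiv ℝ g x).comp P : ℂ →ₗ[ℝ] ℂ) ≠ 0 := hdet
        have h3 : Function.Injective ((fderiv ℝ g x).comp P : ℂ →ₗ[ℝ] ℂ) :=
          ((LinearEquiv.ofIsUnitDet (f := ((fderiv ℝ g x).comp P : ℂ →ₗ[ℝ] ℂ))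
            (v := Module.finBasis ℝ ℂ) (v' := Module.finBasis ℝ ℂ)
            (by rw [LinearMap.det_toMatrix]; exact h1.isUnit))).injective
        refine hv0 (h3 ?_)
        simp [hPv]
      · exact (hg x hx).hasFDerivAt.comp_hasFDerivWithinAt x hid
    · exact ⟨0, fun h => absurd h hx⟩
  choose D hD using H
  exact addHaar_image_eq_zero_of_det_fderivWithin_eq_zero volume (fun x hx => (hD x hx).2)
    fun x hx => (hD x hx).1

lemma not_isBounded_of_convex {S X : Set ℂ} (hS : Convex ℝ S) (hne : S.Nonempty) (hXS : X ⊆ S)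
    {b : ℂ} (hb : b ∉ S) : ¬ Bornology.IsBounded (connectedComponentIn Xᶜ b) := by
  obtain ⟨s, hs⟩ := hne
  have hbs : b - s ≠ 0 := sub_ne_zero.2 fun h => hb (h ▸ hs)
  set ρ : ℝ → ℂ := fun t => b + t • (b - s) with hρ
  have hρc : Continuous ρ := by fun_prop
  have hsub : ρ '' Ici 0 ⊆ connectedComponentIn Xᶜ b := by
    refine (isPreconnected_Ici.image _ hρc.continuousOn).subset_connectedComponentIn
      ⟨0, self_mem_Ici, by simp [hρ]⟩ ?_
    rintro _ ⟨t, ht, rfl⟩ h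
    have ht0 : (0 : ℝ) ≤ t := ht
    refine hb ?_
    have h1 := hS (hXS h) hs (a := 1 / (1 + t)) (b := t / (1 + t)) (by positivity) (by positivity)
      (by field_simp)
    convert h1 using 1
    simp only [hρ, Complex.real_smul]
    push_cast
    have : (1 + t : ℂ) ≠ 0 := by
      have : (0 : ℝ) < 1 + t := by positivity
      exact_mod_cast this.ne'
    field_simp
    ring
  intro hB
  obtain ⟨R, hR⟩ := (hB.subset hsub).exists_norm_le
  have hpos : 0 < ‖b - s‖ := norm_pos_iff.2 hbs
  set t : ℝ := (|R| + ‖b‖ + 1) / ‖b - s‖ with ht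
  have ht0 : 0 ≤ t := by positivity
  have h1 := hR _ ⟨t, ht0, rfl⟩
  have h2 : ‖t • (b - s)‖ = |R| + ‖b‖ + 1 := by
    rw [norm_smul, Real.norm_of_nonneg ht0, ht]
    field_simp
  have h3 : ‖t • (b - s)‖ ≤ ‖ρ t‖ + ‖b‖ := by
    have : t • (b - s) = ρ t - b := by simp [hρ]
    rw [this]
    exact norm_sub_le _ _
  linarith [le_abs_self R]

lemma not_isBounded_of_level {S X : Set ℂ} (hSc : IsCompact S) (hS : Convex ℝ S)
    (hX : IsClosed X) (hXS : X ⊆ S) {F : ℂ → ℝ} {α : ℂ → ℂ →L[ℝ] ℝ}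
    (hF : ∀ x ∈ S, HasFDerivWithinAt F (α x) S x) (hα : ∀ x ∈ S, α x ≠ 0) {s : ℝ}
    (hs : ∀ x ∈ X, F x = s) {a : ℂ} (ha : a ∉ X) :
    ¬ Bornology.IsBounded (connectedComponentIn Xᶜ a) := by
  intro hb
  set W := connectedComponentIn Xᶜ a with hW
  have haW : a ∈ W := mem_connectedComponentIn ha
  rcases S.eq_empty_or_nonempty with hSe | hSne
  · have : X = ∅ := subset_empty_iff.1 (hSe ▸ hXS)
    rw [hW, this, compl_empty, connectedComponentIn_univ,
      PreconnectedSpace.connectedComponent_eq_univ] at hb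
    exact (NormedSpace.noncompactSpace ℝ ℂ).noncompact_univ
      (Metric.isCompact_of_isClosed_isBounded isClosed_univ hb)
  have hWS : W ⊆ S := by
    intro b hbW
    by_contra hbS
    refine not_isBounded_of_convex hS hSne hXS hbS ?_
    rwa [← connectedComponentIn_eq hbW]
  have hWo : IsOpen W := hX.isOpen_compl.connectedComponentIn
  have hcl : closure W ⊆ S := closure_minimal hWS hSc.isClosed
  have hclc : IsCompact (closure W) := hSc.of_isClosed_subset isClosed_closure hcl
  have hFc : ContinuousOn F (closure W) := fun x hx =>
    ((hF x (hcl hx)).continuousWithinAt).mono hcl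
  have hFW : ∀ x ∈ W, HasFDerivAt F (α x) x := fun x hx =>
    (hF x (hWS hx)).hasFDerivAt (mem_of_superset (hWo.mem_nhds hx) hWS)
  have hnW : ∀ x ∈ closure W, x ∉ W → F x = s := fun x hx hxW =>
    hs x (frontier_connectedComponentIn_subset hX a ⟨hx, fun h => hxW (interior_subset h)⟩)
  obtain ⟨x₁, hx₁, hm₁⟩ := hclc.exists_isMaxOn ⟨a, subset_closure haW⟩ hFc
  obtain ⟨x₂, hx₂, hm₂⟩ := hclc.exists_isMinOn ⟨a, subset_closure haW⟩ hFc
  have hloc : ∀ x ∈ W, closure W ∈ 𝓝 x := fun x hx =>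
    mem_of_superset (hWo.mem_nhds hx) subset_closure
  have h1 : x₁ ∉ W := fun h =>
    hα x₁ (hWS h) ((hm₁.isLocalMax (hloc _ h)).hasFDerivAt_eq_zero (hFW x₁ h))
  have h2 : x₂ ∉ W := fun h =>
    hα x₂ (hWS h) ((hm₂.isLocalMin (hloc _ h)).hasFDerivAt_eq_zero (hFW x₂ h))
  have h3 : ∀ x ∈ closure W, F x = s := fun x hx =>
    le_antisymm ((hm₁ hx).trans_eq (hnW _ hx₁ h1)) ((hnW _ hx₂ h2).symm.trans_le (hm₂ hx))
  refine hα a (hWS haW) ?_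
  have h4 : IsLocalMax F a := by
    filter_upwards [hloc a haW] with x hx
    rw [h3 x hx, h3 a (subset_closure haW)]
  exact h4.hasFDerivAt_eq_zero (hFW a haW)

lemma hasLogOn_of_level {S X : Set ℂ} (hSc : IsCompact S) (hS : Convex ℝ S)
    (hX : IsClosed X) (hXS : X ⊆ S) {F : ℂ → ℝ} {α : ℂ → ℂ →L[ℝ] ℝ}
    (hF : ∀ x ∈ S, HasFDerivWithinAt F (α x) S x) (hα : ∀ x ∈ S, α x ≠ 0) {s : ℝ}
    (hs : ∀ x ∈ X, F x = s) {u : ℂ → ℂ} (hu : ContinuousOn u X) (hu0 : ∀ x ∈ X, u x ≠ 0) :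
    HasLogOn u X := by
  have hXc : IsCompact X := hSc.of_isClosed_subset hX hXS
  have hc : ∀ a ∉ X, ¬ Bornology.IsBounded (connectedComponentIn Xᶜ a) := fun a ha =>
    not_isBounded_of_level hSc hS hX hXS hF hα hs ha
  have hX0 : volume X = 0 := by
    rw [← image_id X]
    refine volume_image_eq_zero_of_hasFDerivWithinAt_zero (fun x _ => differentiableAt_id)
      fun x hx => ⟨α x, hα x (hXS hx), ?_⟩
    refine (((hF x (hXS hx)).mono hXS).sub_const s).congr (fun y hy => ?_) ?_
    · exact (sub_eq_zero.2 (hs y hy)).symm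
    · exact (sub_eq_zero.2 (hs x hx)).symm
  exact hasLogOn_of_dense hXc hc
    (fun v hv ε hε => exists_polynomial_approx hXc hX0 hc hv hε) hu hu0

/-- Logarithms on pieces of level sets glue when the level function is locally constant. -/
lemma hasLogOn_of_locally_level {S X : Set ℂ} (hSc : IsCompact S) (hS : Convex ℝ S)
    (hX : IsClosed X) (hXS : X ⊆ S) {F : ℂ → ℝ} {α : ℂ → ℂ →L[ℝ] ℝ}
    (hF : ∀ x ∈ S, HasFDerivWithinAt F (α x) S x) (hα : ∀ x ∈ S, α x ≠ 0)
    (hs : ∀ x ∈ X, ∀ᶠ y in 𝓝[X] x, F y = F x) {u : ℂ → ℂ} (hu : ContinuousOn u X)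
    (hu0 : ∀ x ∈ X, u x ≠ 0) : HasLogOn u X := by
  have hFX : ContinuousOn F X := fun x hx => ((hF x (hXS hx)).continuousWithinAt).mono hXS
  have H : ∀ s : ℝ, HasLogOn u (X ∩ F ⁻¹' {s}) := fun s =>
    hasLogOn_of_level hSc hS (hFX.preimage_isClosed_of_isClosed hX isClosed_singleton)
      (inter_subset_left.trans hXS) hF hα (s := s) (fun x hx => hx.2)
      (hu.mono inter_subset_left) fun x hx => hu0 x hx.1
  choose l hl hle using H
  refine ⟨fun x => l (F x) x, fun x hx => ?_, fun x hx => hle _ x ⟨hx, rfl⟩⟩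
  have h1 : ContinuousWithinAt (l (F x)) X x := by
    refine (hl (F x) x ⟨hx, rfl⟩).mono_of_mem_nhdsWithin ?_
    filter_upwards [hs x hx, self_mem_nhdsWithin] with y hy hyX using ⟨hyX, hy⟩
  refine h1.congr_of_eventuallyEq ?_ rfl
  filter_upwards [hs x hx] with y hy
  rw [hy]

end Levels

end TotallyRealDiscHull

namespace TotallyRealDiscHull

open Set Filter Topology MeasureTheory

section Curve

/-- The tangent vector field of the level sets of `h`, obtained by rotating the gradient. -/
def tangentField (h : ℂ → ℝ) (z : ℂ) : ℂ := ⟨-fderiv ℝ h z Complex.I, fderiv ℝ h z 1⟩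

lemma apply_eq_re_im (L : ℂ →L[ℝ] ℝ) (w : ℂ) : L w = w.re * L 1 + w.im * L Complex.I := by
  conv_lhs => rw [← Complex.re_add_im w]
  rw [map_add, ← Complex.real_smul, ← mul_one (w.re : ℂ), ← Complex.real_smul, map_smul, map_smul]
  rfl

lemma normSq_tangentField_pos {h : ℂ → ℝ} {z : ℂ} (hz : fderiv ℝ h z ≠ 0) :
    0 < fderiv ℝ h z 1 ^ 2 + fderiv ℝ h z Complex.I ^ 2 := by
  by_contra! hle
  have h1 : fderiv ℝ h z 1 = 0 := by nlinarith [sq_nonneg (fderiv ℝ h z Complex.I)]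
  have h2 : fderiv ℝ h z Complex.I = 0 := by nlinarith [sq_nonneg (fderiv ℝ h z 1)]
  exact hz (ContinuousLinearMap.ext fun w => by rw [apply_eq_re_im, h1, h2]; simp)

lemma tangentField_ne_zero {h : ℂ → ℝ} {z : ℂ} (hz : fderiv ℝ h z ≠ 0) : tangentField h z ≠ 0 := by
  intro h0
  have h1 := congrArg Complex.re h0
  have h2 := congrArg Complex.im h0
  have := normSq_tangentField_pos hz
  simp only [tangentField, Complex.zero_re, Complex.zero_im, neg_eq_zero] at h1 h2
  simp [h1, h2] at this

lemma contDiff_tangentField {h : ℂ → ℝ} (hsm : ContDiff ℝ 2 h) : ContDiff ℝ 1 (tangentField h) := by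
  have h1 : ContDiff ℝ 1 (fderiv ℝ h) := hsm.fderiv_right (by norm_num)
  have h2 : tangentField h = fun z => Complex.equivRealProdCLM.symm
      (-fderiv ℝ h z Complex.I, fderiv ℝ h z 1) := by
    ext z
    rfl
  rw [h2]
  exact Complex.equivRealProdCLM.symm.contDiff.comp
    ((h1.clm_apply contDiff_const).neg.prodMk (h1.clm_apply contDiff_const))

lemma exists_eq_smul_tangentField {h : ℂ → ℝ} {z w : ℂ} (hz : fderiv ℝ h z ≠ 0)
    (hw : fderiv ℝ h z w = 0) : ∃ r : ℝ, w = r • tangentField h z := by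
  have hpos := normSq_tangentField_pos hz
  rw [apply_eq_re_im] at hw
  set p := fderiv ℝ h z 1
  set q := fderiv ℝ h z Complex.I with hq
  refine ⟨(-q * w.re + p * w.im) / (p ^ 2 + q ^ 2), ?_⟩
  apply Complex.ext
  · simp only [tangentField, Complex.real_smul, Complex.re_ofReal_mul, ← hq]
    rw [div_mul_eq_mul_div, eq_div_iff hpos.ne']
    linear_combination p * hw
  · simp only [tangentField, Complex.real_smul, Complex.im_ofReal_mul]
    rw [div_mul_eq_mul_div, eq_div_iff hpos.ne']
    linear_combination q * hw

lemma fderiv_comp_eq_zero {S : Set ℂ} (hS : Convex ℝ S) (hSi : (interior S).Nonempty)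
    {f : ℂ → ℂ} {h : ℂ → ℝ} (hh : ∀ x ∈ S, h (f x) = 0) {x : ℂ} (hx : x ∈ S)
    (hf : DifferentiableAt ℝ f x) (hd : DifferentiableAt ℝ h (f x)) (v : ℂ) :
    fderiv ℝ h (f x) (fderiv ℝ f x v) = 0 := by
  have h1 : HasFDerivWithinAt (h ∘ f) ((fderiv ℝ h (f x)).comp (fderiv ℝ f x)) S x :=
    (hd.hasFDerivAt.comp x hf.hasFDerivAt).hasFDerivWithinAt
  have h2 : HasFDerivWithinAt (h ∘ f) (0 : ℂ →L[ℝ] ℝ) S x :=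
    (hasFDerivWithinAt_const 0 x S).congr hh (hh x hx)
  have h3 := (uniqueDiffWithinAt_convex hS hSi (subset_closure hx)).eq h1 h2
  exact DFunLike.congr_fun h3 v

/-- A map into an integral curve of `t`, defined on a convex set, has a primitive `F` with
`df = dF • t`. -/
lemma exists_primitive {S U : Set ℂ} (hS : Convex ℝ S) (hU : IsOpen U) (hSU : S ⊆ U)
    {f t : ℂ → ℂ} (hf : ContDiffOn ℝ 2 f U) (ht : ContDiff ℝ 1 t) (ht0 : ∀ x ∈ S, t (f x) ≠ 0)
    (hft : ∀ x ∈ S, ∀ v, ∃ r : ℝ, fderiv ℝ f x v = r • t (f x)) :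
    ∃ (F : ℂ → ℝ) (α : ℂ → ℂ →L[ℝ] ℝ), ContinuousOn α S ∧ ∀ x ∈ S, HasFDerivWithinAt F (α x) S x ∧
      ∀ v, fderiv ℝ f x v = α x v • t (f x) := by
  have hfx : ∀ x ∈ S, ContDiffAt ℝ 2 f x := fun x hx => hf.contDiffAt (hU.mem_nhds (hSU hx))
  set ω : ℂ → ℂ →L[ℝ] ℂ := fun x => (t (f x))⁻¹ • fderiv ℝ f x with hω
  set τ : ℂ → ℂ →L[ℝ] ℂ := fun x => (fderiv ℝ t (f x)).comp (fderiv ℝ f x) with hτ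
  set dω : ℂ → ℂ →L[ℝ] ℂ →L[ℝ] ℂ := fun x => (t (f x))⁻¹ • fderiv ℝ (fderiv ℝ f) x +
    (-((t (f x) ^ 2)⁻¹ • τ x)).smulRight (fderiv ℝ f x) with hdω
  have hd : ∀ x ∈ S, HasFDerivWithinAt ω (dω x) S x := by
    intro x hx
    have h1 : HasFDerivAt (fderiv ℝ f) (fderiv ℝ (fderiv ℝ f) x) x :=
      (((hfx x hx).fderiv_right (m := 1) (by norm_num)).differentiableAt (by norm_num)).hasFDerivAt
    have h2 : HasFDerivAt (fun x => t (f x)) (τ x) x :=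
      ((ht.differentiable (by norm_num)) _).hasFDerivAt.comp x
        ((hfx x hx).differentiableAt (by norm_num)).hasFDerivAt
    have h3 := ((((hasDerivAt_inv (ht0 x hx)).hasFDerivAt.restrictScalars ℝ).comp x h2).smul h1)
    refine (h3.congr_fderiv ?_).hasFDerivWithinAt
    refine ContinuousLinearMap.ext fun u => ContinuousLinearMap.ext fun v => ?_
    simp [hdω, mul_comm]
  have hsymm : ∀ x ∈ S, ∀ u v, dω x u v = dω x v u := by
    intro x hx u v
    have h1 := ((hfx x hx).isSymmSndFDerivAt (by simp)).eq u v
    obtain ⟨a, ha⟩ := hft x hx u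
    obtain ⟨b, hb⟩ := hft x hx v
    have h2 : τ x u = a • fderiv ℝ t (f x) (t (f x)) := by
      simp only [hτ, ContinuousLinearMap.comp_apply, ha, map_smul]
    have h3 : τ x v = b • fderiv ℝ t (f x) (t (f x)) := by
      simp only [hτ, ContinuousLinearMap.comp_apply, hb, map_smul]
    simp only [hdω, add_apply, smul_apply, ContinuousLinearMap.smulRight_apply, neg_apply,
      h1, h2, h3, ha, hb, smul_eq_mul, Complex.real_smul]
    ring
  obtain ⟨F, hF⟩ := hS.exists_forall_hasFDerivWithinAt_of_hasFDerivWithinAt_symmetric hd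
    fun x hx u _ v _ => hsymm x hx u v
  refine ⟨fun x => (F x).re, fun x => Complex.reCLM.comp (ω x), ?_, fun x hx =>
    ⟨Complex.reCLM.hasFDerivAt.comp_hasFDerivWithinAt x (hF x hx), fun v => ?_⟩⟩
  · exact continuousOn_const.clm_comp fun x hx => (hd x hx).continuousWithinAt
  obtain ⟨r, hr⟩ := hft x hx v
  have h1 : ω x v = r := by
    simp only [hω, smul_apply, hr, smul_eq_mul, Complex.real_smul]
    field_simp [ht0 x hx]
  rw [ContinuousLinearMap.comp_apply, h1, hr]
  simp

lemma eventually_eq_of_fiber {S : Set ℂ} (hS : Convex ℝ S) {f t : ℂ → ℂ}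
    (ht : ContDiff ℝ 1 t) (hf : ∀ x ∈ S, DifferentiableAt ℝ f x) {F : ℂ → ℝ}
    {α : ℂ → ℂ →L[ℝ] ℝ} (hα : ContinuousOn α S) (hF : ∀ x ∈ S, HasFDerivWithinAt F (α x) S x)
    (hfα : ∀ x ∈ S, ∀ v, fderiv ℝ f x v = α x v • t (f x)) {x : ℂ} (hx : x ∈ S)
    (ht0 : t (f x) ≠ 0) : ∀ᶠ y in 𝓝[S] x, f y = f x → F y = F x := by
  obtain ⟨γ, hγ0, ε, hε, hγ⟩ :=
    (ht.contDiffAt (x := f x)).exists_forall_mem_closedBall_exists_eq_forall_mem_Ioo_hasDerivAt₀ 0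
  rw [zero_sub, zero_add] at hγ
  obtain ⟨K, N, hN, hK⟩ := (ht.contDiffAt (x := f x)).exists_lipschitzOnWith
  have hFc : ContinuousWithinAt F S x := (hF x hx).continuousWithinAt
  have hγd : HasDerivAt γ (t (f x)) 0 := by
    have := hγ 0 ⟨by linarith, hε⟩
    rwa [hγ0] at this
  have hFt : Tendsto (fun y => F y - F x) (𝓝[S] x) (𝓝 0) := by
    have := hFc.tendsto.sub_const (F x)
    rwa [sub_self] at this
  have e1 : ∀ᶠ y in 𝓝[S] x, f y ∈ N := (hf x hx).continuousAt.continuousWithinAt hN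
  have e2 : ∀ᶠ y in 𝓝[S] x, F y - F x ∈ Ioo (-ε) ε :=
    hFt (Ioo_mem_nhds (by linarith) hε)
  have e3 : ∀ᶠ y in 𝓝[S] x, γ (F y - F x) ∈ N := by
    have : Tendsto γ (𝓝 0) (𝓝 (f x)) := by
      have := hγd.continuousAt.tendsto
      rwa [hγ0] at this
    exact (this.comp hFt) hN
  have e4 : ∀ᶠ y in 𝓝[S] x, γ (F y - F x) = f x → F y = F x := by
    have h1 := hγd.eventually_ne (c := f x) ht0
    rw [eventually_nhdsWithin_iff] at h1
    filter_upwards [hFt.eventually h1] with y hy h2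
    by_contra h3
    exact hy (sub_ne_zero.2 h3) h2
  obtain ⟨δ, hδ, hball⟩ := Metric.mem_nhdsWithin_iff.1 (e1.and (e2.and e3))
  filter_upwards [e4, inter_mem_nhdsWithin S (Metric.ball_mem_nhds x hδ)] with y hy ⟨hyS, hyδ⟩ hyf
  refine hy ?_
  have hconv : Convex ℝ (Metric.ball x δ ∩ S) := (convex_ball x δ).inter hS
  have hxB : x ∈ Metric.ball x δ ∩ S := ⟨Metric.mem_ball_self hδ, hx⟩
  set ρ : ℝ → ℂ := fun s => x + s • (y - x) with hρ
  have hρB : ∀ s ∈ Icc (0 : ℝ) 1, ρ s ∈ Metric.ball x δ ∩ S := fun s hs =>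
    hconv.add_smul_sub_mem hxB ⟨hyδ, hyS⟩ hs
  have hρd : ∀ s, HasDerivAt ρ (y - x) s := fun s => by
    simpa only [one_smul, id_eq] using ((hasDerivAt_id s).smul_const (y - x)).const_add x
  have hFρ : ∀ s ∈ Icc (0 : ℝ) 1,
      HasDerivWithinAt (fun s => F (ρ s) - F x) (α (ρ s) (y - x)) (Icc 0 1) s := fun s hs =>
    ((hF _ (hρB s hs).2).comp_hasDerivWithinAt s (hρd s).hasDerivWithinAt
      fun r hr => (hρB r hr).2).sub_const _
  have hq : ∀ s ∈ Icc (0 : ℝ) 1,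
      HasDerivWithinAt (fun s => f (ρ s)) (α (ρ s) (y - x) • t (f (ρ s))) (Icc 0 1) s := by
    intro s hs
    rw [← hfα _ (hρB s hs).2]
    exact (hf _ (hρB s hs).2).hasFDerivAt.comp_hasDerivWithinAt s (hρd s).hasDerivWithinAt
  have hr : ∀ s ∈ Icc (0 : ℝ) 1, HasDerivWithinAt (fun s => γ (F (ρ s) - F x))
      (α (ρ s) (y - x) • t (γ (F (ρ s) - F x))) (Icc 0 1) s := fun s hs =>
    (hγ _ (hball (hρB s hs)).2.1).scomp_hasDerivWithinAt s (hFρ s hs)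
  have hρc : Continuous ρ := by fun_prop
  obtain ⟨C, hC⟩ := isCompact_Icc.exists_bound_of_continuousOn
    ((hα.comp hρc.continuousOn fun s hs => (hρB s hs).2).clm_apply continuousOn_const :
      ContinuousOn (fun s => α (ρ s) (y - x)) (Icc (0 : ℝ) 1))
  have hIci : ∀ s ∈ Ico (0 : ℝ) 1, Icc (0 : ℝ) 1 ∈ 𝓝[Ici s] s := fun s hs =>
    mem_of_superset (Icc_mem_nhdsGE hs.2) (Icc_subset_Icc_left hs.1)
  have huniq := ODE_solution_unique_of_mem_Icc_right (a := 0) (b := 1) (K := C.toNNReal * K)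
    (v := fun s p => α (ρ s) (y - x) • t p) (s := fun _ => N) (fun s hs => ?_)
    (fun s hs => (hq s hs).continuousWithinAt)
    (fun s hs => (hq s (Ico_subset_Icc_self hs)).mono_of_mem_nhdsWithin (hIci s hs))
    (fun s hs => (hball (hρB s (Ico_subset_Icc_self hs))).1)
    (fun s hs => (hr s hs).continuousWithinAt)
    (fun s hs => (hr s (Ico_subset_Icc_self hs)).mono_of_mem_nhdsWithin (hIci s hs))
    (fun s hs => (hball (hρB s (Ico_subset_Icc_self hs))).2.2) (by simp [hρ, hγ0])
  · have h1 := huniq (right_mem_Icc.2 zero_le_one)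
    simp only [hρ, one_smul, add_sub_cancel] at h1
    rw [← h1, hyf]
  · refine LipschitzOnWith.of_dist_le_mul fun p hp q hq => ?_
    have h1 := hK.dist_le_mul p hp q hq
    have h2 := hC s (Ico_subset_Icc_self hs)
    have h3 := h2.trans (Real.le_coe_toNNReal C)
    rw [dist_smul₀, NNReal.coe_mul, mul_assoc]
    exact mul_le_mul h3 h1 dist_nonneg (NNReal.coe_nonneg _)

/-- Polynomials are dense on the fibres of a totally real map over a smooth plane curve. -/
theorem polyDense_fiber {S U : Set ℂ} (hSc : IsCompact S) (hS : Convex ℝ S)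
    (hSi : (interior S).Nonempty) (hU : IsOpen U) (hSU : S ⊆ U) {f g : ℂ → ℂ}
    (hf : ContDiffOn ℝ 2 f U) (hg : ContDiffOn ℝ 2 g U)
    (hinj : ∀ x ∈ S, ∀ y ∈ S, f x = f y → g x = g y → x = y) {h : ℂ → ℝ} (hsm : ContDiff ℝ 2 h)
    (hh : ∀ x ∈ S, h (f x) = 0) (hdh : ∀ x ∈ S, fderiv ℝ h (f x) ≠ 0)
    (hdf : ∀ x ∈ S, fderiv ℝ f x ≠ 0) (c : ℂ) : PolyDense (g '' (S ∩ f ⁻¹' {c})) := by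
  have hfd : ∀ x ∈ S, DifferentiableAt ℝ f x := fun x hx =>
    (hf.contDiffAt (hU.mem_nhds (hSU hx))).differentiableAt (by norm_num)
  have hgd : ∀ x ∈ S, DifferentiableAt ℝ g x := fun x hx =>
    (hg.contDiffAt (hU.mem_nhds (hSU hx))).differentiableAt (by norm_num)
  have hhd : Differentiable ℝ h := hsm.differentiable (by norm_num)
  have htan : ∀ x ∈ S, ∀ v, ∃ r : ℝ, fderiv ℝ f x v = r • tangentField h (f x) := fun x hx v =>
    exists_eq_smul_tangentField (hdh x hx)
      (fderiv_comp_eq_zero hS hSi hh hx (hfd x hx) (hhd _) v)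
  have ht := contDiff_tangentField hsm
  obtain ⟨F, α, hαc, hF⟩ := exists_primitive hS hU hSU hf ht
    (fun x hx => tangentField_ne_zero (hdh x hx)) htan
  have hα : ∀ x ∈ S, α x ≠ 0 := fun x hx h0 => hdf x hx <| ContinuousLinearMap.ext fun v => by
    rw [(hF x hx).2 v, h0]
    simp
  set X := S ∩ f ⁻¹' {c} with hX
  have hXS : X ⊆ S := inter_subset_left
  have hXcl : IsClosed X := ContinuousOn.preimage_isClosed_of_isClosed
    (fun x hx => (hfd x hx).continuousAt.continuousWithinAt) hSc.isClosed isClosed_singleton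
  have hXc : IsCompact X := hSc.of_isClosed_subset hXcl hXS
  have hgX : ContinuousOn g X := fun x hx => (hgd x (hXS hx)).continuousAt.continuousWithinAt
  have hloc : ∀ x ∈ X, ∀ᶠ y in 𝓝[X] x, F y = F x := by
    intro x hx
    have := eventually_eq_of_fiber hS ht hfd hαc (fun x hx => (hF x hx).1)
      (fun x hx => (hF x hx).2) hx.1 (tangentField_ne_zero (hdh x hx.1))
    filter_upwards [nhdsWithin_mono x hXS this, self_mem_nhdsWithin] with y hy hyX
    exact hy (hyX.2.trans hx.2.symm)
  have hlog : ∀ τ₀ ∉ g '' X, HasLogOn (fun τ => τ - τ₀) (g '' X) := by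
    intro τ₀ hτ₀
    have h1 : HasLogOn (fun x => g x - τ₀) X :=
      hasLogOn_of_locally_level hSc hS hXcl hXS (fun x hx => (hF x hx).1) hα hloc
        (hgX.sub continuousOn_const) fun x hx h0 => hτ₀ ⟨x, hx, sub_eq_zero.1 h0⟩
    have hinjX : InjOn g X := fun x hx y hy hxy =>
      hinj x hx.1 y hy.1 (hx.2.trans hy.2.symm) hxy
    have h2 : ContinuousOn (Function.invFunOn g X) (g '' X) := by
      refine continuousOn_iff_isClosed.2 fun C hC => ⟨g '' (X ∩ C),
        ((hXc.inter_right hC).image_of_continuousOn (hgX.mono inter_subset_left)).isClosed, ?_⟩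
      ext τ
      constructor
      · rintro ⟨h3, x, hx, rfl⟩
        rw [mem_preimage, hinjX.leftInvOn_invFunOn hx] at h3
        exact ⟨⟨x, ⟨hx, h3⟩, rfl⟩, x, hx, rfl⟩
      · rintro ⟨⟨x, ⟨hx, hxC⟩, rfl⟩, h3⟩
        refine ⟨?_, h3⟩
        rwa [mem_preimage, hinjX.leftInvOn_invFunOn hx]
    refine (h1.comp h2 ?_).congr ?_
    · rintro _ ⟨x, hx, rfl⟩
      exact Function.invFunOn_mem ⟨x, hx, rfl⟩
    · rintro _ ⟨x, hx, rfl⟩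
      have := Function.invFunOn_eq (f := g) (s := X) ⟨x, hx, rfl⟩
      simp [this]
  have hKc : IsCompact (g '' X) := hXc.image_of_continuousOn hgX
  have hcomp : ∀ τ₀ ∉ g '' X, ¬ Bornology.IsBounded (connectedComponentIn (g '' X)ᶜ τ₀) :=
    fun τ₀ hτ₀ => not_isBounded_of_hasLogOn hKc hτ₀ (hlog τ₀ hτ₀)
  have hnull : volume (g '' X) = 0 := by
    refine volume_image_eq_zero_of_hasFDerivWithinAt_zero (fun x hx => hgd x (hXS hx))
      fun x hx => ?_
    refine ⟨α x, hα x (hXS hx), ?_⟩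
    have h1 : HasFDerivWithinAt (fun y => F y - F x) (α x) X x :=
      ((hF x (hXS hx)).1.mono hXS).sub_const _
    refine h1.congr_of_eventuallyEq ?_ (sub_self _).symm
    filter_upwards [hloc x hx] with y hy
    rw [hy, sub_self]
  exact fun u hu ε hε => exists_polynomial_approx hKc hnull hcomp hu hε

end Curve

end TotallyRealDiscHull

namespace TotallyRealDiscHull

open Set Filter Topology Metric

section PeakDiscs

lemma exists_quadratic_bound {h : ℂ → ℝ} (hsm : ContDiff ℝ 2 h) (c : ℂ) :
    ∃ M δ : ℝ, 0 < M ∧ 0 < δ ∧ ∀ z ∈ ball c δ,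
      |h z - h c - fderiv ℝ h c (z - c)| ≤ M * ‖z - c‖ ^ 2 := by
  obtain ⟨K, N, hN, hK⟩ :=
    ((hsm.fderiv_right (m := 1) (by norm_num)).contDiffAt (x := c)).exists_lipschitzOnWith
  obtain ⟨δ, hδ, hδN⟩ := Metric.mem_nhds_iff.1 hN
  refine ⟨K + 1, δ, by positivity, hδ, fun z hz => ?_⟩
  have hsub : closedBall c ‖z - c‖ ⊆ N := fun y hy => hδN <| by
    rw [mem_closedBall, dist_eq_norm] at hy
    rw [mem_ball, dist_eq_norm] at hz ⊢
    exact hy.trans_lt hz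
  have h1 := (convex_closedBall c ‖z - c‖).norm_image_sub_le_of_norm_fderiv_le' (𝕜 := ℝ)
    (f := h) (φ := fderiv ℝ h c) (C := K * ‖z - c‖) (x := c) (y := z)
    (fun y _ => hsm.differentiable (by norm_num) y) (fun y hy => ?_)
    (mem_closedBall_self (norm_nonneg _)) (by rw [mem_closedBall, dist_eq_norm])
  · rw [Real.norm_eq_abs] at h1
    nlinarith [sq_nonneg ‖z - c‖]
  · have h2 := hK.dist_le_mul y (hsub hy) c (hδN (mem_ball_self hδ))
    rw [dist_eq_norm, dist_eq_norm] at h2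
    rw [mem_closedBall, dist_eq_norm] at hy
    exact h2.trans (mul_le_mul_of_nonneg_left hy K.2)

/-- The positive side of a regular level curve: it is locally connected to one point, accumulates
at the curve, and contains a disc touching the curve at `c` only. -/
lemma exists_positive_side {h : ℂ → ℝ} (hsm : ContDiff ℝ 2 h) {c : ℂ} (hc : h c = 0)
    (hd : fderiv ℝ h c ≠ 0) : ∃ (δ : ℝ) (q : ℂ), 0 < δ ∧
      (∀ z ∈ ball c δ, 0 < h z →
        ∃ P : Set ℂ, IsPreconnected P ∧ P ⊆ {w | 0 < h w} ∧ z ∈ P ∧ q ∈ P) ∧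
      (∀ e ∈ ball c δ, h e = 0 → e ∈ closure {w | 0 < h w}) ∧
      ∃ (a : ℂ) (r : ℝ), 0 < r ∧ r < δ ∧ ‖c - a‖ = r ∧ ∀ z, ‖z - a‖ ≤ r → z ≠ c → 0 < h z := by
  set D := fderiv ℝ h c with hD
  set G : ℂ := ⟨D 1, D Complex.I⟩ with hG
  have hDG : ∀ v, D v = v.re * G.re + v.im * G.im := fun v => apply_eq_re_im D v
  set d := ‖G‖ with hdd
  have hdsq : d ^ 2 = G.re ^ 2 + G.im ^ 2 := by
    rw [hdd, ← Complex.normSq_eq_norm_sq, Complex.normSq_apply]; ring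
  have hd0 : 0 < d := by
    have h1 := normSq_tangentField_pos hd
    have h2 : 0 < d ^ 2 := by rw [hdsq]; exact h1
    refine (norm_nonneg G).lt_of_ne' fun h0 => ?_
    rw [hdd, h0] at h2
    norm_num at h2
  set n : ℂ := (d⁻¹ : ℝ) • G with hn
  have hnn : ‖n‖ = 1 := by
    rw [hn, norm_smul, Real.norm_of_nonneg (by positivity), ← hdd, inv_mul_cancel₀ hd0.ne']
  have hDn : D n = d := by
    have : D G = d ^ 2 := by rw [hDG, hdsq]; ring
    rw [hn, map_smul, this, smul_eq_mul]
    field_simp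
  have hDle : ∀ v, |D v| ≤ d * ‖v‖ := fun v => by
    refine abs_le_of_sq_le_sq ?_ (by positivity)
    rw [mul_pow, hdsq, ← Complex.normSq_eq_norm_sq, Complex.normSq_apply, hDG]
    nlinarith [sq_nonneg (v.re * G.im - v.im * G.re)]
  have hstrict : HasStrictFDerivAt h D c :=
    (hsm.contDiffAt).hasStrictFDerivAt (by norm_num)
  obtain ⟨ρ, hρ, hρb⟩ : ∃ ρ > 0, ∀ z ∈ ball c ρ, ∀ w ∈ ball c ρ,
      |h z - h w - D (z - w)| ≤ d / 4 * ‖z - w‖ := by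
    have h1 := hstrict.isLittleO.def (show 0 < d / 4 by positivity)
    rw [nhds_prod_eq, Metric.nhds_basis_ball.prod_self.eventually_iff] at h1
    obtain ⟨ρ, hρ, h2⟩ := h1
    exact ⟨ρ, hρ, fun z hz w hw => h2 (Set.mk_mem_prod hz hw)⟩
  have hup : ∀ z ∈ ball c ρ, ∀ s : ℝ, 0 ≤ s → z + s • n ∈ ball c ρ →
      h z + d / 2 * s ≤ h (z + s • n) := by
    intro z hz s hs hzs
    have h1 := hρb _ hzs _ hz
    rw [add_sub_cancel_left, map_smul, hDn, norm_smul, hnn, Real.norm_of_nonneg hs,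
      smul_eq_mul] at h1
    have := (abs_le.1 h1).1
    nlinarith
  have hmem : ∀ z ∈ ball c (ρ / 4), ∀ s ∈ Icc (0 : ℝ) (ρ / 2), z + s • n ∈ ball c ρ := by
    intro z hz s hs
    rw [mem_ball, dist_eq_norm] at hz ⊢
    calc ‖z + s • n - c‖ = ‖(z - c) + s • n‖ := by congr 1; ring
      _ ≤ ‖z - c‖ + ‖s • n‖ := norm_add_le _ _
      _ = ‖z - c‖ + s := by rw [norm_smul, hnn, Real.norm_of_nonneg hs.1, mul_one]
      _ < ρ := by linarith [hs.2]
  have hsmall : ball c (ρ / 4) ⊆ ball c ρ := ball_subset_ball (by linarith)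
  refine ⟨ρ / 4, c + (ρ / 2) • n, by positivity, fun z hz hzp => ?_, fun e he hec => ?_, ?_⟩
  · refine ⟨(fun s : ℝ => z + s • n) '' Icc 0 (ρ / 2) ∪ ball (c + (ρ / 2) • n) (ρ / 4), ?_, ?_, ?_,
      ?_⟩
    · refine IsPreconnected.union (z + (ρ / 2) • n) ⟨ρ / 2, ⟨by positivity, le_rfl⟩, rfl⟩ ?_
        (isPreconnected_Icc.image _ (by fun_prop)) (convex_ball _ _).isPreconnected
      rw [mem_ball, dist_eq_norm] at hz ⊢
      rwa [add_sub_add_right_eq_sub]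
    · rintro w (⟨s, hs, rfl⟩ | hw)
      · have h1 := hup z (hsmall hz) s hs.1 (hmem z hz s hs)
        have h2 : 0 ≤ d / 2 * s := mul_nonneg (by positivity) hs.1
        exact lt_of_lt_of_le (by linarith) h1
      · rw [mem_ball, dist_eq_norm] at hw
        set v := w - (c + (ρ / 2) • n) with hv
        have hwc : w - c = (ρ / 2) • n + v := by rw [hv]; ring
        have hwn : ‖w - c‖ < 3 / 4 * ρ := by
          rw [hwc]
          refine (norm_add_le _ _).trans_lt ?_
          rw [norm_smul, hnn, Real.norm_of_nonneg (by positivity)]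
          linarith
        have h1 := hρb w (by rw [mem_ball, dist_eq_norm]; linarith) c (mem_ball_self hρ)
        have h2 : D (w - c) = ρ / 2 * d + D v := by
          rw [hwc, map_add, map_smul, hDn, smul_eq_mul]
        have h3 := (abs_le.1 (hDle v)).1
        have h4 := (abs_le.1 h1).1
        rw [hc, h2] at h4
        change 0 < h w
        nlinarith
    · exact Or.inl ⟨0, ⟨le_rfl, by positivity⟩, by simp⟩
    · exact Or.inr (mem_ball_self (by positivity))
  · have hlim : Tendsto (fun s : ℝ => e + s • n) (𝓝[>] 0) (𝓝 e) := by
      have : Tendsto (fun s : ℝ => e + s • n) (𝓝 0) (𝓝 (e + (0 : ℝ) • n)) :=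
        Continuous.tendsto (by fun_prop) 0
      rw [zero_smul, add_zero] at this
      exact this.mono_left nhdsWithin_le_nhds
    refine mem_closure_of_tendsto hlim ?_
    filter_upwards [Ioc_mem_nhdsGT (show (0 : ℝ) < ρ / 2 by positivity)] with s hs
    have h1 := hup e (hsmall he) s hs.1.le (hmem e he s ⟨hs.1.le, hs.2⟩)
    have h2 : 0 < d / 2 * s := mul_pos (by positivity) hs.1
    change 0 < h (e + s • n)
    linarith
  · obtain ⟨M, δ, hM, hδ, hMb⟩ := exists_quadratic_bound hsm c
    obtain ⟨r, hr, hrlt⟩ := exists_between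
      (show 0 < min (ρ / 4) (min (δ / 2) (d / (2 * M))) by positivity)
    have hr1 : r < ρ / 4 := hrlt.trans_le (min_le_left _ _)
    have hr2 : r < δ / 2 := hrlt.trans_le ((min_le_right _ _).trans (min_le_left _ _))
    have hr3 : r * (2 * M) < d := by
      have := hrlt.trans_le ((min_le_right _ _).trans (min_le_right _ _))
      rwa [lt_div_iff₀ (by positivity)] at this
    refine ⟨c + r • n, r, hr, hr1, ?_, fun z hz hzc => ?_⟩
    · rw [sub_add_cancel_left, norm_neg, norm_smul, hnn, Real.norm_of_nonneg hr.le, mul_one]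
    · set v := z - c with hv
      have hv0 : 0 < ‖v‖ := norm_pos_iff.2 (sub_ne_zero.2 hzc)
      have hzv : z - (c + r • n) = v - r • n := by rw [hv]; ring
      rw [hzv] at hz
      have hvδ : ‖v‖ < δ := by
        have : ‖v‖ ≤ ‖v - r • n‖ + ‖r • n‖ := by
          simpa using norm_add_le (v - r • n) (r • n)
        rw [norm_smul, hnn, Real.norm_of_nonneg hr.le] at this
        linarith
      have h1 := hMb z (by rwa [mem_ball, dist_eq_norm])
      have h2 : ‖v‖ ^ 2 * d ≤ 2 * r * D v := by
        have h3 : ‖v - r • n‖ ^ 2 ≤ r ^ 2 := pow_le_pow_left₀ (norm_nonneg _) hz 2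
        rw [← Complex.normSq_eq_norm_sq, Complex.normSq_apply] at h3
        rw [← Complex.normSq_eq_norm_sq, Complex.normSq_apply, hDG]
        have hn2 : n.re ^ 2 + n.im ^ 2 = 1 := by
          have : ‖n‖ ^ 2 = 1 := by rw [hnn]; norm_num
          rw [← Complex.normSq_eq_norm_sq, Complex.normSq_apply] at this
          linarith
        have hGn : G = (d : ℝ) • n := by
          rw [hn, smul_smul, mul_inv_cancel₀ hd0.ne', one_smul]
        have hre : G.re = d * n.re := by rw [hGn]; simp
        have him : G.im = d * n.im := by rw [hGn]; simp
        simp only [Complex.sub_re, Complex.sub_im, Complex.real_smul, Complex.re_ofReal_mul,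
          Complex.im_ofReal_mul] at h3
        rw [hre, him]
        have h5 : v.re * v.re + v.im * v.im ≤ 2 * r * (v.re * n.re + v.im * n.im) := by
          nlinarith
        nlinarith
      have h3 := (abs_le.1 h1).1
      rw [hc] at h3
      have h4 : 0 < ‖v‖ ^ 2 := by positivity
      have h5 : 0 < (d - r * (2 * M)) * ‖v‖ ^ 2 := mul_pos (by linarith) h4
      have h6 : 0 < 2 * r * h z := by nlinarith
      exact (pos_iff_pos_of_mul_pos h6).1 (by positivity)

/-- The union of the unbounded components of the complement of `L`. -/
def unboundedPart (L : Set ℂ) : Set ℂ := {a | ¬ Bornology.IsBounded (connectedComponentIn Lᶜ a)}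

lemma mem_unboundedPart_of_isPreconnected {L P : Set ℂ} (hP : IsPreconnected P) (hPL : P ⊆ Lᶜ)
    {x y : ℂ} (hx : x ∈ P) (hy : y ∈ P) (h : x ∈ unboundedPart L) : y ∈ unboundedPart L := by
  have : connectedComponentIn Lᶜ x = connectedComponentIn Lᶜ y :=
    connectedComponentIn_eq (hP.subset_connectedComponentIn hx hPL hy)
  change ¬ Bornology.IsBounded _
  rw [← this]
  exact h

lemma isOpen_unboundedPart {L : Set ℂ} (hL : IsClosed L) : IsOpen (unboundedPart L) := by
  refine isOpen_iff_mem_nhds.2 fun a ha => ?_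
  have haL : a ∈ Lᶜ := fun haL => ha <| by
    rw [connectedComponentIn_eq_empty (not_not_intro haL)]
    exact Bornology.isBounded_empty
  refine mem_of_superset (hL.isOpen_compl.connectedComponentIn.mem_nhds
    (mem_connectedComponentIn haL)) fun b hb => ?_
  exact mem_unboundedPart_of_isPreconnected isPreconnected_connectedComponentIn
    (connectedComponentIn_subset _ _) (mem_connectedComponentIn haL) hb ha

lemma isPeak_of_mem_unboundedPart {L : Set ℂ} {h : ℂ → ℝ} (hL0 : ∀ z ∈ L, h z = 0)
    {c q : ℂ} {δ : ℝ}
    (hδ : ∀ z ∈ ball c δ, 0 < h z → ∃ P : Set ℂ,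
      IsPreconnected P ∧ P ⊆ {w | 0 < h w} ∧ z ∈ P ∧ q ∈ P)
    (he : ∀ e ∈ ball c δ, h e = 0 → e ∈ closure {w | 0 < h w})
    (hr : ∃ (a : ℂ) (r : ℝ), 0 < r ∧ r < δ ∧ ‖c - a‖ = r ∧
      ∀ z, ‖z - a‖ ≤ r → z ≠ c → 0 < h z)
    {v : ℂ} (hv : v ∈ ball c δ) (hvh : 0 < h v) (hvL : v ∈ unboundedPart L) :
    IsPeak L c ∧ ∀ e ∈ L ∩ ball c δ, e ∈ closure (unboundedPart L) := by
  have hpos : {w | 0 < h w} ⊆ Lᶜ := fun w (hw : 0 < h w) hwL => hw.ne' (hL0 w hwL)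
  have hall : ∀ z ∈ ball c δ, 0 < h z → z ∈ unboundedPart L := by
    intro z hz hzp
    obtain ⟨P, h1, h2, h3, h4⟩ := hδ v hv hvh
    obtain ⟨Q, k1, k2, k3, k4⟩ := hδ z hz hzp
    exact mem_unboundedPart_of_isPreconnected k1 (k2.trans hpos) k4 k3
      (mem_unboundedPart_of_isPreconnected h1 (h2.trans hpos) h3 h4 hvL)
  refine ⟨?_, fun e ⟨heL, heδ⟩ => ?_⟩
  · obtain ⟨a, r, hr0, hrδ, hca, ha⟩ := hr
    refine ⟨a, r, hr0, hall a ?_ ?_, hca, fun z hz hzr => ?_⟩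
    · rw [mem_ball', dist_eq_norm]
      linarith
    · refine ha a (by simpa using hr0.le) fun hac => ?_
      rw [hac, sub_self, norm_zero] at hca
      exact hr0.ne hca
    · by_contra hzc
      exact (ha z hzr hzc).ne' (hL0 z hz)
  · have h1 := he e heδ (hL0 e heL)
    have h2 := isOpen_ball.inter_closure ⟨heδ, h1⟩
    exact closure_mono (fun z hz => hall z hz.1 hz.2) h2

lemma isPeak_of_mem_closure {L : Set ℂ} (hL : IsClosed L) {h : ℂ → ℝ} (hsm : ContDiff ℝ 2 h)
    (hL0 : ∀ z ∈ L, h z = 0) {c : ℂ} (hcL : c ∈ L) (hd : fderiv ℝ h c ≠ 0)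
    (hc : c ∈ closure (unboundedPart L)) :
    IsPeak L c ∧ ∃ δ > 0, ∀ e ∈ L ∩ ball c δ, e ∈ closure (unboundedPart L) := by
  have hd' : fderiv ℝ (fun z => -h z) c ≠ 0 := by
    rw [fderiv_fun_neg]
    exact neg_ne_zero.2 hd
  obtain ⟨δ₁, q₁, hδ₁, h1, h2, h3⟩ := exists_positive_side hsm (hL0 c hcL) hd
  obtain ⟨δ₂, q₂, hδ₂, k1, k2, k3⟩ := exists_positive_side hsm.neg
    (by rw [hL0 c hcL, neg_zero]) hd'
  obtain ⟨v, hv, hvV, hv0⟩ : ∃ v ∈ ball c (min δ₁ δ₂), v ∈ unboundedPart L ∧ h v ≠ 0 := by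
    obtain ⟨v, hv, hvV⟩ := mem_closure_iff.1 hc (ball c (min δ₁ δ₂)) isOpen_ball
      (mem_ball_self (lt_min hδ₁ hδ₂))
    by_cases hv0 : h v = 0
    · have h4 := h2 v (ball_subset_ball (min_le_left _ _) hv) hv0
      obtain ⟨w, ⟨hw1, hw2⟩, hw⟩ := mem_closure_iff.1 h4 _
        (isOpen_ball.inter (isOpen_unboundedPart hL)) ⟨hv, hvV⟩
      exact ⟨w, hw1, hw2, ne_of_gt hw⟩
    · exact ⟨v, hv, hvV, hv0⟩
  rcases hv0.lt_or_gt with hneg | hpos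
  · obtain ⟨l1, l2⟩ := isPeak_of_mem_unboundedPart (h := fun z => -h z)
      (fun z hz => by rw [hL0 z hz, neg_zero]) k1 k2 k3
      (ball_subset_ball (min_le_right _ _) hv) (neg_pos.2 hneg) hvV
    exact ⟨l1, δ₂, hδ₂, l2⟩
  · obtain ⟨l1, l2⟩ := isPeak_of_mem_unboundedPart hL0 h1 h2 h3
      (ball_subset_ball (min_le_left _ _) hv) hpos hvV
    exact ⟨l1, δ₁, hδ₁, l2⟩

/-- Every point of a connected compact piece of a regular level curve is a peak point. -/
theorem isPeak_of_level {L : Set ℂ} (hL : IsCompact L) (hLp : IsPreconnected L) {h : ℂ → ℝ}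
    (hsm : ContDiff ℝ 2 h) (hL0 : ∀ z ∈ L, h z = 0) (hd : ∀ z ∈ L, fderiv ℝ h z ≠ 0)
    {c : ℂ} (hc : c ∈ L) : IsPeak L c := by
  have : PreconnectedSpace L := isPreconnected_iff_preconnectedSpace.1 hLp
  set T : Set L := {x | (x : ℂ) ∈ closure (unboundedPart L)} with hT
  have hcl : IsClosed T := isClosed_closure.preimage continuous_subtype_val
  have hop : IsOpen T := by
    refine Metric.isOpen_iff.2 fun x hx => ?_
    obtain ⟨-, δ, hδ, h1⟩ := isPeak_of_mem_closure hL.isClosed hsm hL0 x.2 (hd x x.2) hx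
    exact ⟨δ, hδ, fun y hy => h1 y ⟨y.2, hy⟩⟩
  have hne : T.Nonempty := by
    obtain ⟨R, hR⟩ := hL.isBounded.subset_closedBall c
    obtain ⟨b, hb⟩ : ∃ b, b ∉ closedBall c R := by
      by_contra! hall
      exact (NormedSpace.noncompactSpace ℝ ℂ).noncompact_univ
        (by rw [← eq_univ_of_forall hall]; exact isCompact_closedBall c R)
    have hbV : b ∈ unboundedPart L := not_isBounded_of_convex (convex_closedBall c R)
      ⟨c, hR hc⟩ hR hb
    have hbL : b ∈ Lᶜ := fun h => hb (hR h)
    set W := connectedComponentIn Lᶜ b with hW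
    have hWV : W ⊆ unboundedPart L := fun w hw =>
      mem_unboundedPart_of_isPreconnected isPreconnected_connectedComponentIn
        (connectedComponentIn_subset _ _) (mem_connectedComponentIn hbL) hw hbV
    obtain ⟨x, hx⟩ : (frontier W).Nonempty := by
      refine nonempty_frontier_iff.2 ⟨⟨b, mem_connectedComponentIn hbL⟩, fun h => ?_⟩
      have : c ∈ W := h ▸ mem_univ c
      exact connectedComponentIn_subset _ _ this hc
    exact ⟨⟨x, frontier_connectedComponentIn_subset hL.isClosed b hx⟩, closure_mono hWV hx.1⟩
  have huniv := IsClopen.eq_univ ⟨hcl, hop⟩ hne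
  have hcT : (⟨c, hc⟩ : L) ∈ T := huniv ▸ mem_univ _
  exact (isPeak_of_mem_closure hL.isClosed hsm hL0 hc (hd c hc) hcT).1

end PeakDiscs

end TotallyRealDiscHull

namespace TotallyRealDiscHull

open Set Filter Topology Metric

/-- On a totally real surface in `ℂ²`, the first coordinate has no critical points. -/
lemma fderiv_fst_ne_zero {φ : ℝ × ℝ → Fin 2 → ℂ} {x : ℝ × ℝ} (hφ : DifferentiableAt ℝ φ x)
    (hinj : Function.Injective (fderiv ℝ φ x))
    (hreal : ∀ v w : ℝ × ℝ, fderiv ℝ φ x v = Complex.I • fderiv ℝ φ x w → fderiv ℝ φ x v = 0) :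
    fderiv ℝ (fun y => φ y 0) x ≠ 0 := by
  intro h0
  have happ : ∀ i v, fderiv ℝ (fun y => φ y i) x v = fderiv ℝ φ x v i := fun i v => by
    rw [fderiv_apply hφ i]
    rfl
  have hz : ∀ v, fderiv ℝ φ x v 0 = 0 := fun v => by rw [← happ, h0]; rfl
  set T : ℝ × ℝ →ₗ[ℝ] ℂ := (fderiv ℝ (fun y => φ y 1) x).toLinearMap with hT
  have hTa : ∀ v, T v = fderiv ℝ φ x v 1 := fun v => happ 1 v
  have hTi : Function.Injective T := fun v w hvw => hinj <| by
    rw [hTa, hTa] at hvw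
    funext i
    fin_cases i
    · exact (hz v).trans (hz w).symm
    · exact hvw
  have hTs : Function.Surjective T :=
    (LinearMap.injective_iff_surjective_of_finrank_eq_finrank (by simp)).1 hTi
  obtain ⟨w, hw⟩ := hTs (Complex.I⁻¹ * T (1, 0))
  have hv : fderiv ℝ φ x (1, 0) = Complex.I • fderiv ℝ φ x w := by
    funext i
    fin_cases i
    · simp [hz]
    · simp only [Fin.mk_one, Pi.smul_apply, smul_eq_mul]
      rw [← hTa, ← hTa, hw, mul_inv_cancel_left₀ Complex.I_ne_zero]
  have h1 : fderiv ℝ φ x (1, 0) = fderiv ℝ φ x 0 := by rw [hreal _ _ hv, map_zero]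
  simpa using congrArg Prod.fst (hinj h1)

lemma subset_polyHull {n : ℕ} {K : Set (Fin n → ℂ)} (hK : IsCompact K) : K ⊆ polyHull n K :=
  fun z hz p => le_csSup
    (hK.image (MvPolynomial.continuous_eval p).norm).bddAbove ⟨z, hz, rfl⟩

/-- The image of the closed unit disc under a totally real map whose first coordinate takes values
in a smooth curve is polynomially convex. -/
lemma polyHull_image_subset {h : ℂ → ℝ} (hsm : ContDiff ℝ 2 h) {U : Set (ℝ × ℝ)}
    {φ : ℝ × ℝ → Fin 2 → ℂ} (hU : IsOpen U) (hSU : closedBall (0 : ℝ × ℝ) 1 ⊆ U)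
    (hφ : ContDiffOn ℝ 2 φ U) (hinj : InjOn φ U)
    (hh : ∀ x ∈ closedBall (0 : ℝ × ℝ) 1, h (φ x 0) = 0)
    (hdh : ∀ x ∈ closedBall (0 : ℝ × ℝ) 1, fderiv ℝ h (φ x 0) ≠ 0)
    (hdφ : ∀ x ∈ closedBall (0 : ℝ × ℝ) 1, fderiv ℝ (fun y => φ y 0) x ≠ 0) :
    polyHull 2 (φ '' closedBall 0 1) ⊆ φ '' closedBall 0 1 := by
  intro x hx
  set S : Set (ℝ × ℝ) := closedBall 0 1 with hS
  have hSc : IsCompact S := isCompact_closedBall 0 1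
  have hSconv : Convex ℝ S := convex_closedBall 0 1
  have h0S : (0 : ℝ × ℝ) ∈ S := mem_closedBall_self zero_le_one
  have hcont : ∀ i, ContinuousOn (fun y => φ y i) S := fun i =>
    (continuous_apply i).comp_continuousOn (hφ.continuousOn.mono hSU)
  have hφi : ∀ i, ContDiffOn ℝ 2 (fun y => φ y i) U := fun i => contDiffOn_pi.1 hφ i
  have hinj' : ∀ a ∈ S, ∀ b ∈ S, φ a 0 = φ b 0 → φ a 1 = φ b 1 → a = b := fun a ha b hb h0 h1 =>
    hinj (hSU ha) (hSU hb) (by funext i; fin_cases i <;> assumption)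
  have : CompactSpace S := isCompact_iff_compactSpace.1 hSc
  have : Nonempty S := ⟨⟨0, h0S⟩⟩
  let f : C(S, ℂ) := ⟨fun y => φ y 0, (hcont 0).domRestrict⟩
  let g : C(S, ℂ) := ⟨fun y => φ y 1, (hcont 1).domRestrict⟩
  have hfr : range f = (fun y => φ y 0) '' S := Subset.antisymm
    (range_subset_iff.2 fun y => ⟨y, y.2, rfl⟩) (image_subset_iff.2 fun y hy => ⟨⟨y, hy⟩, rfl⟩)
  have hfib : ∀ c ∈ range f, PolyDense (g '' {y | f y = c}) := fun c _ => by
    set e := Complex.equivRealProdCLM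
    have he : ∀ z, HasFDerivAt e (e : ℂ →L[ℝ] ℝ × ℝ) z := fun z => e.hasFDerivAt
    have key := polyDense_fiber (S := e ⁻¹' S) (U := e ⁻¹' U) (f := fun z => φ (e z) 0)
      (g := fun z => φ (e z) 1) (e.toHomeomorph.isCompact_preimage.2 hSc)
      (hSconv.linear_preimage (e : ℂ →ₗ[ℝ] ℝ × ℝ))
      ⟨0, interior_maximal (preimage_mono ball_subset_closedBall)
        (isOpen_ball.preimage e.continuous) (by simp)⟩
      (hU.preimage e.continuous) (preimage_mono hSU)
      ((hφi 0).comp e.contDiff.contDiffOn fun _ hz => hz)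
      ((hφi 1).comp e.contDiff.contDiffOn fun _ hz => hz)
      (fun a ha b hb h0 h1 => e.injective (hinj' _ ha _ hb h0 h1)) hsm
      (fun z hz => hh _ hz) (fun z hz => hdh _ hz) (fun z hz h0 => hdφ _ hz ?_) c
    · convert key using 1
      ext w
      constructor
      · rintro ⟨y, hy, rfl⟩
        have hey : e (e.symm y) = y := e.apply_symm_apply y
        refine ⟨e.symm y, ⟨?_, ?_⟩, ?_⟩
        · rw [mem_preimage, hey]
          exact y.2
        · rw [mem_preimage, hey]
          exact hy
        · simp only [hey]
          rfl
      · rintro ⟨z, ⟨hz, hzc⟩, rfl⟩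
        exact ⟨⟨e z, hz⟩, hzc, rfl⟩
    · have hd : DifferentiableAt ℝ (fun y => φ y 0) (e z) :=
        ((hφi 0).contDiffAt (hU.mem_nhds (hSU hz))).differentiableAt (by norm_num)
      have := hd.hasFDerivAt.comp z (he z)
      rw [HasFDerivAt.fderiv (f := fun z => φ (e z) 0) this] at h0
      refine ContinuousLinearMap.ext fun v => ?_
      simpa using DFunLike.congr_fun h0 (e.symm v)
  have hpeak : ∀ c ∈ range f, IsPeak (range f) c := by
    rw [hfr]
    intro c hc
    exact isPeak_of_level (hSc.image_of_continuousOn (hcont 0))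
      (hSconv.isPreconnected.image _ (hcont 0)) hsm (forall_mem_image.2 hh)
      (forall_mem_image.2 hdh) hc
  have hlog : ∀ z₀ ∉ range f, HasLogOn (fun y => f y - z₀) (univ : Set S) := fun z₀ hz₀ =>
    (hasLogOn_closedBall (u := fun y => φ y 0 - z₀) ((hcont 0).sub continuousOn_const)
      fun y hy h0 => hz₀ ⟨⟨y, hy⟩, sub_eq_zero.1 h0⟩).comp
        continuous_subtype_val.continuousOn fun y _ => y.2
  have hvec : ∀ y : S, ![f y, g y] = φ y := fun y => by
    funext i
    fin_cases i <;> rfl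
  obtain ⟨y, h0, h1⟩ := exists_eq_of_mem_hull (f := f) (g := g)
    (fun a b h0 h1 => Subtype.ext (hinj' _ a.2 _ b.2 h0 h1)) hlog hpeak hfib (x := x)
    fun p C hC => (hx p).trans <| csSup_le ⟨_, _, ⟨0, h0S, rfl⟩, rfl⟩ <| by
      rintro _ ⟨_, ⟨y, hy, rfl⟩, rfl⟩
      simpa only [hvec] using hC ⟨y, hy⟩
  refine ⟨y, y.2, ?_⟩
  funext i
  fin_cases i
  · exact h0
  · exact h1

end TotallyRealDiscHull

/-- Let `h : ℂ → ℝ` be smooth and `E_h := {z ∈ ℂ : h z = 0}`.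
If `dh ≠ 0` at every point of `E_h`, then every totally real `C²`-smooth disc
contained in `M := E_h × ℂ ⊆ ℂ²` is polynomially convex. -/
theorem totallyRealDisc_in_curve_cross_C_polyConvex
    (h : ℂ → ℝ) (hsm : ContDiff ℝ (⊤ : ℕ∞) h)
    (Eh : Set ℂ) (hEh : Eh = {z : ℂ | h z = 0})
    (hdh : ∀ z ∈ Eh, fderiv ℝ h z ≠ 0)
    (M : Set (Fin 2 → ℂ)) (hM : M = {z : Fin 2 → ℂ | z 0 ∈ Eh})
    (K : Set (Fin 2 → ℂ)) (hK : TotallyRealDisc 2 K) (hKM : K ⊆ M) :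
    PolyConvex 2 K := by

  obtain ⟨U, φ, hU, hSU, hφ, hinj, himm, hreal, rfl⟩ := hK
  have hEh' : ∀ x ∈ Metric.closedBall (0 : ℝ × ℝ) 1, φ x 0 ∈ Eh := fun x hx => by
    have := hKM (Set.mem_image_of_mem φ hx)
    rwa [hM] at this
  refine Set.Subset.antisymm
    (TotallyRealDiscHull.polyHull_image_subset (hsm.of_le ?_) hU hSU hφ hinj
      (fun x hx => ?_) (fun x hx => hdh _ (hEh' x hx)) fun x hx => ?_)
    (TotallyRealDiscHull.subset_polyHull
      ((isCompact_closedBall 0 1).image_of_continuousOn (hφ.continuousOn.mono hSU)))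
  · exact WithTop.coe_le_coe.2 (le_top : (2 : ℕ∞) ≤ ⊤)
  · have := hEh' x hx
    rwa [hEh] at this
  · exact TotallyRealDiscHull.fderiv_fst_ne_zero
      ((hφ.contDiffAt (hU.mem_nhds (hSU hx))).differentiableAt (by norm_num))
      (himm x (hSU hx)) (hreal x (hSU hx))
end
end

section
/- Let M := ℝ × ℂ ⊂ ℂ², i.e., M = { (z₁, z₂) ∈ ℂ² : Im z₁ = 0 }. Then every totally real C²-smooth disc contained in M is polynomially convex. -/
noncomputable section

open Set Filter Topology Metric

/-- The function `u` has a continuous logarithm on `s`. -/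
def HasLogOn {α : Type*} [TopologicalSpace α] (u : α → ℂ) (s : Set α) : Prop :=
  ∃ h : α → ℂ, ContinuousOn h s ∧ ∀ x ∈ s, u x = Complex.exp (h x)

namespace HasLogOn

variable {α : Type*} [TopologicalSpace α] {u v : α → ℂ} {s t : Set α}

theorem mono (hu : HasLogOn u s) (hts : t ⊆ s) : HasLogOn u t := by
  obtain ⟨h, hc, he⟩ := hu
  exact ⟨h, hc.mono hts, fun x hx => he x (hts hx)⟩

theorem congr (hu : HasLogOn u s) (huv : ∀ x ∈ s, v x = u x) : HasLogOn v s := by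
  obtain ⟨h, hc, he⟩ := hu
  exact ⟨h, hc, fun x hx => by rw [huv x hx, he x hx]⟩

theorem mul (hu : HasLogOn u s) (hv : HasLogOn v s) : HasLogOn (fun x => u x * v x) s := by
  obtain ⟨h, hc, he⟩ := hu
  obtain ⟨k, kc, ke⟩ := hv
  exact ⟨fun x => h x + k x, hc.add kc, fun x hx => by simp only [Complex.exp_add, he x hx, ke x hx]⟩

theorem prod {ι : Type*} (Z : Finset ι) {w : ι → α → ℂ} (h : ∀ i ∈ Z, HasLogOn (w i) s) :
    HasLogOn (fun x => ∏ i ∈ Z, w i x) s := by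
  classical
  induction Z using Finset.induction_on with
  | empty => exact ⟨fun _ => 0, continuousOn_const, by simp⟩
  | insert a Z ha ih =>
    have h1 := (h a (Finset.mem_insert_self a Z)).mul
      (ih fun i hi => h i (Finset.mem_insert_of_mem hi))
    exact h1.congr fun x _ => Finset.prod_insert ha

theorem inv (hu : HasLogOn u s) : HasLogOn (fun x => (u x)⁻¹) s := by
  obtain ⟨h, hc, he⟩ := hu
  exact ⟨fun x => -h x, hc.neg, fun x hx => by simp only [Complex.exp_neg, he x hx]⟩

theorem of_norm_sub_one_lt (hc : ContinuousOn u s) (h : ∀ x ∈ s, ‖u x - 1‖ < 1) :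
    HasLogOn u s := by
  have hs : ∀ x ∈ s, u x ∈ Complex.slitPlane := fun x hx => by
    apply Complex.ball_one_subset_slitPlane
    simpa [dist_eq_norm] using h x hx
  exact ⟨fun x => Complex.log (u x), hc.clog hs,
    fun x hx => (Complex.exp_log (Complex.slitPlane_ne_zero (hs x hx))).symm⟩

theorem of_continuous [SimplyConnectedSpace α] [LocallyPathConnectedSpace α]
    (hc : Continuous u) (h0 : ∀ x, u x ≠ 0) : HasLogOn u univ := by
  obtain ⟨x₀⟩ : Nonempty α := inferInstance
  obtain ⟨f, ⟨-, hf⟩, -⟩ := Complex.isCoveringMapOn_exp.existsUnique_continuousMap_lifts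
    ⟨u, hc⟩ (a₀ := x₀) (Complex.exp_log (h0 x₀)) h0
  exact ⟨f, f.continuous.continuousOn, fun x _ => (congrFun hf x).symm⟩

end HasLogOn

/-- A nonvanishing function on a closed ball of `ℝ × ℝ` (a square) has a continuous logarithm. -/
theorem hasLogOn_closedBall {u : ℝ × ℝ → ℂ} (hc : ContinuousOn u (closedBall 0 1))
    (h0 : ∀ x ∈ closedBall (0 : ℝ × ℝ) 1, u x ≠ 0) : HasLogOn u (closedBall 0 1) := by
  let r : ℝ × ℝ → ℝ × ℝ := fun x => (max (-1) (min 1 x.1), max (-1) (min 1 x.2))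
  have hr : Continuous r := by fun_prop
  have hmem : ∀ x, r x ∈ closedBall (0 : ℝ × ℝ) 1 := fun x => by
    simp [r, Prod.norm_def, abs_le]
  have hfix : ∀ x ∈ closedBall (0 : ℝ × ℝ) 1, r x = x := fun x hx => by
    simp only [mem_closedBall, dist_zero_right, Prod.norm_def, Real.norm_eq_abs, sup_le_iff,
      abs_le] at hx
    ext <;> simp [r, hx]
  have := HasLogOn.of_continuous (u := fun x => u (r x))
    (hc.comp_continuous hr hmem) fun x => h0 _ (hmem x)
  exact (this.mono (subset_univ _)).congr fun x hx => by rw [hfix x hx]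

/-- There is no continuous logarithm of `z - w` on a circle around `w`. -/
theorem not_hasLogOn_sphere (w : ℂ) {R : ℝ} (hR : 0 < R) :
    ¬ HasLogOn (fun z => z - w) (sphere w R) := by
  rintro ⟨k, kc, ke⟩
  let c : ℝ → ℂ := circleMap w R
  have hc : ∀ t, c t ∈ sphere w R := circleMap_mem_sphere w hR.le
  let m : ℝ → ℂ := fun t => k (c t) - (Real.log R + t * Complex.I)
  have hm : Continuous m :=
    (kc.comp_continuous (continuous_circleMap w R) hc).sub (by fun_prop)
  have hexp : ∀ t, Complex.exp (m t) = 1 := fun t => by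
    have h1 := ke _ (hc t)
    have hR' : (R : ℂ) ≠ 0 := by exact_mod_cast hR.ne'
    simp only [m, Complex.exp_sub, Complex.exp_add, ← h1]
    rw [← Complex.ofReal_exp, Real.exp_log hR]
    simp [c, circleMap, hR']
  have hI : (0 : ℝ) < 2 * Real.pi := Real.two_pi_pos
  have hconst : ∀ t, (m t).im = (m 0).im := by
    let n : ℝ → ℝ := fun t => (m t).im / (2 * Real.pi)
    have hn : Continuous n := (Complex.continuous_im.comp hm).div_const _
    have hint : ∀ t, ∃ j : ℤ, n t = j := fun t => by
      obtain ⟨j, hj⟩ := Complex.exp_eq_one_iff.1 (hexp t)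
      refine ⟨j, ?_⟩
      simp only [n, hj]
      have : ((j : ℂ) * (2 * Real.pi * Complex.I)).im = j * (2 * Real.pi) := by simp
      rw [this]; field_simp
    choose j hj using hint
    have hjc : Continuous j := by
      rw [Int.isClosedEmbedding_coe_real.isInducing.continuous_iff]
      convert hn using 1
      exact funext fun t => (hj t).symm
    intro t
    have h1 : j t = j 0 := PreconnectedSpace.constant inferInstance hjc
    have h2 : n t = n 0 := by rw [hj, hj, h1]
    simpa [n, hI.ne', div_left_inj'] using h2
  have h2 := hconst (2 * Real.pi)
  have hper : c (2 * Real.pi) = c 0 := by simp [c, circleMap]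
  simp only [m, hper] at h2
  simp at h2

open Polynomial in
/-- If `z - w` has a continuous logarithm on a plane compactum `Y` for a dense set of `w ∉ Y`, then
`Y` is polynomially convex. -/
theorem exists_polynomial_eval_eq_one {Y : Set ℂ} (hY : IsCompact Y)
    (H : ∀ E : Set ℂ, IsOpen E → E.Nonempty → Disjoint E Y →
      ∃ w ∈ E, HasLogOn (fun z => z - w) Y) {w : ℂ} (hw : w ∉ Y) :
    ∃ q : ℂ[X], q.eval w = 1 ∧ ∀ z ∈ Y, ‖q.eval z‖ ≤ 1 / 2 := by
  have : CompactSpace Y := isCompact_iff_compactSpace.1 hY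
  let S : Subalgebra ℂ C(Y, ℂ) := (polynomialFunctions Y).topologicalClosure
  have hS : IsClosed (S : Set C(Y, ℂ)) := (polynomialFunctions Y).isClosed_topologicalClosure
  have : CompleteSpace S := hS.completeSpace_coe
  let ζ : S := ⟨toContinuousMapOnAlgHom Y X, (polynomialFunctions Y).le_topologicalClosure
    ⟨X, Algebra.mem_top, rfl⟩⟩
  have hζ : spectrum ℂ (ζ : C(Y, ℂ)) ⊆ Y := fun μ hμ => by
    rw [ContinuousMap.spectrum_eq_range] at hμ
    obtain ⟨y, rfl⟩ := hμ
    simp [ζ]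
  have hfr : frontier (spectrum ℂ ζ) ⊆ Y := (Subalgebra.frontier_spectrum S ζ).trans hζ
  by_cases hws : w ∈ spectrum ℂ ζ
  · exfalso
    set E := spectrum ℂ ζ \ Y
    have hEo : IsOpen E := by
      have : E = interior (spectrum ℂ ζ) \ Y := by
        ext μ
        refine ⟨fun h => ⟨?_, h.2⟩, fun h => ⟨interior_subset h.1, h.2⟩⟩
        by_contra h'
        exact h.2 (hfr ⟨subset_closure h.1, h'⟩)
      rw [this]
      exact isOpen_interior.sdiff hY.isClosed
    obtain ⟨w', hw'E, h, hc, he⟩ := H E hEo ⟨w, hws, hw⟩ disjoint_sdiff_left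
    obtain ⟨k, hk⟩ := ContinuousMap.exists_restrict_eq hY.isClosed
      (⟨Y.domRestrict h, continuousOn_iff_continuous_domRestrict.1 hc⟩ : C(Y, ℂ))
    have hk' : ∀ y ∈ Y, k y = h y := fun y hy => congrArg (fun f : C(Y, ℂ) => f ⟨y, hy⟩) hk
    have hEfr : frontier E ⊆ Y := fun μ hμ => by
      by_contra hμY
      refine hμY (hfr ?_)
      rw [hEo.frontier_eq] at hμ
      refine ⟨closure_mono sdiff_subset hμ.1, fun h' => hμ.2 ⟨interior_subset h', hμY⟩⟩
    classical
    let F : ℂ → ℂ := E.piecewise (fun z => Complex.exp (k z)) fun z => z - w'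
    have hF : Continuous F := by
      refine Continuous.piecewise (fun a ha => ?_) (by fun_prop) (by fun_prop)
      rw [hk' a (hEfr ha)]
      exact (he a (hEfr ha)).symm
    have hF0 : ∀ z, F z ≠ 0 := fun z => by
      by_cases hz : z ∈ E
      · simp [F, hz]
      · simp only [F, hz, not_false_eq_true, piecewise_eq_of_notMem]
        exact fun h0 => hz (by rwa [sub_eq_zero.1 h0])
    obtain ⟨R, hR0, hR⟩ := (spectrum.isBounded ζ).subset_ball_lt 0 w'
    refine not_hasLogOn_sphere w' hR0
      (((HasLogOn.of_continuous hF hF0).mono (subset_univ _)).congr fun z hz => ?_)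
    have hzE : z ∉ E := fun hzE => by
      have := hR hzE.1
      rw [mem_sphere] at hz
      rw [mem_ball, hz] at this
      exact lt_irrefl _ this
    simp [F, hzE]
  · rw [spectrum.notMem_iff] at hws
    obtain ⟨a, ha⟩ := hws.exists_right_inv
    obtain ⟨M, hM0, hM⟩ : ∃ M : ℝ, 0 < M ∧ ∀ z ∈ Y, ‖w - z‖ ≤ M := by
      obtain ⟨M, hM⟩ := hY.exists_bound_of_continuousOn (f := fun z => w - z) (by fun_prop)
      exact ⟨max M 1, by positivity, fun z hz => (hM z hz).trans (le_max_left _ _)⟩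
    obtain ⟨b, hb, hab⟩ := Metric.mem_closure_iff.1
      (show (a : C(Y, ℂ)) ∈ closure (polynomialFunctions Y : Set C(Y, ℂ)) from a.2)
      (1 / (2 * M)) (by positivity)
    obtain ⟨q, -, rfl⟩ := hb
    refine ⟨1 - (C w - X) * q, by simp, fun z hz => ?_⟩
    have h1 : (w - z) * (a : C(Y, ℂ)) ⟨z, hz⟩ = 1 := by
      have := congrArg (fun f : S => (f : C(Y, ℂ)) ⟨z, hz⟩) ha
      simpa [ζ] using this
    have h2 : ‖(a : C(Y, ℂ)) ⟨z, hz⟩ - q.eval z‖ ≤ 1 / (2 * M) := by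
      rw [← dist_eq_norm]
      exact (ContinuousMap.dist_apply_le_dist (x := (⟨z, hz⟩ : Y)) ..).trans hab.le
    have h3 : (1 - (C w - X) * q).eval z = (w - z) * ((a : C(Y, ℂ)) ⟨z, hz⟩ - q.eval z) := by
      rw [mul_sub, h1]; simp
    rw [h3, norm_mul]
    calc _ ≤ M * (1 / (2 * M)) := by gcongr; exact hM z hz
      _ = 1 / 2 := by field_simp

/-- The existence of a logarithm of `x ↦ L (x - a)` is locally constant in `a` off `X`. -/
theorem eventually_hasLogOn_iff {X : Set (ℝ × ℝ)} (hX : IsCompact X) (L : (ℝ × ℝ) ≃L[ℝ] ℂ)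
    {a : ℝ × ℝ} (ha : a ∉ X) :
    ∀ᶠ b in 𝓝 a, (HasLogOn (fun x => L (x - b)) X ↔ HasLogOn (fun x => L (x - a)) X) := by
  have h0 : ∀ x ∈ X, L (x - a) ≠ 0 := fun x hx h => by
    rw [map_eq_zero_iff L L.injective, sub_eq_zero] at h
    exact ha (h ▸ hx)
  obtain ⟨M, hM0, hM⟩ : ∃ M : ℝ, 0 < M ∧ ∀ x ∈ X, ‖(L (x - a))⁻¹‖ ≤ M := by
    obtain ⟨M, hM⟩ := hX.exists_bound_of_continuousOn (f := fun x => (L (x - a))⁻¹)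
      (ContinuousOn.inv₀ (by fun_prop) h0)
    exact ⟨max M 1, by positivity, fun z hz => (hM z hz).trans (le_max_left _ _)⟩
  have hcont : Tendsto (fun b => ‖L (a - b)‖) (𝓝 a) (𝓝 ‖L (a - a)‖) :=
    Continuous.tendsto (f := fun b => ‖L (a - b)‖) (by fun_prop) a
  rw [sub_self, map_zero, norm_zero] at hcont
  filter_upwards [hcont.eventually_lt_const (inv_pos.2 hM0)] with b hb
  have hq : HasLogOn (fun x => L (x - b) * (L (x - a))⁻¹) X := by
    refine HasLogOn.of_norm_sub_one_lt (.mul (by fun_prop) (ContinuousOn.inv₀ (by fun_prop) h0))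
      fun x hx => ?_
    have : L (x - b) * (L (x - a))⁻¹ - 1 = L (a - b) * (L (x - a))⁻¹ := by
      have h1 : L (x - b) = L (x - a) + L (a - b) := by rw [← map_add]; simp
      rw [h1, add_mul, mul_inv_cancel₀ (h0 x hx)]; ring
    rw [this, norm_mul]
    calc _ ≤ ‖L (a - b)‖ * M := by gcongr; exact hM x hx
      _ < M⁻¹ * M := by gcongr
      _ = 1 := inv_mul_cancel₀ hM0.ne'
  have hqa : ∀ x ∈ X, L (x - b) = (L (x - b) * (L (x - a))⁻¹) * L (x - a) := fun x hx => by
    rw [inv_mul_cancel_right₀ (h0 x hx)]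
  obtain ⟨k, -, hk⟩ := id hq
  refine ⟨fun h => (h.mul hq.inv).congr fun x hx => ?_, fun h => (hq.mul h).congr hqa⟩
  have hne : L (x - b) * (L (x - a))⁻¹ ≠ 0 :=
    ne_of_eq_of_ne (hk x hx) (Complex.exp_ne_zero _)
  have hne' : L (x - b) ≠ 0 := left_ne_zero_of_mul hne
  have := h0 x hx
  field_simp

/-- A level set of a function without local extrema in the square does not separate the plane:
points of the square off the level set have logarithms of the distance vector on it. -/
theorem hasLogOn_levelSet {f : ℝ × ℝ → ℝ} (hf : ContinuousOn f (closedBall 0 1))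
    (hcrit : ∀ x ∈ interior (closedBall (0 : ℝ × ℝ) 1), ¬ IsLocalExtr f x) (c : ℝ)
    (L : (ℝ × ℝ) ≃L[ℝ] ℂ) {a : ℝ × ℝ} (ha : a ∉ {x ∈ closedBall (0 : ℝ × ℝ) 1 | f x = c}) :
    HasLogOn (fun x => L (x - a)) {x ∈ closedBall (0 : ℝ × ℝ) 1 | f x = c} := by
  set Q := closedBall (0 : ℝ × ℝ) 1
  set X := {x ∈ Q | f x = c}
  have hXc : IsClosed X := hf.preimage_isClosed_of_isClosed isClosed_closedBall isClosed_singleton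
  have hXQ : X ⊆ Q := fun x hx => hx.1
  have hX : IsCompact X := (isCompact_closedBall _ _).of_isClosed_subset hXc hXQ
  by_contra hlog
  let T : Set (ℝ × ℝ) := {b | b ∉ X ∧ ¬ HasLogOn (fun x => L (x - b)) X}
  have hTQ : T ⊆ Q := fun b hb => by
    by_contra hbQ
    refine hb.2 ((hasLogOn_closedBall (by fun_prop) fun x hx h => ?_).mono hXQ)
    rw [map_eq_zero_iff L L.injective, sub_eq_zero] at h
    exact hbQ (h ▸ hx)
  have hTo : IsOpen T := isOpen_iff_mem_nhds.2 fun b hb => by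
    filter_upwards [eventually_hasLogOn_iff hX L hb.1, hXc.isOpen_compl.mem_nhds hb.1] with b' h1 h2
    exact ⟨h2, fun h => hb.2 (h1.1 h)⟩
  have hTX : IsClosed (T ∪ X) := by
    rw [← isOpen_compl_iff, isOpen_iff_mem_nhds]
    intro b hb
    have hbX : b ∉ X := fun h => hb (Or.inr h)
    filter_upwards [eventually_hasLogOn_iff hX L hbX, hXc.isOpen_compl.mem_nhds hbX] with b' h1 h2
    rintro (h3 | h3)
    · exact hb (Or.inl ⟨hbX, fun h => h3.2 (h1.2 h)⟩)
    · exact h2 h3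
  have hTXQ : T ∪ X ⊆ Q := union_subset hTQ hXQ
  have haT : a ∈ T := ⟨ha, hlog⟩
  obtain ⟨x, hx, hmax⟩ := ((isCompact_closedBall _ _).of_isClosed_subset hTX hTXQ).exists_isMaxOn
    ⟨a, Or.inl haT⟩ ((hf.mono hTXQ).sub continuousOn_const).abs (f := fun y => |f y - c|)
  rw [isMaxOn_iff] at hmax
  have hpos : 0 < |f x - c| := by
    refine lt_of_lt_of_le (abs_pos.2 (sub_ne_zero.2 fun h => ?_)) (hmax a (Or.inl haT))
    exact ha ⟨hTQ haT, h⟩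
  have hxT : x ∈ T := hx.resolve_right fun h => by simp [h.2] at hpos
  refine hcrit x (interior_maximal hTQ hTo hxT) ?_
  rcases lt_or_gt_of_ne (sub_ne_zero.1 (abs_pos.1 hpos)) with h | h
  · left
    filter_upwards [hTo.mem_nhds hxT] with y hy
    have := (neg_le_abs _).trans (hmax y (Or.inl hy))
    rw [abs_of_neg (sub_neg.2 h)] at this
    linarith
  · right
    filter_upwards [hTo.mem_nhds hxT] with y hy
    have := (le_abs_self _).trans (hmax y (Or.inl hy))
    rw [abs_of_pos (sub_pos.2 h)] at this
    linarith

/-- A function on the square with nondegenerate zeros is a nonvanishing function times a finite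
product of real-linear factors; hence it has a logarithm where those factors do. -/
theorem hasLogOn_of_nondegenerate_zeros {g : ℝ × ℝ → ℂ} (hg : ContinuousOn g (closedBall 0 1))
    (hreg : ∀ x ∈ closedBall (0 : ℝ × ℝ) 1, g x = 0 →
      ∃ L : (ℝ × ℝ) ≃L[ℝ] ℂ, HasFDerivAt g (L : (ℝ × ℝ) →L[ℝ] ℂ) x)
    {X : Set (ℝ × ℝ)} (hXQ : X ⊆ closedBall 0 1) (hgX : ∀ x ∈ X, g x ≠ 0)
    (hX : ∀ (L : (ℝ × ℝ) ≃L[ℝ] ℂ), ∀ a ∉ X, HasLogOn (fun x => L (x - a)) X) :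
    HasLogOn g X := by
  classical
  set Q := closedBall (0 : ℝ × ℝ) 1
  have hQ : IsCompact Q := isCompact_closedBall _ _
  have hZc : IsCompact {x ∈ Q | g x = 0} := hQ.of_isClosed_subset
    (hg.preimage_isClosed_of_isClosed isClosed_closedBall isClosed_singleton) fun x hx => hx.1
  have hZf : {x ∈ Q | g x = 0}.Finite := by
    by_contra hinf
    obtain ⟨x, hx, hacc⟩ := Set.Infinite.exists_accPt_of_subset_isCompact hinf hZc Subset.rfl
    obtain ⟨L, hL⟩ := hreg x hx.1 hx.2
    have h1 := hL.eventually_ne (c := 0) ⟨_, L.antilipschitz⟩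
    rw [accPt_iff_frequently_nhdsNE] at hacc
    obtain ⟨y, h2, h3⟩ := (hacc.and_eventually h1).exists
    exact h3 h2.2
  set Z := hZf.toFinset
  have hZ : ∀ x, x ∈ Z ↔ x ∈ Q ∧ g x = 0 := fun x => by simp [Z]
  have : Nonempty ((ℝ × ℝ) ≃L[ℝ] ℂ) := ⟨Complex.equivRealProdCLM.symm⟩
  choose! L hL using hreg
  have hL0 : ∀ a x, L a (x - a) = 0 ↔ x = a := fun a x => by
    rw [map_eq_zero_iff (L a) (L a).injective, sub_eq_zero]
  let P : ℝ × ℝ → ℂ := fun x => ∏ a ∈ Z, L a (x - a)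
  have hP0 : ∀ x, x ∉ Z → P x ≠ 0 := fun x hx => Finset.prod_ne_zero_iff.2 fun a ha h =>
    hx ((hL0 a x).1 h ▸ ha)
  let R : ℝ × ℝ → ℝ × ℝ → ℂ := fun a x => ∏ b ∈ Z.erase a, L b (x - b)
  have hR0 : ∀ a, R a a ≠ 0 := fun a => Finset.prod_ne_zero_iff.2 fun b hb h =>
    (Finset.ne_of_mem_erase hb) ((hL0 b a).1 h).symm
  have hPR : ∀ a ∈ Z, ∀ x, P x = L a (x - a) * R a x := fun a ha x =>
    (Finset.mul_prod_erase Z (fun b => L b (x - b)) ha).symm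
  have hPc : Continuous P := by fun_prop
  have hRc : ∀ a, Continuous (R a) := fun a => by fun_prop
  let v : ℝ × ℝ → ℂ := fun x => if x ∈ Z then (R x x)⁻¹ else g x / P x
  have hv0 : ∀ x ∈ Q, v x ≠ 0 := fun x hx => by
    by_cases hxZ : x ∈ Z
    · simp [v, hxZ, hR0 x]
    · simp only [v, hxZ, if_false]
      exact div_ne_zero (fun h => hxZ ((hZ x).2 ⟨hx, h⟩)) (hP0 x hxZ)
  have hvc : ContinuousOn v Q := fun x hx => by
    by_cases hxZ : x ∈ Z
    · refine ContinuousAt.continuousWithinAt ?_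
      have hnear : ∀ᶠ y in 𝓝[≠] x, v y = g y / L x (y - x) * (R x y)⁻¹ := by
        have h1 : ∀ᶠ y in 𝓝 x, y ∉ Z.erase x :=
          (Z.erase x).finite_toSet.isClosed.isOpen_compl.mem_nhds (by simp)
        filter_upwards [self_mem_nhdsWithin, h1.filter_mono nhdsWithin_le_nhds] with y hy h2
        have hyZ : y ∉ Z := fun h => h2 (Finset.mem_erase.2 ⟨hy, h⟩)
        simp only [v, hyZ, if_false, hPR x hxZ, div_eq_mul_inv, mul_inv, mul_assoc]
      rw [continuousAt_iff_punctured_nhds]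
      refine Tendsto.congr' (hnear.mono fun y hy => hy.symm) ?_
      have hvx : v x = 1 * (R x x)⁻¹ := by simp [v, hxZ]
      rw [hvx]
      refine Tendsto.mul ?_ (((hRc x).tendsto x).inv₀ (hR0 x) |>.mono_left nhdsWithin_le_nhds)
      have hx0 := ((hZ x).1 hxZ).2
      have hd := (hL x hx hx0).isLittleO
      simp only [hx0, sub_zero] at hd
      have h3 : (fun y => g y - L x (y - x)) =o[𝓝 x] fun y => L x (y - x) := by
        refine hd.trans_isBigO ?_
        exact (L x).isBigO_sub_rev (𝓝 x) x |>.congr_right fun y => rfl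
      have h4 := (h3.mono (nhdsWithin_le_nhds (s := {x}ᶜ))).tendsto_div_nhds_zero
      have h5 := h4.add_const 1
      rw [zero_add] at h5
      refine h5.congr' ?_
      filter_upwards [self_mem_nhdsWithin] with y hy
      have : L x (y - x) ≠ 0 := fun h => hy ((hL0 x y).1 h)
      field_simp
      ring
    · have hev : v =ᶠ[𝓝 x] fun y => g y / P y := by
        have h1 : ∀ᶠ y in 𝓝 x, y ∉ Z :=
          Z.finite_toSet.isClosed.isOpen_compl.mem_nhds (by simpa using hxZ)
        filter_upwards [h1] with y hy
        simp [v, hy]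
      refine ContinuousWithinAt.congr_of_eventuallyEq ?_ (hev.filter_mono nhdsWithin_le_nhds)
        hev.self_of_nhds
      exact (hg x hx).div hPc.continuousWithinAt (hP0 x hxZ)
  have hZX : ∀ a ∈ Z, a ∉ X := fun a ha haX => hgX a haX ((hZ a).1 ha).2
  refine (((hasLogOn_closedBall hvc hv0).mono hXQ).mul
    (HasLogOn.prod Z fun a ha => hX (L a) a (hZX a ha))).congr fun x hx => ?_
  have hxZ : x ∉ Z := fun h => hZX x h hx
  simp only [v, hxZ, if_false]
  exact (div_mul_cancel₀ _ (hP0 x hxZ)).symm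

theorem HasLogOn.image {α : Type*} [TopologicalSpace α] {X : Set α} (hX : IsCompact X)
    {g : α → ℂ} (hg : ContinuousOn g X) (hinj : InjOn g X) {u : ℂ → ℂ}
    (h : HasLogOn (fun x => u (g x)) X) : HasLogOn u (g '' X) := by
  obtain ⟨k, kc, ke⟩ := h
  have : CompactSpace X := isCompact_iff_compactSpace.1 hX
  let e : X ≃ g '' X := Equiv.Set.imageOfInjOn g X hinj
  have he : Continuous e := (continuousOn_iff_continuous_domRestrict.1 hg).subtype_mk _
  let E := he.homeoOfEquivCompactToT2
  classical
  have hE : ∀ y : g '' X, g (E.symm y) = y := fun y =>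
    congrArg Subtype.val (E.apply_symm_apply y)
  refine ⟨fun y => if hy : y ∈ g '' X then k (E.symm ⟨y, hy⟩) else 0, ?_, fun y hy => ?_⟩
  · rw [continuousOn_iff_continuous_domRestrict]
    refine ((continuousOn_iff_continuous_domRestrict.1 kc).comp E.symm.continuous).congr fun y => ?_
    simp [Set.domRestrict]
  · simp only [hy, dif_pos]
    refine Eq.trans ?_ (ke _ (E.symm ⟨y, hy⟩).2)
    simp only [hE]

open MeasureTheory in
/-- Sard's theorem for maps `ℝ × ℝ → ℂ`. -/
theorem exists_regular_value {g : ℝ × ℝ → ℂ} {s : Set (ℝ × ℝ)}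
    (hg : ∀ x ∈ s, DifferentiableAt ℝ g x) {E : Set ℂ} (hE : IsOpen E) (hne : E.Nonempty) :
    ∃ w ∈ E, ∀ x ∈ s, g x = w →
      ∃ L : (ℝ × ℝ) ≃L[ℝ] ℂ, HasFDerivAt g (L : (ℝ × ℝ) →L[ℝ] ℂ) x := by
  let e : ℂ ≃L[ℝ] ℝ × ℝ := Complex.equivRealProdCLM
  let D : ℝ × ℝ → (ℝ × ℝ) →L[ℝ] (ℝ × ℝ) := fun x => (e : ℂ →L[ℝ] ℝ × ℝ).comp (fderiv ℝ g x)
  let C : Set (ℝ × ℝ) := {x ∈ s | (D x).det = 0}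
  have hC : volume ((fun x => e (g x)) '' C) = 0 := by
    refine addHaar_image_eq_zero_of_det_fderivWithin_eq_zero volume (f' := D)
      (fun x hx => ?_) fun x hx => hx.2
    exact (e.hasFDerivAt.comp x (hg x hx.1).hasFDerivAt).hasFDerivWithinAt
  have hpos : 0 < volume (e '' E) :=
    (e.toHomeomorph.isOpenMap E hE).measure_pos volume (hne.image e)
  obtain ⟨y, ⟨w, hw, rfl⟩, hy⟩ : ∃ y ∈ e '' E, y ∉ (fun x => e (g x)) '' C := by
    by_contra! hcon
    exact hpos.ne' (measure_mono_null hcon hC)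
  refine ⟨w, hw, fun x hx hgx => ?_⟩
  have hdet : (D x).det ≠ 0 := fun h => hy ⟨x, ⟨hx, h⟩, by simp [hgx]⟩
  let A := (D x).toContinuousLinearEquivOfDetNeZero hdet
  refine ⟨A.trans e.symm, ?_⟩
  convert (hg x hx).hasFDerivAt using 1
  ext <;> simp [A, D]

/-- A real quadratic polynomial in one coordinate peaking over its centre, which vanishes nowhere
off `ℝ` and is at most `1` on a given compactum over `ℝ`. -/
theorem exists_peaking_quadratic {K : Set (Fin 2 → ℂ)} (hK : IsCompact K)
    (hKM : ∀ y ∈ K, (y 0).im = 0) (c : ℝ) :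
    ∃ δ : ℝ, 0 < δ ∧ ∀ y ∈ K,
      ‖1 - (δ : ℂ) * (y 0 - c) ^ 2‖ = 1 - δ * ((y 0).re - c) ^ 2 := by
  obtain ⟨B, hB⟩ := hK.exists_bound_of_continuousOn (f := fun y => ((y 0).re - c) ^ 2)
    (by fun_prop)
  refine ⟨(max B 1)⁻¹, by positivity, fun y hy => ?_⟩
  have hy0 : y 0 = ((y 0).re : ℂ) := Complex.ext rfl (by simp [hKM y hy])
  have h1 : ((y 0).re - c) ^ 2 ≤ max B 1 :=
    ((Real.le_norm_self _).trans (hB y hy)).trans (le_max_left _ _)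
  have h2 : (max B 1)⁻¹ * ((y 0).re - c) ^ 2 ≤ 1 := by
    rw [inv_mul_le_iff₀ (by positivity)]; linarith
  rw [hy0]
  norm_cast
  exact Real.norm_of_nonneg (by linarith)

open MvPolynomial in
/-- The hull of a compactum in `ℝ × ℂ` stays in `ℝ × ℂ`. -/
theorem im_eq_zero_of_mem_polyHull {K : Set (Fin 2 → ℂ)} (hK : IsCompact K)
    (hKM : ∀ y ∈ K, (y 0).im = 0) {z : Fin 2 → ℂ} (hz : z ∈ polyHull 2 K) : (z 0).im = 0 := by
  obtain ⟨δ, hδ, h⟩ := exists_peaking_quadratic hK hKM (z 0).re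
  have h1 := hz (1 - C (δ : ℂ) * (X 0 - C ((z 0).re : ℂ)) ^ 2)
  simp only [map_sub, map_one, map_mul, map_pow, eval_C, eval_X] at h1
  have h2 : z 0 - (z 0).re = (z 0).im * Complex.I := by
    rw [sub_eq_iff_eq_add']; exact (Complex.re_add_im _).symm
  have h3 : 1 - (δ : ℂ) * (z 0 - (z 0).re) ^ 2 = ((1 + δ * (z 0).im ^ 2 : ℝ) : ℂ) := by
    rw [h2, mul_pow, Complex.I_sq]; push_cast; ring
  rw [h3, Complex.norm_real, Real.norm_of_nonneg (by positivity)] at h1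
  have h4 : 1 + δ * (z 0).im ^ 2 ≤ 1 := h1.trans <| by
    refine Real.sSup_le ?_ zero_le_one
    rintro _ ⟨y, hy, rfl⟩
    dsimp only
    rw [h y hy]
    linarith [mul_nonneg hδ.le (sq_nonneg ((y 0).re - (z 0).re))]
  have h5 : (z 0).im ^ 2 ≤ 0 := by
    by_contra! h6
    linarith [mul_pos hδ h6]
  exact pow_eq_zero_iff two_ne_zero |>.1 (le_antisymm h5 (sq_nonneg _))

open MvPolynomial in
/-- Polynomials separate a point of `ℝ × ℂ` from a compactum `K ⊆ ℝ × ℂ` as soon as they separate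
it from the fibre of `K` through this point. -/
theorem notMem_polyHull_of_fibre {K : Set (Fin 2 → ℂ)} (hK : IsCompact K)
    (hKM : ∀ y ∈ K, (y 0).im = 0) {z : Fin 2 → ℂ} (hz : (z 0).im = 0) {q : Polynomial ℂ}
    (hqz : q.eval (z 1) = 1) (hq : ∀ y ∈ K, y 0 = z 0 → ‖q.eval (y 1)‖ ≤ 1 / 2) :
    z ∉ polyHull 2 K := by
  intro hzK
  obtain ⟨δ, hδ, h⟩ := exists_peaking_quadratic hK hKM (z 0).re
  have hz0 : z 0 = ((z 0).re : ℂ) := Complex.ext rfl (by simp [hz])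
  have hqc : Continuous fun y : Fin 2 → ℂ => ‖q.eval (y 1)‖ := by fun_prop
  let K' : Set (Fin 2 → ℂ) := {y ∈ K | 3 / 4 ≤ ‖q.eval (y 1)‖}
  have hK' : IsCompact K' := hK.inter_right (isClosed_le continuous_const hqc)
  have hr0 : ∀ y ∈ K, 0 ≤ 1 - δ * ((y 0).re - (z 0).re) ^ 2 := fun y hy =>
    h y hy ▸ norm_nonneg _
  have hr1 : ∀ y ∈ K, 1 - δ * ((y 0).re - (z 0).re) ^ 2 ≤ 1 := fun y hy => by
    linarith [mul_nonneg hδ.le (sq_nonneg ((y 0).re - (z 0).re))]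
  obtain ⟨ρ, hρ0, hρ1, hρ⟩ : ∃ ρ : ℝ, 0 ≤ ρ ∧ ρ < 1 ∧
      ∀ y ∈ K', 1 - δ * ((y 0).re - (z 0).re) ^ 2 ≤ ρ := by
    rcases K'.eq_empty_or_nonempty with he | hne
    · exact ⟨0, le_rfl, zero_lt_one, by simp [he]⟩
    · obtain ⟨y, hy, hmax⟩ := hK'.exists_isMaxOn hne
        (f := fun y => 1 - δ * ((y 0).re - (z 0).re) ^ 2) (by fun_prop)
      refine ⟨_, hr0 y hy.1, (hr1 y hy.1).lt_of_ne fun h1 => ?_, fun x hx => hmax hx⟩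
      have h2 : ((y 0).re - (z 0).re) ^ 2 = 0 := by simpa [hδ.ne'] using h1
      have h3 : (y 0).re = (z 0).re := sub_eq_zero.1 (pow_eq_zero_iff two_ne_zero |>.1 h2)
      have h4 := hq y hy.1 (Complex.ext h3 (by rw [hKM y hy.1, hz]))
      linarith [hy.2]
  obtain ⟨B, hB⟩ := hK.exists_bound_of_continuousOn (f := fun y => ‖q.eval (y 1)‖)
    hqc.continuousOn
  obtain ⟨N, hN⟩ : ∃ N : ℕ, ρ ^ N * B < 3 / 4 := by
    have := (tendsto_pow_atTop_nhds_zero_of_lt_one hρ0 hρ1).mul_const B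
    rw [zero_mul] at this
    exact (this.eventually_lt_const (by norm_num)).exists
  have h1 := hzK ((1 - C (δ : ℂ) * (X 0 - C ((z 0).re : ℂ)) ^ 2) ^ N * Polynomial.aeval (X 1) q)
  have hev : ∀ y : Fin 2 → ℂ, eval y (Polynomial.aeval (X 1) q) = q.eval (y 1) := fun y => by
    rw [Polynomial.aeval_def, Polynomial.hom_eval₂, eval_X]
    have : (eval y).comp (algebraMap ℂ (MvPolynomial (Fin 2) ℂ)) = RingHom.id ℂ := by
      ext i; simp [algebraMap_eq]
    rw [this, Polynomial.eval₂_id]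
  simp only [map_sub, map_one, map_mul, map_pow, eval_C, eval_X, hev, hqz, norm_mul, norm_pow] at h1
  rw [← hz0] at h1
  simp only [sub_self, ne_eq, OfNat.ofNat_ne_zero, not_false_eq_true, zero_pow, mul_zero, sub_zero,
    norm_one, one_pow, mul_one] at h1
  have h2 : (1 : ℝ) ≤ 3 / 4 := h1.trans <| by
    refine Real.sSup_le ?_ (by norm_num)
    rintro _ ⟨y, hy, rfl⟩
    dsimp only
    rw [hz0, h y hy]
    by_cases hyK : y ∈ K'
    · calc _ ≤ ρ ^ N * B := by
            gcongr
            · exact hr0 y hy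
            · exact hρ y hyK
            · simpa using hB y hy
        _ ≤ 3 / 4 := hN.le
    · have h3 : ‖q.eval (y 1)‖ ≤ 3 / 4 := le_of_not_ge fun h4 => hyK ⟨hy, h4⟩
      calc _ ≤ 1 * (3 / 4 : ℝ) := by
            gcongr
            exact pow_le_one₀ (hr0 y hy) (hr1 y hy)
        _ = 3 / 4 := one_mul _
  norm_num at h2

/-- The first coordinate of a totally real immersion into `ℝ × ℂ` has no local extrema. -/
theorem not_isLocalExtr_re {φ : ℝ × ℝ → (Fin 2 → ℂ)} {x : ℝ × ℝ} (hd : DifferentiableAt ℝ φ x)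
    (hreal : ∀ᶠ y in 𝓝 x, (φ y 0).im = 0) (hinj : Function.Injective (fderiv ℝ φ x))
    (htr : ∀ v w, fderiv ℝ φ x v = Complex.I • fderiv ℝ φ x w → fderiv ℝ φ x v = 0) :
    ¬ IsLocalExtr (fun y => (φ y 0).re) x := by
  intro hext
  set D := fderiv ℝ φ x
  have h0 : HasFDerivAt (fun y => φ y 0) ((ContinuousLinearMap.proj 0).comp D) x :=
    hasFDerivAt_pi'.1 hd.hasFDerivAt 0
  have hre : ∀ v, (D v 0).re = 0 := fun v => DFunLike.congr_fun
    (hext.hasFDerivAt_eq_zero (Complex.reCLM.hasFDerivAt.comp x h0)) v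
  have him : ∀ v, (D v 0).im = 0 := fun v => by
    have h1 : HasFDerivAt (fun y => (φ y 0).im) (0 : (ℝ × ℝ) →L[ℝ] ℝ) x :=
      (hasFDerivAt_const (0 : ℝ) x).congr_of_eventuallyEq hreal
    exact DFunLike.congr_fun ((Complex.imCLM.hasFDerivAt.comp x h0).unique h1) v
  have hD0 : ∀ v, D v 0 = 0 := fun v => Complex.ext (hre v) (him v)
  let T : (ℝ × ℝ) →ₗ[ℝ] ℂ :=
    ((ContinuousLinearMap.proj (R := ℝ) (φ := fun _ : Fin 2 => ℂ) 1).comp D :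
      (ℝ × ℝ) →L[ℝ] ℂ)
  have hT : ∀ v, T v = D v 1 := fun v => rfl
  have hTinj : Function.Injective T := fun v w hvw => hinj <| by
    ext i
    fin_cases i
    · simp [hD0]
    · exact hvw
  have hTsurj : Function.Surjective T :=
    (LinearMap.injective_iff_surjective_of_finrank_eq_finrank (by simp)).1 hTinj
  obtain ⟨w, hw⟩ := hTsurj 1
  obtain ⟨v, hv⟩ := hTsurj Complex.I
  have h2 : D v = 0 := htr v w <| by
    ext i
    fin_cases i
    · simp [hD0]
    · simp [← hT, hw, hv]
  exact Complex.I_ne_zero (by rw [← hv, hT, h2]; rfl)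

/-- Every totally real `C²`-smooth disc contained in
`M = ℝ × ℂ = {(z₁,z₂) ∈ ℂ² : Im z₁ = 0}` is polynomially convex. -/
theorem totallyRealDisc_in_R_cross_C_polyConvex
    (M : Set (Fin 2 → ℂ)) (hM : M = {z : Fin 2 → ℂ | (z 0).im = 0})
    (K : Set (Fin 2 → ℂ)) (hK : TotallyRealDisc 2 K) (hKM : K ⊆ M) :
    PolyConvex 2 K := by
  obtain ⟨U, φ, hU, hQU, hφ, hinj, himm, htr, rfl⟩ := hK
  subst hM
  set Q := closedBall (0 : ℝ × ℝ) 1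
  have hφQ : ∀ x ∈ Q, DifferentiableAt ℝ φ x := fun x hx =>
    (hφ.differentiableOn (by simp)).differentiableAt (hU.mem_nhds (hQU hx))
  have hφc : ContinuousOn φ Q := fun x hx => (hφQ x hx).continuousAt.continuousWithinAt
  have hQ : IsCompact Q := isCompact_closedBall _ _
  have hK : IsCompact (φ '' Q) := hQ.image_of_continuousOn hφc
  have him : ∀ y ∈ φ '' Q, (y 0).im = 0 := fun y hy => hKM hy
  refine Subset.antisymm (fun z hz => ?_) fun z hz p =>
    le_csSup (hK.bddAbove_image p.continuous_eval.norm.continuousOn) ⟨z, hz, rfl⟩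
  by_contra hzK
  have hz0 := im_eq_zero_of_mem_polyHull hK him hz
  let f : ℝ × ℝ → ℝ := fun x => (φ x 0).re
  let g : ℝ × ℝ → ℂ := fun x => φ x 1
  let X : Set (ℝ × ℝ) := {x ∈ Q | f x = (z 0).re}
  have hfc : ContinuousOn f Q := by fun_prop
  have hgc : ContinuousOn g Q := by fun_prop
  have hXQ : X ⊆ Q := fun x hx => hx.1
  have hX : IsCompact X := hQ.of_isClosed_subset
    (hfc.preimage_isClosed_of_isClosed isClosed_closedBall isClosed_singleton) hXQ
  have hX0 : ∀ x ∈ X, φ x 0 = z 0 := fun x hx =>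
    Complex.ext hx.2 (by rw [him _ (mem_image_of_mem φ hx.1), hz0])
  have hgX : InjOn g X := fun x hx y hy hxy => hinj (hQU hx.1) (hQU hy.1) <| by
    ext i
    fin_cases i
    · exact (hX0 x hx).trans (hX0 y hy).symm
    · exact hxy
  have hcrit : ∀ x ∈ interior Q, ¬ IsLocalExtr f x := fun x hx => by
    have hxQ := interior_subset hx
    refine not_isLocalExtr_re (hφQ x hxQ) ?_ (himm x (hQU hxQ)) (htr x (hQU hxQ))
    filter_upwards [isOpen_interior.mem_nhds hx] with y hy
    exact him _ (mem_image_of_mem φ (interior_subset hy))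
  obtain ⟨q, hq1, hq2⟩ := exists_polynomial_eval_eq_one (hX.image_of_continuousOn (hgc.mono hXQ))
    (w := z 1) (fun E hEo hEne hEX => by
      obtain ⟨w, hwE, hw⟩ := exists_regular_value (g := g) (s := Q)
        (fun x hx => differentiableAt_pi.1 (hφQ x hx) 1) hEo hEne
      refine ⟨w, hwE, HasLogOn.image hX (hgc.mono hXQ) hgX ?_⟩
      refine hasLogOn_of_nondegenerate_zeros (hgc.sub continuousOn_const) (fun x hx hx0 => ?_) hXQ
        (fun x hx hx0 => ?_) fun L a ha => hasLogOn_levelSet hfc hcrit _ L ha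
      · obtain ⟨L, hL⟩ := hw x hx (sub_eq_zero.1 hx0)
        exact ⟨L, hL.sub_const w⟩
      · exact hEX.notMem_of_mem_left hwE ⟨x, hx, sub_eq_zero.1 hx0⟩)
    (by
      rintro ⟨x, hx, hxz⟩
      refine hzK ⟨x, hx.1, ?_⟩
      ext i
      fin_cases i
      · exact hX0 x hx
      · exact hxz)
  refine notMem_polyHull_of_fibre hK him hz0 hq1 ?_ hz
  rintro _ ⟨x, hx, rfl⟩ hx0
  exact hq2 _ ⟨x, ⟨hx, congrArg Complex.re hx0⟩, rfl⟩
end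
end
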